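/- For every integer k ≥ 3, the packing number A(24k+11,4,4) equals the Johnson bound J(24k+11,4,4); equivalently, setting n = 24k+11, A(n,4,4) = (n³ − 4n² + n − 18)/24. -/

import Mathlib

/-- A 3-(n,4,1) packing design (packing quadruple system PQS(n)) on the point
set `Fin n`: a collection of 4-element blocks such that every 3-element subset
of points is contained in at most one block. -/
def IsPQS (n : ℕ) (B : Finset (Finset (Fin n))) : Prop :=
  (∀ b ∈ B, b.card = 4) ∧
  ∀ t : Finset (Fin n), t.card = 3 → (B.filter (fun b => t ⊆ b)).card ≤ 1

/-- The packing number A(n,4,4): the maximum number of blocks in a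
3-(n,4,1) packing design. -/
noncomputable def packingNumber (n : ℕ) : ℕ :=
  sSup {N | ∃ B : Finset (Finset (Fin n)), IsPQS n B ∧ B.card = N}

/-- The Johnson bound J(n,4,4). -/
def johnsonBound (n : ℕ) : ℕ :=
  if n % 6 = 0 then n * ((n - 1) * ((n - 2) / 2) / 3) / 4 - 1
  else n * ((n - 1) * ((n - 2) / 2) / 3) / 4

/-- `Dec T`: the triples satisfying `T` can be partitioned into quadruples: there is a symmetric
quaternary relation `Q` such that `T x y z` holds iff `Q x y z w` for some `w`, which is then
unique. -/
def Dec {α : Type*} (T : α → α → α → Prop) : Prop :=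
  ∃ Q : α → α → α → α → Prop,
    (∀ x y z w, Q x y z w → Q y x z w ∧ Q x z y w ∧ Q x y w z) ∧
    (∀ x y z w w', Q x y z w → Q x y z w' → w = w') ∧
    ∀ x y z, T x y z ↔ ∃ w, Q x y z w

namespace Dec

variable {α β ι : Type*} {T : α → α → α → Prop}

theorem congr {T' : α → α → α → Prop} (h : Dec T) (e : ∀ x y z, T' x y z ↔ T x y z) : Dec T' := by
  obtain ⟨Q, h1, h2, h3⟩ := h
  exact ⟨Q, h1, h2, fun x y z => (e x y z).trans (h3 x y z)⟩

theorem of_forall_not (h : ∀ x y z, ¬ T x y z) : Dec T :=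
  ⟨fun _ _ _ _ => False, by simp, by simp, by simpa using h⟩

/-- A disjoint union of decomposable relations is decomposable. -/
theorem iUnion (R : ι → α → α → α → Prop) (h : ∀ i, Dec (R i))
    (hT : ∀ x y z, T x y z ↔ ∃ i, R i x y z)
    (disj : ∀ i j x y z, R i x y z → R j x y z → i = j) : Dec T := by
  choose Q h1 h2 h3 using h
  refine ⟨fun x y z w => ∃ i, Q i x y z w, ?_, ?_, ?_⟩
  · rintro x y z w ⟨i, hi⟩
    obtain ⟨a, b, c⟩ := h1 i x y z w hi
    exact ⟨⟨i, a⟩, ⟨i, b⟩, ⟨i, c⟩⟩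
  · rintro x y z w w' ⟨i, hi⟩ ⟨j, hj⟩
    obtain rfl := disj i j x y z ((h3 i x y z).2 ⟨w, hi⟩) ((h3 j x y z).2 ⟨w', hj⟩)
    exact h2 i x y z w w' hi hj
  · intro x y z
    rw [hT]
    constructor
    · rintro ⟨i, hi⟩
      obtain ⟨w, hw⟩ := (h3 i x y z).1 hi
      exact ⟨w, i, hw⟩
    · rintro ⟨w, i, hw⟩
      exact ⟨i, (h3 i x y z).2 ⟨w, hw⟩⟩

theorem or {T₁ T₂ : α → α → α → Prop} (h₁ : Dec T₁) (h₂ : Dec T₂)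
    (hT : ∀ x y z, T x y z ↔ T₁ x y z ∨ T₂ x y z)
    (disj : ∀ x y z, T₁ x y z → ¬ T₂ x y z) : Dec T := by
  refine iUnion (fun b : Bool => if b then T₁ else T₂) ?_ ?_ ?_
  · rintro (_ | _) <;> simpa
  · simp [hT, or_comm]
  · rintro (_ | _) (_ | _) x y z hx hy
    · rfl
    · exact absurd hx (disj x y z hy)
    · exact absurd hy (disj x y z hx)
    · rfl

/-- A relation living on the range of an injection is decomposable if its pullback is. -/
theorem of_comap (φ : β → α) (hφ : Function.Injective φ)
    (hT : ∀ x y z, T x y z → x ∈ Set.range φ ∧ y ∈ Set.range φ ∧ z ∈ Set.range φ)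
    (h : Dec fun a b c => T (φ a) (φ b) (φ c)) : Dec T := by
  obtain ⟨Q, h1, h2, h3⟩ := h
  refine ⟨fun x y z w => ∃ a b c d, φ a = x ∧ φ b = y ∧ φ c = z ∧ φ d = w ∧ Q a b c d, ?_, ?_, ?_⟩
  · rintro _ _ _ _ ⟨a, b, c, d, rfl, rfl, rfl, rfl, hq⟩
    obtain ⟨p, q, r⟩ := h1 _ _ _ _ hq
    exact ⟨⟨_, _, _, _, rfl, rfl, rfl, rfl, p⟩, ⟨_, _, _, _, rfl, rfl, rfl, rfl, q⟩,
      ⟨_, _, _, _, rfl, rfl, rfl, rfl, r⟩⟩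
  · rintro _ _ _ _ _ ⟨a, b, c, d, rfl, rfl, rfl, rfl, hq⟩ ⟨a', b', c', d', e1, e2, e3, rfl, hq'⟩
    obtain rfl := hφ e1
    obtain rfl := hφ e2
    obtain rfl := hφ e3
    rw [h2 _ _ _ _ _ hq hq']
  · intro x y z
    constructor
    · intro ht
      obtain ⟨⟨a, rfl⟩, ⟨b, rfl⟩, ⟨c, rfl⟩⟩ := hT x y z ht
      obtain ⟨w, hw⟩ := (h3 a b c).1 ht
      exact ⟨φ w, a, b, c, w, rfl, rfl, rfl, rfl, hw⟩
    · rintro ⟨w, a, b, c, d, rfl, rfl, rfl, rfl, hq⟩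
      exact (h3 a b c).2 ⟨d, hq⟩

theorem of_equiv (e : β ≃ α) (h : Dec fun a b c => T (e a) (e b) (e c)) : Dec T :=
  of_comap e e.injective (fun x y z _ => ⟨e.surjective x, e.surjective y, e.surjective z⟩) h

/-- Giving weight `B` to every point. -/
theorem prod (h : Dec T) (B : Type*) [AddCommGroup B] :
    Dec fun x y z : α × B => T x.1 y.1 z.1 := by
  obtain ⟨Q, h1, h2, h3⟩ := h
  refine ⟨fun x y z w => Q x.1 y.1 z.1 w.1 ∧ x.2 + y.2 + z.2 + w.2 = 0, ?_, ?_, ?_⟩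
  · rintro x y z w ⟨hq, hs⟩
    obtain ⟨p, q, r⟩ := h1 _ _ _ _ hq
    refine ⟨⟨p, ?_⟩, ⟨q, ?_⟩, ⟨r, ?_⟩⟩ <;> rw [← hs] <;> abel
  · rintro x y z ⟨w, c⟩ ⟨w', c'⟩ ⟨hq, hs⟩ ⟨hq', hs'⟩
    obtain rfl := h2 _ _ _ _ _ hq hq'
    rw [← hs'] at hs
    simpa using hs
  · rintro ⟨x, a⟩ ⟨y, b⟩ ⟨z, c⟩
    simp only [h3]
    constructor
    · rintro ⟨w, hw⟩
      exact ⟨(w, -(a + b + c)), hw, by simp⟩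
    · rintro ⟨w, hw, -⟩
      exact ⟨w.1, hw⟩

end Dec

/-- The graph with adjacency `A` has a one-factorization, with factors given by involutions. -/
def OneFact {Z : Type} (A : Z → Z → Prop) : Prop :=
  ∃ (κ : Type) (σ : κ → Z → Z), (∀ c x, σ c (σ c x) = x) ∧ (∀ x y, A x y ↔ ∃ c, σ c x = y) ∧
    ∀ c c' x, σ c x = σ c' x → c = c'

namespace OneFact

theorem congr {Z : Type} {A A' : Z → Z → Prop} (h : OneFact A) (e : ∀ x y, A' x y ↔ A x y) :
    OneFact A' := by
  obtain ⟨κ, σ, h1, h2, h3⟩ := h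
  exact ⟨κ, σ, h1, fun x y => (e x y).trans (h2 x y), h3⟩

theorem or {Z : Type} {A A₁ A₂ : Z → Z → Prop} (h₁ : OneFact A₁) (h₂ : OneFact A₂)
    (e : ∀ x y, A x y ↔ A₁ x y ∨ A₂ x y) (disj : ∀ x y, A₁ x y → ¬ A₂ x y) : OneFact A := by
  obtain ⟨κ, σ, a1, a2, a3⟩ := h₁
  obtain ⟨τ, ρ, b1, b2, b3⟩ := h₂
  refine ⟨κ ⊕ τ, Sum.elim σ ρ, ?_, ?_, ?_⟩
  · rintro (c | c) x
    · exact a1 c x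
    · exact b1 c x
  · intro x y
    simp [e, a2, b2]
  · rintro (c | c) (c' | c') x h
    · exact congrArg _ (a3 _ _ _ h)
    · exact absurd ((b2 _ _).2 ⟨c', rfl⟩) (disj x _ ((a2 _ _).2 ⟨c, h⟩))
    · exact absurd ((b2 _ _).2 ⟨c, h⟩) (disj x _ ((a2 _ _).2 ⟨c', rfl⟩))
    · exact congrArg _ (b3 _ _ _ h)

theorem of_equiv {Z Y : Type} {A : Z → Z → Prop} (e : Y ≃ Z) (h : OneFact fun x y => A (e x) (e y)) :
    OneFact A := by
  obtain ⟨κ, σ, h1, h2, h3⟩ := h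
  refine ⟨κ, fun c x => e (σ c (e.symm x)), ?_, ?_, ?_⟩
  · intro c x
    simp [h1]
  · intro x y
    have := h2 (e.symm x) (e.symm y)
    simp only [Equiv.apply_symm_apply] at this
    rw [this]
    simp [Equiv.eq_symm_apply]
  · intro c c' x h
    exact h3 c c' _ (e.injective h)

/-- The complete graph on an even number of points. -/
theorem complete_option (v : ℕ) : OneFact fun x y : Option (ZMod (2 * v + 1)) => x ≠ y := by
  have two : ∀ x y : ZMod (2 * v + 1), x + x = y + y → x = y := by
    intro x y h
    have hu : IsUnit (2 : ZMod (2 * v + 1)) := by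
      have := (ZMod.isUnit_iff_coprime 2 (2 * v + 1)).2 (by simp)
      exact_mod_cast this
    rw [← two_mul, ← two_mul] at h
    exact hu.mul_left_cancel h
  have half : ∀ c : ZMod (2 * v + 1), ∃ x, x + x = c := by
    have := Finite.surjective_of_injective (f := fun x : ZMod (2 * v + 1) => x + x)
      (fun x y h => two x y h)
    exact this
  choose f hf using half
  have hf' : ∀ x, f (x + x) = x := fun x => two _ _ (hf _)
  refine ⟨ZMod (2 * v + 1), fun c x => x.elim (some (f c)) fun x => if x + x = c then none else
    some (c - x), ?_, ?_, ?_⟩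
  · rintro c (_ | x)
    · simp [hf]
    · by_cases h : x + x = c
      · subst h
        simp [hf']
      · have : ¬ (c - x + (c - x) = c) := fun h' => h (by linear_combination -h')
        simp [h, this]
  · rintro (_ | x) (_ | y)
    · simp
    · simp only [ne_eq, reduceCtorEq, not_false_eq_true, Option.elim_none, Option.some.injEq,
        true_iff]
      exact ⟨y + y, hf' y⟩
    · simp
    · constructor
      · intro h
        refine ⟨x + y, ?_⟩
        have : ¬ (x + x = x + y) := fun h' => h (by rw [add_left_cancel h'])
        simp [this]
      · rintro ⟨c, hc⟩ h
        simp only [Option.some.injEq] at h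
        subst h
        by_cases h : x + x = c
        · simp [h] at hc
        · simp only [Option.elim_some, h, if_false, Option.some.injEq] at hc
          exact h (by linear_combination -hc)
  · rintro c c' (_ | x) h
    · simp only [Option.elim_none, Option.some.injEq] at h
      rw [← hf c, ← hf c', h]
    · simp only [Option.elim_some] at h
      split_ifs at h with h1 h2 h2
      · rw [← h1, h2]
      · simpa using h

theorem complete {Z : Type} [Fintype Z] (h : Even (Fintype.card Z)) :
    OneFact fun x y : Z => x ≠ y := by
  classical
  obtain ⟨v, hv⟩ := h
  rcases v with _ | v
  · have : IsEmpty Z := Fintype.card_eq_zero_iff.1 (by simpa using hv)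
    exact ⟨Empty, fun c => c.elim, fun c => c.elim, fun x => isEmptyElim x, fun c => c.elim⟩
  · have e : Option (ZMod (2 * v + 1)) ≃ Z := Fintype.equivOfCardEq (by
      rw [Fintype.card_option, ZMod.card, hv]; ring)
    exact of_equiv e ((complete_option v).congr fun x y => by simp)

end OneFact

/-- Quadruples formed by two edges of the same factor in two different copies of the vertex set. -/
theorem Dec.of_oneFact {ι U : Type} {A : U → U → Prop} (h : OneFact A) :
    Dec fun p q r : ι × U => (p.1 = q.1 ∧ r.1 ≠ p.1 ∧ A p.2 q.2) ∨
      (p.1 = r.1 ∧ q.1 ≠ p.1 ∧ A p.2 r.2) ∨ (q.1 = r.1 ∧ p.1 ≠ q.1 ∧ A q.2 r.2) := by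
  obtain ⟨κ, σ, h1, h2, h3⟩ := h
  have hs : ∀ c x y, σ c x = y → σ c y = x := fun c x y h => h ▸ h1 c x
  let P : ι × U → ι × U → ι × U → ι × U → Prop := fun p q r w =>
    p.1 = q.1 ∧ r.1 = w.1 ∧ p.1 ≠ r.1 ∧ ∃ c, σ c p.2 = q.2 ∧ σ c r.2 = w.2
  have P1 : ∀ p q r w, P p q r w → P q p r w := fun p q r w ⟨a, b, c, d, e, f⟩ =>
    ⟨a.symm, b, a ▸ c, d, hs _ _ _ e, f⟩
  have P2 : ∀ p q r w, P p q r w → P r w p q := fun p q r w ⟨a, b, c, d, e, f⟩ =>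
    ⟨b, a, c.symm, d, f, e⟩
  have P3 : ∀ p q r w, P p q r w → P p q w r := fun p q r w h => P2 _ _ _ _ (P1 _ _ _ _ (P2 _ _ _ _ h))
  refine ⟨fun p q r w => P p q r w ∨ P p r q w ∨ P q r p w, ?_, ?_, ?_⟩
  · rintro p q r w (h | h | h)
    · exact ⟨.inl (P1 _ _ _ _ h), .inr (.inl h), .inl (P3 _ _ _ _ h)⟩
    · exact ⟨.inr (.inr h), .inl h, .inr (.inr (P2 _ _ _ _ h))⟩
    · exact ⟨.inr (.inl h), .inr (.inr (P1 _ _ _ _ h)), .inr (.inl (P2 _ _ _ _ h))⟩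
  · have key : ∀ p q r w w', P p q r w → P p q r w' → w = w' := by
      rintro p q r w w' ⟨a, b, c, d, e, f⟩ ⟨a', b', c', d', e', f'⟩
      obtain rfl := h3 d d' p.2 (e.trans e'.symm)
      exact Prod.ext (b.symm.trans b') (f.symm.trans f')
    have ex : ∀ p q r w p' q' r' w', P p q r w → P p' q' r' w' → p.1 = q.1 ∧ p.1 ≠ r.1 ∧
        p'.1 = q'.1 ∧ p'.1 ≠ r'.1 := fun _ _ _ _ _ _ _ _ h h' => ⟨h.1, h.2.2.1, h'.1, h'.2.2.1⟩
    rintro p q r w w' (h | h | h) (h' | h' | h')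
    all_goals try exact key _ _ _ _ _ h h'
    all_goals
      obtain ⟨a, b, c, d⟩ := ex _ _ _ _ _ _ _ _ h h'
      exfalso
      clear_value P
      clear h h' ex key P1 P2 P3 h1 h2 h3 hs
      simp_all
  · have key : ∀ p q r, (p.1 = q.1 ∧ r.1 ≠ p.1 ∧ A p.2 q.2) ↔ ∃ w, P p q r w := by
      intro p q r
      rw [h2]
      constructor
      · rintro ⟨a, b, c, d⟩
        exact ⟨(r.1, σ c r.2), a, rfl, b.symm, c, d, rfl⟩
      · rintro ⟨w, a, b, c, d, e, f⟩
        exact ⟨a, c.symm, d, e⟩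
    intro p q r
    beta_reduce
    rw [key p q r, key p r q, key q r p]
    simp only [exists_or]

theorem Dec.of_transversal {α Z : Type} [AddCommGroup Z] (p : α → Fin 4) (v : α → Z)
    (inj : ∀ x y, p x = p y → v x = v y → x = y) :
    Dec fun x y z : α => ∃ w, (p x ≠ p y ∧ p x ≠ p z ∧ p x ≠ p w ∧ p y ≠ p z ∧ p y ≠ p w ∧
      p z ≠ p w) ∧ v x + v y + v z + v w = 0 := by
  refine ⟨_, ?_, ?_, fun x y z => Iff.rfl⟩
  · rintro x y z w ⟨⟨a, b, c, d, e, f⟩, s⟩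
    refine ⟨⟨⟨a.symm, d, e, b, c, f⟩, ?_⟩, ⟨⟨b, a, c, d.symm, f, e⟩, ?_⟩,
      ⟨⟨a, c, b, e, d, f.symm⟩, ?_⟩⟩ <;> rw [← s] <;> abel
  · rintro x y z w w' ⟨h, s⟩ ⟨h', s'⟩
    refine inj _ _ ?_ ?_
    · clear s s'
      generalize p x = a at *
      generalize p y = b at *
      generalize p z = c at *
      generalize p w = d at *
      generalize p w' = e at *
      omega
    · exact add_left_cancel (s.trans s'.symm)

section Tripling

variable {Z : Type} [AddCommGroup Z]

/-- Quadruples with two points in one part and one point in each of the other two parts. -/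
theorem Dec.of_classes (cls : Z → Option (Fin 3)) (K : Fin 3 → Z) (Δ : Z → Prop)
    (hK : ∀ i d, cls d = some i → cls (K i - d) = some i)
    (hΔ : ∀ i d, cls d = some i → Δ (d + d - K i))
    (hΔ' : ∀ i δ, Δ δ → ∃ d, cls d = some i ∧ d + d - K i = δ)
    (inj : ∀ i d d', cls d = some i → cls d' = some i → d + d = d' + d' → d = d') :
    Dec fun x y z : Fin 3 × Z => (x.1 ≠ y.1 ∧ x.1 ≠ z.1 ∧ y.1 ≠ z.1 ∧ cls (x.2 + y.2 + z.2) ≠ none) ∨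
      (x.1 = y.1 ∧ z.1 ≠ x.1 ∧ Δ (x.2 - y.2)) ∨ (x.1 = z.1 ∧ y.1 ≠ x.1 ∧ Δ (x.2 - z.2)) ∨
      (y.1 = z.1 ∧ x.1 ≠ y.1 ∧ Δ (y.2 - z.2)) := by
  let P : Fin 3 × Z → Fin 3 × Z → Fin 3 × Z → Fin 3 × Z → Prop := fun a b c d =>
    (a.1 = b.1 ∧ c.1 ≠ a.1 ∧ d.1 ≠ a.1 ∧ c.1 ≠ d.1) ∧ cls (a.2 + c.2 + d.2) = some a.1 ∧
      a.2 + b.2 + (c.2 + d.2) + (c.2 + d.2) = K a.1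
  have P1 : ∀ a b c d, P a b c d → P b a c d := by
    rintro ⟨i, a⟩ ⟨j, b⟩ ⟨k, c⟩ ⟨l, d⟩ ⟨⟨h1, h2, h3, h4⟩, h5, h6⟩
    dsimp only at *
    subst h1
    refine ⟨⟨rfl, h2, h3, h4⟩, ?_, ?_⟩
    · rw [← hK _ _ h5, ← h6]
      congr 1
      dsimp only
      abel
    · rw [← h6]
      dsimp only
      abel
  have P2 : ∀ a b c d, P a b c d → P a b d c := by
    rintro ⟨i, a⟩ ⟨j, b⟩ ⟨k, c⟩ ⟨l, d⟩ ⟨⟨h1, h2, h3, h4⟩, h5, h6⟩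
    dsimp only at *
    refine ⟨⟨h1, h3, h2, h4.symm⟩, ?_, ?_⟩
    · rw [← h5]
      congr 1
      dsimp only
      abel
    · rw [← h6]
      dsimp only
      abel
  have third : ∀ {i k l l' : Fin 3}, k ≠ i → l ≠ i → k ≠ l → l' ≠ i → k ≠ l' → l = l' := by decide
  have U1 : ∀ a b c d d', P a b c d → P a b c d' → d = d' := by
    rintro ⟨i, a⟩ ⟨j, b⟩ ⟨k, c⟩ ⟨l, d⟩ ⟨l', d'⟩ ⟨⟨h1, h2, h3, h4⟩, h5, h6⟩ ⟨⟨g1, g2, g3, g4⟩, g5, g6⟩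
    dsimp only at *
    obtain rfl := third h2 h3 h4 g3 g4
    have := inj _ _ _ h5 g5 (by
      have e : ∀ d, a + c + d + (a + c + d) = (a + b + (c + d) + (c + d)) + (a - b) := by
        intro d; abel
      rw [e, e, h6, g6])
    rw [add_left_cancel this]
  have U2 : ∀ a b b' c d, P a b c d → P a b' c d → b = b' := by
    rintro ⟨i, a⟩ ⟨j, b⟩ ⟨j', b'⟩ ⟨k, c⟩ ⟨l, d⟩ ⟨⟨h1, h2, h3, h4⟩, h5, h6⟩ ⟨⟨g1, g2, g3, g4⟩, g5, g6⟩
    dsimp only at *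
    subst h1 g1
    have := h6.trans g6.symm
    simpa using this
  have E1 : ∀ a b c, (a.1 = b.1 ∧ c.1 ≠ a.1 ∧ Δ (a.2 - b.2)) ↔ ∃ d, P a b c d := by
    rintro ⟨i, a⟩ ⟨j, b⟩ ⟨k, c⟩
    dsimp only
    constructor
    · rintro ⟨rfl, h1, h2⟩
      obtain ⟨s, hs, hs'⟩ := hΔ' i _ h2
      obtain ⟨l, hl, hl'⟩ : ∃ l : Fin 3, l ≠ i ∧ k ≠ l := by
        clear h2 hs hs'
        revert i k; decide
      refine ⟨(l, s - a - c), ⟨rfl, h1, hl, hl'⟩, ?_, ?_⟩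
      · rw [← hs]
        congr 1
        dsimp only
        abel
      · have : K i = s + s - (a - b) := by rw [← hs']; abel
        rw [this]
        dsimp only
        abel
    · rintro ⟨⟨l, d⟩, ⟨h1, h2, h3, h4⟩, h5, h6⟩
      dsimp only at *
      subst h1
      refine ⟨rfl, h2, ?_⟩
      have := hΔ _ _ h5
      rw [← h6] at this
      convert this using 1
      abel
  have E2 : ∀ a c d, (c.1 ≠ a.1 ∧ d.1 ≠ a.1 ∧ c.1 ≠ d.1 ∧ cls (a.2 + c.2 + d.2) = some a.1) ↔
      ∃ b, P a b c d := by
    rintro ⟨i, a⟩ ⟨k, c⟩ ⟨l, d⟩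
    dsimp only
    constructor
    · rintro ⟨h1, h2, h3, h4⟩
      refine ⟨(i, K i - a - (c + d) - (c + d)), ⟨rfl, h1, h2, h3⟩, h4, ?_⟩
      dsimp only
      abel
    · rintro ⟨b, ⟨h1, h2, h3, h4⟩, h5, h6⟩
      exact ⟨h2, h3, h4, h5⟩
  have P0 : ∀ a b c d, P a b c d → a.1 = b.1 ∧ c.1 ≠ a.1 ∧ d.1 ≠ a.1 ∧ c.1 ≠ d.1 ∧
      cls (a.2 + c.2 + d.2) = some a.1 := fun a b c d h => ⟨h.1.1, h.1.2.1, h.1.2.2.1, h.1.2.2.2, h.2.1⟩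
  clear_value P
  refine ⟨fun x y z w => P x y z w ∨ P x z y w ∨ P x w y z ∨ P y z x w ∨ P y w x z ∨ P z w x y,
    ?_, ?_, ?_⟩
  · intro x y z w h
    refine ⟨?_, ?_, ?_⟩
    · rcases h with h | h | h | h | h | h
      · exact .inl (P1 _ _ _ _ h)
      · exact .inr (.inr (.inr (.inl h)))
      · exact .inr (.inr (.inr (.inr (.inl h))))
      · exact .inr (.inl h)
      · exact .inr (.inr (.inl h))
      · exact .inr (.inr (.inr (.inr (.inr (P2 _ _ _ _ h)))))
    · rcases h with h | h | h | h | h | h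
      · exact .inr (.inl h)
      · exact .inl h
      · exact .inr (.inr (.inl (P2 _ _ _ _ h)))
      · exact .inr (.inr (.inr (.inl (P1 _ _ _ _ h))))
      · exact .inr (.inr (.inr (.inr (.inr h))))
      · exact .inr (.inr (.inr (.inr (.inl h))))
    · rcases h with h | h | h | h | h | h
      · exact .inl (P2 _ _ _ _ h)
      · exact .inr (.inr (.inl h))
      · exact .inr (.inl h)
      · exact .inr (.inr (.inr (.inr (.inl h))))
      · exact .inr (.inr (.inr (.inl h)))
      · exact .inr (.inr (.inr (.inr (.inr (P1 _ _ _ _ h)))))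
  · intro x y z w w' h h'
    have Q0 : ∀ w, (P x y z w ∨ P x z y w ∨ P x w y z ∨ P y z x w ∨ P y w x z ∨ P z w x y) →
        (P x y z w ∧ x.1 = y.1 ∧ z.1 ≠ x.1) ∨ (P x z y w ∧ x.1 = z.1 ∧ y.1 ≠ x.1) ∨
        (P x w y z ∧ y.1 ≠ x.1 ∧ z.1 ≠ x.1 ∧ y.1 ≠ z.1 ∧ cls (x.2 + y.2 + z.2) = some x.1) ∨
        (P y z x w ∧ y.1 = z.1 ∧ x.1 ≠ y.1) ∨
        (P y w x z ∧ y.1 ≠ x.1 ∧ z.1 ≠ x.1 ∧ y.1 ≠ z.1 ∧ cls (x.2 + y.2 + z.2) = some y.1) ∨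
        (P z w x y ∧ y.1 ≠ x.1 ∧ z.1 ≠ x.1 ∧ y.1 ≠ z.1 ∧ cls (x.2 + y.2 + z.2) = some z.1) := by
      rintro w (h | h | h | h | h | h)
      · exact .inl ⟨h, (P0 _ _ _ _ h).1, (P0 _ _ _ _ h).2.1⟩
      · exact .inr (.inl ⟨h, (P0 _ _ _ _ h).1, (P0 _ _ _ _ h).2.1⟩)
      · obtain ⟨-, a, b, c, d⟩ := P0 _ _ _ _ h
        exact .inr (.inr (.inl ⟨h, a, b, c, d⟩))
      · exact .inr (.inr (.inr (.inl ⟨h, (P0 _ _ _ _ h).1, (P0 _ _ _ _ h).2.1⟩)))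
      · obtain ⟨-, a, b, c, d⟩ := P0 _ _ _ _ h
        exact .inr (.inr (.inr (.inr (.inl ⟨h, a.symm, c.symm, b.symm, by rw [← d]; congr 1; abel⟩))))
      · obtain ⟨-, a, b, c, d⟩ := P0 _ _ _ _ h
        exact .inr (.inr (.inr (.inr (.inr ⟨h, c.symm, a.symm, b, by rw [← d]; congr 1; abel⟩))))
    replace h := Q0 w h
    replace h' := Q0 w' h'
    clear Q0 E1 E2 P0 P1 P2 third hK hΔ hΔ' inj
    generalize cls (x.2 + y.2 + z.2) = s at h h'
    rcases h with ⟨h, g⟩ | ⟨h, g⟩ | ⟨h, g⟩ | ⟨h, g⟩ | ⟨h, g⟩ | ⟨h, g⟩ <;>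
    rcases h' with ⟨h', g'⟩ | ⟨h', g'⟩ | ⟨h', g'⟩ | ⟨h', g'⟩ | ⟨h', g'⟩ | ⟨h', g'⟩ <;>
    first
    | exact U1 _ _ _ _ _ h h'
    | exact U2 _ _ _ _ _ h h'
    | (clear h h' U1 U2; grind)
  · intro x y z
    have e1 : x.2 + z.2 + y.2 = x.2 + y.2 + z.2 := by abel
    have e2 : y.2 + x.2 + z.2 = x.2 + y.2 + z.2 := by abel
    have e3 : z.2 + x.2 + y.2 = x.2 + y.2 + z.2 := by abel
    simp only [exists_or, ← E1, ← E2]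
    rw [e2, e3]
    clear E1 E2 P0 P1 P2 U1 U2 third hK hΔ hΔ' inj
    generalize cls (x.2 + y.2 + z.2) = s
    have : x.1 ≠ y.1 → x.1 ≠ z.1 → y.1 ≠ z.1 → s ≠ none → s = some x.1 ∨ s = some y.1 ∨
        s = some z.1 := by
      generalize x.1 = a
      generalize y.1 = b
      generalize z.1 = c
      revert a b c s
      decide
    grind


/-- Points of the canonical group-divisible designs: groups indexed by `κ`, each a copy of `A`, and
a stem `S`. -/
abbrev Pt (κ A S : Type) := κ × A ⊕ S

/-- The union of the groups whose index satisfies `h`, together with the stem. -/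
def Pt.In {κ A S : Type} (h : κ → Prop) : Pt κ A S → Prop :=
  Sum.elim (fun p => h p.1) fun _ => True

/-- Triples of distinct points neither contained in a single group together with the stem, nor in
the hole formed by the groups satisfying `h` together with the stem. -/
def CTri (κ A S : Type) (h : κ → Prop) (x y z : Pt κ A S) : Prop :=
  (x ≠ y ∧ x ≠ z ∧ y ≠ z) ∧ (∀ i, ¬(x.In (· = i) ∧ y.In (· = i) ∧ z.In (· = i))) ∧
    ¬(x.In h ∧ y.In h ∧ z.In h)

theorem Dec.lift {α β : Type} {T : α → α → α → Prop} (φ : α → β) (hφ : φ.Injective) (h : Dec T) :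
    Dec fun x y z => ∃ a b c, φ a = x ∧ φ b = y ∧ φ c = z ∧ T a b c :=
  Dec.of_comap φ hφ (by rintro x y z ⟨a, b, c, rfl, rfl, rfl, -⟩; simp)
    (h.congr fun a b c => by simp [hφ.eq_iff])

theorem Dec.tripling (cls : Z → Option (Fin 3)) (K : Fin 3 → Z) (Δ : Z → Prop)
    (hK : ∀ i d, cls d = some i → cls (K i - d) = some i)
    (hΔ : ∀ i d, cls d = some i → Δ (d + d - K i))
    (hΔ' : ∀ i δ, Δ δ → ∃ d, cls d = some i ∧ d + d - K i = δ)
    (inj : ∀ i d d', cls d = some i → cls d' = some i → d + d = d' + d' → d = d')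
    (zero : ¬ Δ 0) (hF : OneFact fun x y => x ≠ y ∧ ¬ Δ (x - y)) :
    Dec (CTri (Fin 3) Z {d // cls d = none} fun _ => False) := by
  have T2 := Dec.of_classes cls K Δ hK hΔ hΔ' inj
  have T3 := Dec.of_oneFact (ι := Fin 3) hF
  have hp : ∀ i : Fin 3, i.castSucc ≠ 3 := by decide
  have hp' : ∀ i j : Fin 3, i.castSucc ≠ j.castSucc ↔ i ≠ j := by decide
  have T1 := Dec.of_transversal (α := Pt (Fin 3) Z {d // cls d = none})
    (Sum.elim (fun x => x.1.castSucc) fun _ => 3) (Sum.elim Prod.snd fun d => -d.1) (by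
      rintro (⟨i, x⟩ | d) (⟨j, y⟩ | d') h h'
      · have h : i.castSucc = j.castSucc := h
        simpa using And.intro (by simpa using h) h'
      · exact absurd h (hp i)
      · exact absurd h.symm (hp j)
      · simpa [Subtype.ext_iff] using h')
  have T23 : Dec fun x y z : Fin 3 × Z =>
      (x.1 ≠ y.1 ∧ x.1 ≠ z.1 ∧ y.1 ≠ z.1 ∧ cls (x.2 + y.2 + z.2) ≠ none) ∨
      (x.1 = y.1 ∧ z.1 ≠ x.1 ∧ x.2 ≠ y.2) ∨ (x.1 = z.1 ∧ y.1 ≠ x.1 ∧ x.2 ≠ z.2) ∨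
      (y.1 = z.1 ∧ x.1 ≠ y.1 ∧ y.2 ≠ z.2) := by
    have zero' : ∀ x y : Z, Δ (x - y) → x ≠ y := by
      rintro x y h rfl
      exact zero (by simpa using h)
    have comb : ∀ (p q r a b c a' b' c' s : Prop), (a → a') → (b → b') → (c → c') →
        ((s ∨ (p ∧ a') ∨ (q ∧ b') ∨ (r ∧ c')) ↔ (s ∨ (p ∧ a) ∨ (q ∧ b) ∨ (r ∧ c)) ∨
          (p ∧ a' ∧ ¬a) ∨ (q ∧ b' ∧ ¬b) ∨ (r ∧ c' ∧ ¬c)) := by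
      intro p q r a b c a' b' c' s ha hb hc
      have one : ∀ p a a' : Prop, (a → a') → ((p ∧ a') ↔ (p ∧ a) ∨ (p ∧ a' ∧ ¬a)) := by
        intros
        tauto
      rw [one p a a' ha, one q b b' hb, one r c c' hc]
      clear ha hb hc one
      simp only [or_left_comm, or_comm]
    refine Dec.or T2 T3 (fun x y z => ?_) (fun x y z => ?_)
    · simpa only [and_assoc] using comb (x.1 = y.1 ∧ z.1 ≠ x.1) (x.1 = z.1 ∧ y.1 ≠ x.1)
        (y.1 = z.1 ∧ x.1 ≠ y.1) _ _ _ _ _ _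
        (x.1 ≠ y.1 ∧ x.1 ≠ z.1 ∧ y.1 ≠ z.1 ∧ cls (x.2 + y.2 + z.2) ≠ none)
        (zero' x.2 y.2) (zero' x.2 z.2) (zero' y.2 z.2)
    · clear T1 T2 T3 hF hK hΔ hΔ' inj comb zero zero' hp hp'
      generalize Δ (x.2 - y.2) = a
      generalize Δ (x.2 - z.2) = b
      generalize Δ (y.2 - z.2) = c
      rintro (⟨h1, h2, h3, -⟩ | ⟨h1, h2, h3⟩ | ⟨h1, h2, h3⟩ | ⟨h1, h2, h3⟩)
        (⟨g1, g2, -, g3⟩ | ⟨g1, g2, -, g3⟩ | ⟨g1, g2, -, g3⟩)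
      all_goals simp_all
  have T4 := Dec.lift (Sum.inl : _ → Pt (Fin 3) Z {d // cls d = none}) Sum.inl_injective T23
  have C1 : ∀ (i j k : Fin 3) (x y z : Z), (∃ w : Pt (Fin 3) Z {d // cls d = none},
      ((i.castSucc ≠ j.castSucc ∧ i.castSucc ≠ k.castSucc ∧ 
       i.castSucc ≠ w.elim (fun x => x.1.castSucc) (fun _ => 3) ∧ j.castSucc ≠ k.castSucc ∧
       j.castSucc ≠ w.elim (fun x => x.1.castSucc) (fun _ => 3) ∧ 
       k.castSucc ≠ w.elim (fun x => x.1.castSucc) (fun _ => 3)) ∧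
       x + y + z + w.elim Prod.snd (fun d => - d.1) = 0)) ↔ (i ≠ j ∧ i ≠ k ∧ j ≠ k ∧ 
         cls (x + y + z) = none) := by
    intro i j k x y z
    constructor
    · rintro ⟨⟨l, w⟩ | d, ⟨h1, h2, h3, h4, h5, h6⟩, h7⟩
      · simp only [Sum.elim_inl, hp'] at h1 h2 h3 h4 h5 h6
        omega
      · simp only [hp'] at h1 h2 h4
        refine ⟨h1, h2, h4, ?_⟩
        have : x + y + z = d.1 := by simpa [← sub_eq_add_neg, sub_eq_zero] using h7
        rw [this, d.2]
    · rintro ⟨h1, h2, h3, h4⟩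
      refine ⟨.inr ⟨_, h4⟩, ⟨(hp' _ _).2 h1, (hp' _ _).2 h2, hp _, (hp' _ _).2 h3, hp _, hp _⟩, ?_⟩
      simp
  have C2 : ∀ (a b c : Fin 4) (t : Z), a = 3 ∨ b = 3 ∨ c = 3 →
      ((∃ w : Pt (Fin 3) Z {d // cls d = none}, ((a ≠ b ∧ a ≠ c ∧
       a ≠ w.elim (fun x => x.1.castSucc) (fun _ => 3) ∧ b ≠ c ∧
       b ≠ w.elim (fun x => x.1.castSucc) (fun _ => 3) ∧
       c ≠ w.elim (fun x => x.1.castSucc) (fun _ => 3)) ∧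
       t + w.elim Prod.snd (fun d => - d.1) = 0)) ↔ (a ≠ b ∧ a ≠ c ∧ b ≠ c)) := by
    intro a b c t h
    constructor
    · rintro ⟨w, ⟨h1, h2, h3, h4, h5, h6⟩, h7⟩
      exact ⟨h1, h2, h4⟩
    · rintro ⟨h1, h2, h3⟩
      obtain ⟨l, h4, h5, h6⟩ : ∃ l : Fin 3, a ≠ l.castSucc ∧ b ≠ l.castSucc ∧ c ≠ l.castSucc := by
        revert a b c
        decide
      exact ⟨.inl (l, -t), ⟨h1, h2, h4, h3, h5, h6⟩, by simp⟩
  clear T23 hK hΔ hΔ' inj zero hF T2 T3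
  have p3 : ∀ i j k : Fin 3, i ≠ j → ∀ l, ¬ (i = l ∧ j = l) := by
    rintro i j k h l ⟨rfl, rfl⟩
    exact h rfl
  refine Dec.or T1 T4 ?_ ?_
  · rintro (⟨i, x⟩ | d) (⟨j, y⟩ | d') (⟨k, z⟩ | d'')
    · refine Iff.trans ?_ (or_congr_left (C1 i j k x y z).symm)
      simp [CTri, Pt.In]
      clear T1 T4 C1 C2 p3 hp hp'
      by_cases h1 : i = j
      · subst h1
        grind
      · by_cases h2 : i = k
        · subst h2
          grind
        · grind
    all_goals
      refine Iff.trans ?_ (or_congr_left (C2 _ _ _ _ (by simp)).symm)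
      simp only [CTri, Pt.In]
      simp [hp, (hp _).symm]
    all_goals
      clear T1 T4 C1 C2 p3 hp hp'
      grind
  · rintro (⟨i, x⟩ | d) (⟨j, y⟩ | d') (⟨k, z⟩ | d'') h
    · replace h := (C1 i j k x y z).1 h
      simp [h]
    all_goals simp

end Tripling

namespace OneFact

theorem prod {W : Type} (ι : Type) {A : W → W → Prop} (h : OneFact A) :
    OneFact fun x y : ι × W => x.1 = y.1 ∧ A x.2 y.2 := by
  obtain ⟨κ, σ, h1, h2, h3⟩ := h
  refine ⟨κ, fun c x => (x.1, σ c x.2), ?_, ?_, ?_⟩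
  · simp [h1]
  · simp [h2, Prod.ext_iff]
  · intro c c' x h
    exact h3 _ _ _ (by simpa using h)

theorem odd_differences {Z : Type} [AddCommGroup Z] (par : Z →+ ZMod 2) (E : Z → Prop)
    (hE : ∀ d, E d → E (-d)) (hodd : ∀ d, E d → par d = 1) : OneFact fun x y => E (x - y) := by
  have two : ∀ a : ZMod 2, a ≠ 0 → a = 1 := by decide
  refine ⟨{d // E d}, fun c x => if par x = 0 then x + c.1 else x - c.1, ?_, ?_, ?_⟩
  · rintro ⟨c, hc⟩ x
    have := hodd c hc
    by_cases h : par x = 0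
    · simp [h, this]
    · simp [two _ h, this]
  · intro x y
    by_cases h : par x = 0
    · simp only [h, if_true]
      constructor
      · intro hE'
        exact ⟨⟨y - x, by simpa using hE _ hE'⟩, by simp⟩
      · rintro ⟨⟨c, hc⟩, rfl⟩
        simpa using hE _ hc
    · simp only [h, if_false]
      constructor
      · intro hE'
        exact ⟨⟨x - y, hE'⟩, by simp⟩
      · rintro ⟨⟨c, hc⟩, rfl⟩
        simpa using hc
  · rintro ⟨c, hc⟩ ⟨c', hc'⟩ x h
    by_cases h0 : par x = 0
    · simpa [h0] using h
    · simpa [h0] using h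

theorem even_differences {Z : Type} [AddCommGroup Z] (par : Z →+ ZMod 2) (v : Z) (hv : v + v = 0)
    (hodd : par v = 1) : OneFact fun x y : Z => (x ≠ y ∧ par (x - y) = 0) ∨ x - y = v := by
  classical
  have e2 : ∀ a b : ZMod 2, a + b = 0 ↔ a - b = 0 := by decide
  refine ⟨{c // par c = 0}, fun c x => if x + x = c.1 then x + v else c.1 - x, ?_, ?_, ?_⟩
  · rintro ⟨c, hc⟩ x
    by_cases h : x + x = c
    · have : x + v + (x + v) = c := by rw [add_add_add_comm, hv, add_zero, h]
      simp [h, this, add_assoc, hv]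
    · have : ¬ (c - x + (c - x) = c) := by
        intro h'
        apply h
        have : c - x + (c - x) - c = c - (x + x) := by abel
        rw [h', sub_self] at this
        exact (sub_eq_zero.1 this.symm).symm
      simp [h, this]
  · intro x y
    constructor
    · rintro (⟨h1, h2⟩ | h)
      · refine ⟨⟨x + y, ?_⟩, ?_⟩
        · rw [map_add, e2, ← map_sub, h2]
        · have : ¬ (x + x = x + y) := fun h => h1 (add_left_cancel h)
          simp [this]
      · refine ⟨⟨x + x, by rw [map_add]; generalize par x = a; revert a; decide⟩, ?_⟩
        rw [sub_eq_iff_eq_add] at h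
        simp [h, add_comm v y, add_assoc, hv]
    · rintro ⟨⟨c, hc⟩, rfl⟩
      by_cases h : x + x = c
      · right
        have : -v = v := neg_eq_of_add_eq_zero_left hv
        simp [h, this]
      · left
        simp only [h, if_false]
        refine ⟨fun h' => h (eq_sub_iff_add_eq.1 h'), ?_⟩
        simp only [map_sub, hc, zero_sub, sub_neg_eq_add]
        generalize par x = a
        revert a
        decide
  · rintro ⟨c, hc⟩ ⟨c', hc'⟩ x h
    have key : ∀ c', par c' = 0 → x + v ≠ c' - x := by
      intro c' hc' h
      have h2 := congrArg par h
      rw [map_add, map_sub, hodd, hc'] at h2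
      revert h2
      generalize par x = a
      revert a
      decide
    by_cases h0 : x + x = c <;> by_cases h1 : x + x = c'
    · exact Subtype.ext (h0.symm.trans h1)
    · exact absurd ((if_pos h0).symm.trans (h.trans (if_neg h1))) (key c' hc')
    · exact absurd ((if_pos h1).symm.trans (h.symm.trans (if_neg h0))) (key c hc)
    · simpa [h0, h1] using h

/-- The circulant graph on an even cyclic group avoiding a symmetric set of odd differences. -/
theorem zmod (v : ℕ) [NeZero v] (Δ : ZMod (2 * v) → Prop) (hΔ : ∀ d, Δ d → Δ (-d))
    (hodd : ∀ d, Δ d → ZMod.castHom (dvd_mul_right 2 v) (ZMod 2) d = 1) (hv : ¬ Δ v) :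
    OneFact fun x y : ZMod (2 * v) => x ≠ y ∧ ¬ Δ (x - y) := by
  set par := (ZMod.castHom (dvd_mul_right 2 v) (ZMod 2)) with hpar
  have two : ∀ a : ZMod 2, a ≠ 0 → a = 1 := by decide
  have hvv : (v : ZMod (2 * v)) + v = 0 := by
    rw [← two_mul]
    exact_mod_cast ZMod.natCast_self (2 * v)
  rcases Nat.even_or_odd v with hev | hod
  · have he : OneFact fun x y : ZMod (2 * v) => x ≠ y ∧ par (x - y) = 0 := by
      let f : Bool × Fin v → ZMod (2 * v) := fun p => ((p.1.toNat + 2 * p.2.1 : ℕ) : ZMod (2 * v))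
      have hfp : ∀ p, par (f p) = p.1.toNat := by
        intro p
        have h2 : par 2 = 0 := by rw [map_ofNat]; decide
        simp [f, h2]
      have hf : f.Injective := by
        rintro ⟨b, w⟩ ⟨b', w'⟩ h
        have h1 := w.2
        have h2 := w'.2
        have h3 := b.toNat_le
        have h4 := b'.toNat_le
        simp only [f] at h
        rw [ZMod.natCast_eq_natCast_iff', Nat.mod_eq_of_lt (by omega), Nat.mod_eq_of_lt (by omega)] at h
        have hb : b.toNat = b'.toNat := by omega
        have : w = w' := Fin.ext (by omega)
        clear h
        cases b <;> cases b' <;> simp_all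
      have hb : f.Bijective := (Fintype.bijective_iff_injective_and_card f).2 ⟨hf, by
        simp [ZMod.card]⟩
      refine of_equiv (Equiv.ofBijective f hb) (((complete (Z := Fin v) (by simpa)).prod Bool).congr ?_)
      rintro ⟨b, w⟩ ⟨b', w'⟩
      simp only [Equiv.ofBijective_apply, ne_eq, hf.eq_iff, map_sub, hfp]
      cases b <;> cases b' <;> simp
    refine he.or (odd_differences par.toAddMonoidHom (fun d => par d = 1 ∧ ¬ Δ d) ?_ ?_) ?_ ?_
    · rintro d ⟨h1, h2⟩
      exact ⟨by rw [map_neg, h1]; decide, fun h => h2 (by simpa using hΔ _ h)⟩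
    · exact fun d h => h.1
    · intro x y
      constructor
      · rintro ⟨h1, h2⟩
        by_cases h : par (x - y) = 0
        · exact .inl ⟨h1, h⟩
        · exact .inr ⟨two _ h, h2⟩
      · rintro (⟨h1, h2⟩ | ⟨h1, h2⟩)
        · refine ⟨h1, fun h => ?_⟩
          rw [hodd _ h] at h2
          exact one_ne_zero h2
        · refine ⟨?_, h2⟩
          rintro rfl
          simp at h1
    · rintro x y ⟨-, h1⟩ ⟨h2, -⟩
      rw [h1] at h2
      exact zero_ne_one h2
  · have hpv : par v = 1 := by
      rw [map_natCast]
      exact (ZMod.natCast_eq_one_iff_odd).2 hod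
    have hnv : -(v : ZMod (2 * v)) = v := neg_eq_of_add_eq_zero_left hvv
    refine (even_differences par.toAddMonoidHom v hvv hpv).or
      (odd_differences par.toAddMonoidHom (fun d => par d = 1 ∧ d ≠ v ∧ ¬ Δ d) ?_ ?_) ?_ ?_
    · rintro d ⟨h1, h2, h3⟩
      exact ⟨by rw [map_neg, h1]; decide, fun h => h2 (by rw [← hnv, ← h, neg_neg]),
        fun h => h3 (by simpa using hΔ _ h)⟩
    · exact fun d h => h.1
    · intro x y
      constructor
      · rintro ⟨h1, h2⟩
        by_cases h : par (x - y) = 0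
        · exact .inl (.inl ⟨h1, h⟩)
        · by_cases h3 : x - y = v
          · exact .inl (.inr h3)
          · exact .inr ⟨two _ h, h3, h2⟩
      · rintro ((⟨h1, h2⟩ | h) | ⟨h1, h2, h3⟩)
        · refine ⟨h1, fun h => ?_⟩
          have h2 : par (x - y) = 0 := h2
          rw [hodd _ h] at h2
          exact one_ne_zero h2
        · rw [h]
          refine ⟨?_, hv⟩
          rintro rfl
          rw [sub_self] at h
          rw [← h, map_zero] at hpv
          exact zero_ne_one hpv
        · refine ⟨?_, h3⟩
          rintro rfl
          simp at h1
    · rintro x y (⟨-, h1⟩ | h1) ⟨h2, h3, -⟩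
      · have h1 : par (x - y) = 0 := h1
        rw [h1] at h2
        exact zero_ne_one h2
      · exact h3 h1

end OneFact

theorem Pt.In_map {κ A S κ' A' S' : Type} (e : κ → κ') (f : A → A') (g : S → S')
    (h : κ' → Prop) (x : Pt κ A S) :
    Pt.In h (Sum.map (Prod.map e f) g x) ↔ x.In fun i => h (e i) := by
  rcases x with ⟨i, a⟩ | s <;> rfl

theorem Dec.cTri_equiv {κ A S κ' A' S' : Type} {h : κ → Prop} {h' : κ' → Prop} (e : κ ≃ κ')
    (f : A ≃ A') (g : S ≃ S') (hh : ∀ i, h i ↔ h' (e i)) (H : Dec (CTri κ A S h)) :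
    Dec (CTri κ' A' S' h') := by
  refine Dec.of_equiv (Equiv.sumCongr (Equiv.prodCongr e f) g) (H.congr fun x y z => ?_)
  have hm : ∀ x, (Equiv.sumCongr (Equiv.prodCongr e f) g) x = Sum.map (Prod.map e f) g x :=
    fun x => rfl
  have hI : ∀ x : Pt κ A S, x.In (fun i => h' (e i)) ↔ x.In h := by
    intro x
    rw [funext fun i => propext (hh i)]
  simp only [CTri, ne_eq, EmbeddingLike.apply_eq_iff_eq]
  simp only [hm, Pt.In_map, hI]
  refine and_congr_right fun _ => and_congr_left fun _ => ?_
  rw [e.symm.forall_congr_left]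
  simp

theorem ZMod.natCast_eq_natCast_iff_dvd_sub (a b n : ℕ) :
    (a : ZMod n) = b ↔ (n : ℤ) ∣ (b : ℤ) - a := by
  rw [← ZMod.intCast_eq_intCast_iff_dvd_sub]
  simp

/-- Tripling over a cyclic group of order `2 * v` with a stem of size `2 * v - 6 * f`. -/
theorem Dec.tripling_card {Z S : Type} [Fintype Z] [Fintype S] {v f : ℕ} (hf : 3 * f ≤ v)
    (hv : 0 < v) (hZ : Fintype.card Z = 2 * v) (hS : Fintype.card S + 6 * f = 2 * v) :
    Dec (CTri (Fin 3) Z S fun _ => False) := by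
  have : NeZero v := ⟨hv.ne'⟩
  let cls : ZMod (2 * v) → Option (Fin 3) := fun d =>
    if d.val < 2 * f then some 0 else if d.val < 4 * f then some 1 else
      if d.val < 6 * f then some 2 else none
  have hcls : ∀ i d, cls d = some i ↔ 2 * f * i ≤ d.val ∧ d.val < 2 * f * i + 2 * f := by
    intro i d
    simp only [cls]
    fin_cases i <;> split_ifs <;> simp <;> omega
  have hcls' : ∀ i d, cls d = some i ↔ ∃ n < 2 * f, d = ((2 * f * i + n : ℕ) : ZMod (2 * v)) := by
    intro i d
    rw [hcls]
    have hi := i.2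
    have hfi : 2 * f * i ≤ 2 * f * 2 := Nat.mul_le_mul_left _ (by omega)
    constructor
    · rintro ⟨h1, h2⟩
      refine ⟨d.val - 2 * f * i, by omega, ?_⟩
      rw [Nat.add_sub_cancel' h1, ZMod.natCast_zmod_val]
    · rintro ⟨n, hn, rfl⟩
      rw [ZMod.val_natCast_of_lt (by omega)]
      omega
  let K : Fin 3 → ZMod (2 * v) := fun i => ((2 * (2 * f * i) + 2 * f : ℕ) : ZMod (2 * v)) - 1
  let Δ : ZMod (2 * v) → Prop := fun δ => ∃ n < 2 * f, δ = ((2 * n + 1 : ℕ) : ZMod (2 * v)) - (2 * f : ℕ)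
  have hodd : ∀ d, Δ d → ZMod.castHom (dvd_mul_right 2 v) (ZMod 2) d = 1 := by
    rintro d ⟨n, hn, rfl⟩
    rw [map_sub, map_natCast, map_natCast, (ZMod.natCast_eq_one_iff_odd).2 ⟨n, rfl⟩,
      (ZMod.natCast_eq_zero_iff_even).2 (even_two_mul f), sub_zero]
  have key := Dec.tripling cls K Δ ?_ ?_ ?_ ?_ ?_ ?_
  · refine Dec.cTri_equiv (Equiv.refl _) (Fintype.equivOfCardEq (by rw [hZ, ZMod.card]))
      (Fintype.equivOfCardEq ?_) (fun _ => Iff.rfl) key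
    have h1 : Fintype.card {d // cls d = none} = Fintype.card {d : ZMod (2 * v) // ¬ d.val < 6 * f} := by
      refine Fintype.card_congr (Equiv.subtypeEquivRight fun d => ?_)
      simp only [cls]
      split_ifs <;> simp <;> omega
    have h2 : Fintype.card {d : ZMod (2 * v) // d.val < 6 * f} = 6 * f := by
      have e : Fin (6 * f) ≃ {d : ZMod (2 * v) // d.val < 6 * f} :=
        { toFun := fun i => ⟨(i.1 : ZMod (2 * v)), by
            rw [ZMod.val_natCast_of_lt (by omega)]; exact i.2⟩
          invFun := fun d => ⟨d.1.val, d.2⟩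
          left_inv := fun i => Fin.ext (ZMod.val_natCast_of_lt (by omega))
          right_inv := fun d => Subtype.ext (ZMod.natCast_zmod_val _) }
      rw [← Fintype.card_congr e, Fintype.card_fin]
    rw [h1, Fintype.card_subtype_compl, h2, ZMod.card]
    omega
  · intro i d h
    rw [hcls'] at h ⊢
    obtain ⟨n, hn, rfl⟩ := h
    refine ⟨2 * f - 1 - n, by omega, ?_⟩
    rw [sub_eq_iff_eq_add, ← Nat.cast_add, sub_eq_iff_eq_add]
    norm_cast
    congr 1
    omega
  · intro i d h
    rw [hcls'] at h
    obtain ⟨n, hn, rfl⟩ := h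
    refine ⟨n, hn, ?_⟩
    simp only [K]
    push_cast
    ring
  · rintro i δ ⟨n, hn, rfl⟩
    refine ⟨_, (hcls' i _).2 ⟨n, hn, rfl⟩, ?_⟩
    simp only [K]
    push_cast
    ring
  · intro i d d' h h' e
    rw [hcls] at h h'
    have hi := i.2
    have hfi : 2 * f * i ≤ 2 * f * 2 := Nat.mul_le_mul_left _ (by omega)
    rw [← ZMod.natCast_zmod_val d, ← ZMod.natCast_zmod_val d', ← Nat.cast_add, ← Nat.cast_add,
      ZMod.natCast_eq_natCast_iff_dvd_sub] at e
    obtain ⟨c, hc⟩ := e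
    have hc0 : c = 0 := by
      have b1 : (2 * v : ℕ) * c < (2 * v : ℕ) * 1 := by
        rw [← hc]; push_cast; omega
      have b2 : ((2 * v : ℕ) : ℤ) * (-1) < (2 * v : ℕ) * c := by
        rw [← hc]; push_cast; omega
      have p : (0 : ℤ) < (2 * v : ℕ) := by push_cast; omega
      have := lt_of_mul_lt_mul_left b1 p.le
      have := lt_of_mul_lt_mul_left b2 p.le
      omega
    refine ZMod.val_injective _ ?_
    rw [hc0] at hc
    push_cast at hc
    omega
  · intro h
    have := hodd 0 h
    rw [map_zero] at this
    exact zero_ne_one this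
  · refine OneFact.zmod v Δ ?_ hodd ?_
    · rintro d ⟨n, hn, rfl⟩
      refine ⟨2 * f - 1 - n, by omega, ?_⟩
      rw [neg_sub, sub_eq_sub_iff_add_eq_add]
      norm_cast
      congr 1
      omega
    · rintro ⟨n, hn, h⟩
      rw [eq_sub_iff_add_eq, ← Nat.cast_add, ZMod.natCast_eq_natCast_iff_dvd_sub] at h
      obtain ⟨c, hc⟩ := h
      push_cast at hc
      have b1 : (2 * v : ℤ) * c < (2 * v) * 1 := by
        rw [← hc]; omega
      have b2 : (2 * v : ℤ) * (-1) < (2 * v) * c := by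
        rw [← hc]; omega
      have p : (0 : ℤ) < 2 * v := by omega
      have := lt_of_mul_lt_mul_left b1 p.le
      have := lt_of_mul_lt_mul_left b2 p.le
      have hc0 : c = 0 := by omega
      rw [hc0] at hc
      omega

theorem Dec.comap_equiv {α β : Type} {T : α → α → α → Prop} (e : β ≃ α) (h : Dec T) :
    Dec fun a b c => T (e a) (e b) (e c) :=
  Dec.of_equiv e.symm (h.congr fun x y z => by simp)

section Reindex

variable {κ κ' A S : Type}

theorem Pt.In.mono {p q : κ → Prop} (h : ∀ i, p i → q i) {x : Pt κ A S} (hx : x.In p) : x.In q := by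
  rcases x with ⟨i, a⟩ | s
  · exact h i hx
  · trivial

/-- Changing the index set of the groups. -/
def Pt.reindex (m : κ → κ') : Pt κ A S → Pt κ' A S := Sum.map (Prod.map m id) id

theorem Pt.reindex_injective {m : κ → κ'} (hm : m.Injective) :
    (Pt.reindex m : Pt κ A S → Pt κ' A S).Injective :=
  (hm.prodMap Function.injective_id).sumMap Function.injective_id

theorem Pt.In_reindex (m : κ → κ') (h : κ' → Prop) (x : Pt κ A S) :
    (x.reindex m).In h ↔ x.In fun i => h (m i) :=
  Pt.In_map _ _ _ _ _

theorem Pt.In_range_iff (m : κ → κ') (x : Pt κ' A S) :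
    x.In (· ∈ Set.range m) ↔ ∃ a : Pt κ A S, a.reindex m = x := by
  rcases x with ⟨i, a⟩ | s
  · constructor
    · rintro ⟨j, rfl⟩
      exact ⟨.inl (j, a), rfl⟩
    · rintro ⟨⟨j, a'⟩ | s, h⟩
      · exact ⟨j, congrArg Prod.fst (Sum.inl_injective h)⟩
      · cases h
  · exact iff_of_true trivial ⟨.inr s, rfl⟩

theorem CTri.mono {h h' : κ → Prop} (hh : ∀ i, h' i → h i) {x y z : Pt κ A S}
    (H : CTri κ A S h x y z) : CTri κ A S h' x y z :=
  ⟨H.1, H.2.1, fun ⟨a, b, c⟩ => H.2.2 ⟨a.mono hh, b.mono hh, c.mono hh⟩⟩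

theorem cTri_reindex {m : κ → κ'} (hm : m.Injective) (h : κ' → Prop) (x y z : Pt κ A S) :
    CTri κ' A S h (x.reindex m) (y.reindex m) (z.reindex m) ↔
      CTri κ A S (fun i => h (m i)) x y z := by
  simp only [CTri, ne_eq, (Pt.reindex_injective hm).eq_iff, Pt.In_reindex]
  refine and_congr_right fun _ => ⟨fun ⟨h1, h2⟩ => ⟨fun i => ?_, h2⟩, fun ⟨h1, h2⟩ => ⟨fun j => ?_, h2⟩⟩
  · simpa only [hm.eq_iff] using h1 (m i)
  · by_cases hj : j ∈ Set.range m
    · obtain ⟨i, rfl⟩ := hj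
      simpa only [hm.eq_iff] using h1 i
    · have key : ∀ x : Pt κ A S, x.In (fun i => m i = j) → x.In fun i => h (m i) := fun x hx =>
        hx.mono fun i hi => (hj ⟨i, hi⟩).elim
      exact fun ⟨a, b, c⟩ => h2 ⟨key x a, key y b, key z c⟩

/-- Filling the hole of a design. -/
theorem Dec.fill_hole {m : κ → κ'} (hm : m.Injective) (H : Dec (CTri κ' A S (· ∈ Set.range m)))
    (H' : Dec (CTri κ A S fun _ => False)) : Dec (CTri κ' A S fun _ => False) := by
  refine Dec.or H (Dec.lift (Pt.reindex m) (Pt.reindex_injective hm) H') ?_ ?_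
  · intro x y z
    constructor
    · intro h
      by_cases hx : x.In (· ∈ Set.range m) ∧ y.In (· ∈ Set.range m) ∧ z.In (· ∈ Set.range m)
      · right
        simp only [Pt.In_range_iff] at hx
        obtain ⟨⟨a, rfl⟩, ⟨b, rfl⟩, ⟨c, rfl⟩⟩ := hx
        exact ⟨a, b, c, rfl, rfl, rfl, (cTri_reindex hm _ _ _ _).1 h⟩
      · exact .inl ⟨h.1, h.2.1, hx⟩
    · rintro (h | ⟨a, b, c, rfl, rfl, rfl, h⟩)
      · exact h.mono fun _ => False.elim
      · exact (cTri_reindex hm _ _ _ _).2 h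
  · rintro _ _ _ h ⟨a, b, c, rfl, rfl, rfl, -⟩
    exact h.2.2 ⟨(Pt.In_range_iff m _).2 ⟨a, rfl⟩, (Pt.In_range_iff m _).2 ⟨b, rfl⟩,
      (Pt.In_range_iff m _).2 ⟨c, rfl⟩⟩

/-- Doubling a design without stem. -/
theorem Dec.double [Fintype κ] [Fintype A] (he : Even (Fintype.card (κ × A)))
    (H : Dec (CTri κ A Empty fun _ => False)) : Dec (CTri (Bool × κ) A Empty fun _ => False) := by
  let E : Pt (Bool × κ) A Empty ≃ Bool × (κ × A) :=
    (Equiv.sumEmpty _ _).trans (Equiv.prodAssoc _ _ _)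
  have F := (Dec.of_oneFact (ι := Bool) (OneFact.complete he)).comap_equiv E
  have hm : ∀ b : Bool, Function.Injective (fun i : κ => (b, i)) := fun b i j h => by simpa using h
  have G := Dec.iUnion _ (fun b : Bool => Dec.lift (Pt.reindex fun i : κ => (b, i))
    (Pt.reindex_injective (hm b)) H) (fun _ _ _ => Iff.rfl) (by
      rintro i j _ _ _ ⟨a, b, c, rfl, rfl, rfl, -⟩ ⟨a', b', c', h, -⟩
      rcases a with ⟨a, a1⟩ | a
      · rcases a' with ⟨a', a1'⟩ | a'
        · have := congrArg (fun p => p.1.1) (Sum.inl_injective h)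
          exact this.symm
        · exact a'.elim
      · exact a.elim)
  have part : ∀ {b b' b'' : Bool} {i i' i'' : κ} {x x' x'' : A},
      ((b = b' ∧ b'' ≠ b ∧ (i, x) ≠ (i', x')) ∨ (b = b'' ∧ b' ≠ b ∧ (i, x) ≠ (i'', x'')) ∨
        (b' = b'' ∧ b ≠ b' ∧ (i', x') ≠ (i'', x''))) → ¬ (b = b' ∧ b = b'') := by
    intro b b' b'' i i' i'' x x' x''
    generalize ((i, x) ≠ (i', x')) = p
    generalize ((i, x) ≠ (i'', x'')) = q
    generalize ((i', x') ≠ (i'', x'')) = r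
    cases b <;> cases b' <;> cases b'' <;> simp
  refine Dec.or F G ?_ ?_
  · rintro (⟨⟨b, i⟩, x⟩ | s) (⟨⟨b', i'⟩, x'⟩ | s') (⟨⟨b'', i''⟩, x''⟩ | s'')
    all_goals try exact Empty.elim (by assumption)
    constructor
    · intro h
      by_cases hb : b = b' ∧ b = b''
      · obtain ⟨rfl, rfl⟩ := hb
        exact .inr ⟨b, .inl (i, x), .inl (i', x'), .inl (i'', x''), rfl, rfl, rfl,
          (cTri_reindex (hm b) (fun _ => False) (.inl (i, x)) (.inl (i', x'))
            (.inl (i'', x''))).1 h⟩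
      · left
        obtain ⟨⟨h1, h2, h3⟩, -⟩ := h
        simp only [E, Equiv.trans_apply, Equiv.sumEmpty_apply_inl, Equiv.prodAssoc_apply]
        clear E F G hm part
        simp only [ne_eq, Sum.inl.injEq, Prod.mk.injEq] at h1 h2 h3 ⊢
        cases b <;> cases b' <;> cases b'' <;> simp_all
    · rintro (h | ⟨c, p, q, r, e1, e2, e3, h⟩)
      · have hb : ¬ (b = b' ∧ b = b'') := part h
        replace h : (b = b' ∧ b'' ≠ b ∧ (i, x) ≠ (i', x')) ∨ (b = b'' ∧ b' ≠ b ∧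
          (i, x) ≠ (i'', x'')) ∨ (b' = b'' ∧ b ≠ b' ∧ (i', x') ≠ (i'', x'')) := h
        refine ⟨⟨?_, ?_, ?_⟩, ?_, fun h => h.1⟩
        all_goals try
          rintro e
          simp only [Sum.inl.injEq, Prod.mk.injEq] at e
          obtain ⟨⟨rfl, rfl⟩, rfl⟩ := e
          rcases h with h | h | h
          all_goals first
            | exact h.2.2 rfl
            | exact h.2.1 rfl
            | exact h.2.1 h.1
            | exact h.2.1 h.1.symm
        · rintro j ⟨h1, h2, h3⟩
          have h1 : (b, i) = j := h1
          have h2 : (b', i') = j := h2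
          have h3 : (b'', i'') = j := h3
          exact hb ⟨congrArg Prod.fst (h1.trans h2.symm), congrArg Prod.fst (h1.trans h3.symm)⟩
      · rw [← e1, ← e2, ← e3]
        exact (cTri_reindex (hm c) _ _ _ _).2 h
  · rintro _ _ _ h ⟨b, ⟨i, x⟩ | s, ⟨i', x'⟩ | s', ⟨i'', x''⟩ | s'', rfl, rfl, rfl, -⟩
    all_goals try exact Empty.elim (by assumption)
    exact part h ⟨rfl, rfl⟩

variable {α : Type}

/-- Filling the parts of a tripling design. -/
theorem Dec.fill (h0 : κ ⊕ α → Prop) (T : Dec (CTri (Fin 3) (κ × A) (α × A ⊕ S) fun _ => False))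
    (H : Dec (CTri (κ ⊕ α) A S fun t => t.isRight)) (H0 : Dec (CTri (κ ⊕ α) A S h0)) :
    Dec (CTri ((Fin 3 × κ) ⊕ α) A S
      (Sum.elim (fun p => p.1 = 0 ∧ h0 (.inl p.2)) fun a => h0 (.inr a))) := by
  let E : Pt ((Fin 3 × κ) ⊕ α) A S ≃ Pt (Fin 3) (κ × A) (α × A ⊕ S) :=
    { toFun := Sum.elim (fun p => p.1.elim (fun t => .inl (t.1, (t.2, p.2))) fun a => .inr (.inl (a, p.2)))
        fun s => .inr (.inr s)
      invFun := Sum.elim (fun p => .inl (.inl (p.1, p.2.1), p.2.2)) (Sum.elim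
        (fun p => .inl (.inr p.1, p.2)) .inr)
      left_inv := by rintro (⟨⟨i, k⟩ | a, x⟩ | s) <;> rfl
      right_inv := by rintro (⟨i, k, x⟩ | ⟨a, x⟩ | s) <;> rfl }
  let m : Fin 3 → κ ⊕ α → (Fin 3 × κ) ⊕ α := fun i => Sum.map (fun k => (i, k)) id
  have hm : ∀ i, (m i).Injective := fun i =>
    Function.Injective.sumMap (fun k k' h => congrArg Prod.snd h) Function.injective_id
  have hE : ∀ i x, (E x).In (· = i) ↔ ∃ a : Pt (κ ⊕ α) A S, a.reindex (m i) = x := by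
    rintro i (⟨⟨j, k⟩ | a, x⟩ | s)
    · constructor
      · rintro rfl
        exact ⟨.inl (.inl k, x), rfl⟩
      · rintro ⟨⟨k' | a', x'⟩ | s', h⟩
        · simp only [Pt.reindex, Sum.map_inl, Prod.map, m, Sum.inl.injEq, Prod.mk.injEq] at h
          exact h.1.1.symm
        · simp [Pt.reindex, m] at h
        · simp [Pt.reindex] at h
    · exact iff_of_true trivial ⟨.inl (.inr a, x), rfl⟩
    · exact iff_of_true trivial ⟨.inr s, rfl⟩
  set h' : (Fin 3 × κ) ⊕ α → Prop :=
    Sum.elim (fun p => p.1 = 0 ∧ h0 (.inl p.2)) fun a => h0 (.inr a) with hh'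
  have hm0 : ∀ t, h' (m 0 t) ↔ h0 t := by
    rintro (k | a) <;> simp [hh', m]
  have hmi : ∀ i, i ≠ 0 → ∀ t, h' (m i t) → t.isRight := by
    rintro i hi (k | a) h
    · exact absurd h.1 hi
    · rfl
  have hmS : ∀ i j (a : Pt (κ ⊕ α) A S), a.In (fun t => t.isRight) →
      a.reindex (m i) = a.reindex (m j) := by
    rintro i j (⟨k | a, x⟩ | s) h
    · cases h
    · rfl
    · rfl
  have hmS' : ∀ i j (a b : Pt (κ ⊕ α) A S), i ≠ j → a.reindex (m i) = b.reindex (m j) →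
      a.In (fun t => t.isRight) := by
    rintro i j (⟨k | a, x⟩ | s) b hij h
    · rcases b with ⟨k' | a', x'⟩ | s' <;> simp [Pt.reindex, m] at h
      exact absurd h.1.1 hij
    · rfl
    · trivial
  let hh : Fin 3 → κ ⊕ α → Prop := fun i t => if i = 0 then h0 t else t.isRight
  have hle : ∀ i t, h' (m i t) → hh i t := by
    intro i t
    by_cases hi : i = 0
    · subst hi
      simp [hh, hm0]
    · simpa [hh, hi] using hmi i hi t
  have F := T.comap_equiv E
  have G := Dec.iUnion _ (fun i : Fin 3 => Dec.lift (T := CTri (κ ⊕ α) A S (hh i))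
      (Pt.reindex (m i)) (Pt.reindex_injective (hm i)) (by
        by_cases hi : i = 0
        · simpa [hh, hi] using H0
        · simpa [hh, hi] using H)) (fun _ _ _ => Iff.rfl) (by
    rintro i j _ _ _ ⟨a, b, c, rfl, rfl, rfl, h⟩ ⟨a', b', c', ha, hb, hc, h2⟩
    by_contra hij
    by_cases hi : i = 0
    · have hj : j ≠ 0 := fun h => hij (hi.trans h.symm)
      have := h2.2.2
      simp only [hh, hj, if_false] at this
      exact this ⟨hmS' j i _ _ (Ne.symm hij) ha, hmS' j i _ _ (Ne.symm hij) hb,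
        hmS' j i _ _ (Ne.symm hij) hc⟩
    · have := h.2.2
      simp only [hh, hi, if_false] at this
      exact this ⟨hmS' i j _ _ hij ha.symm, hmS' i j _ _ hij hb.symm, hmS' i j _ _ hij hc.symm⟩)
  have hgrp : ∀ j, ∃ i, ∀ x : Pt ((Fin 3 × κ) ⊕ α) A S, x.In (· = j) → (E x).In (· = i) := by
    rintro (⟨i, k⟩ | a)
    · refine ⟨i, ?_⟩
      rintro (⟨_ | a, x⟩ | s) h
      · cases h
        rfl
      · trivial
      · trivial
    · refine ⟨0, ?_⟩
      rintro (⟨_ | a, x⟩ | s) h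
      · cases h
      · trivial
      · trivial
  have hhole : ∀ x : Pt ((Fin 3 × κ) ⊕ α) A S, x.In h' → (E x).In (· = 0) := by
    rintro (⟨⟨i, k⟩ | a, x⟩ | s) h
    · exact h.1
    · trivial
    · trivial
  refine Dec.or F G ?_ ?_
  · intro x y z
    constructor
    · intro h
      by_cases hi : ∃ i, (E x).In (· = i) ∧ (E y).In (· = i) ∧ (E z).In (· = i)
      · right
        obtain ⟨i, h1, h2, h3⟩ := hi
        rw [hE] at h1 h2 h3
        obtain ⟨⟨a, rfl⟩, ⟨b, rfl⟩, ⟨c, rfl⟩⟩ := And.intro h1 (And.intro h2 h3)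
        by_cases hS : a.In (fun t => t.isRight) ∧ b.In (fun t => t.isRight) ∧
            c.In (fun t => t.isRight)
        · refine ⟨0, a, b, c, hmS _ _ a hS.1, hmS _ _ b hS.2.1, hmS _ _ c hS.2.2, ?_⟩
          rw [hmS i 0 a hS.1, hmS i 0 b hS.2.1, hmS i 0 c hS.2.2, cTri_reindex (hm 0)] at h
          exact h.mono fun t ht => (hm0 t).2 (by simpa [hh] using ht)
        · refine ⟨i, a, b, c, rfl, rfl, rfl, ?_⟩
          rw [cTri_reindex (hm i)] at h
          by_cases hi : i = 0
          · subst hi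
            exact h.mono fun t ht => (hm0 t).2 (by simpa [hh] using ht)
          · refine ⟨h.1, h.2.1, ?_⟩
            simpa only [hh, hi, if_false] using hS
      · left
        refine ⟨⟨E.injective.ne h.1.1, E.injective.ne h.1.2.1, E.injective.ne h.1.2.2⟩, 
          not_exists.1 hi, fun ⟨h1, h2, h3⟩ => hi ⟨0, h1.mono (fun _ => False.elim),
            h2.mono (fun _ => False.elim), h3.mono (fun _ => False.elim)⟩⟩
    · rintro (h | ⟨i, a, b, c, rfl, rfl, rfl, h⟩)
      · refine ⟨⟨fun e => h.1.1 (congrArg E e), fun e => h.1.2.1 (congrArg E e),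
          fun e => h.1.2.2 (congrArg E e)⟩, fun j ⟨h1, h2, h3⟩ => ?_, fun ⟨h1, h2, h3⟩ => ?_⟩
        · obtain ⟨i, hi⟩ := hgrp j
          exact h.2.1 i ⟨hi _ h1, hi _ h2, hi _ h3⟩
        · exact h.2.1 0 ⟨hhole _ h1, hhole _ h2, hhole _ h3⟩
      · exact (cTri_reindex (hm i) _ _ _ _).2 (h.mono (hle i))
  · rintro _ _ _ h ⟨i, a, b, c, rfl, rfl, rfl, -⟩
    exact h.2.1 i ⟨(hE i _).2 ⟨a, rfl⟩, (hE i _).2 ⟨b, rfl⟩, (hE i _).2 ⟨c, rfl⟩⟩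

end Reindex

section Candelabra

variable {κ κ' A S : Type}

/-- There are `m` groups of type `A`, of which `e` lie in the hole, and a stem `S`. -/
def Candelabra (A S : Type) (m e : ℕ) : Prop := Dec (CTri (Fin m) A S fun i => i.val < e)

theorem Equiv.exists_iff_of_card_eq {α β : Type} [Finite α] [Finite β] (p : α → Prop) (q : β → Prop)
    (h : Nat.card α = Nat.card β) (h' : Nat.card {a // p a} = Nat.card {b // q b}) :
    ∃ e : α ≃ β, ∀ a, p a ↔ q (e a) := by
  classical
  have : Fintype α := Fintype.ofFinite α
  have : Fintype β := Fintype.ofFinite β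
  have hc : Nat.card {a // ¬ p a} = Nat.card {b // ¬ q b} := by
    simp only [Nat.card_eq_fintype_card] at *
    rw [Fintype.card_subtype_compl, Fintype.card_subtype_compl, h, h']
  have e1 : {a // p a} ≃ {b // q b} := Fintype.equivOfCardEq (by simpa only [Nat.card_eq_fintype_card] using h')
  have e2 : {a // ¬ p a} ≃ {b // ¬ q b} := Fintype.equivOfCardEq (by simpa only [Nat.card_eq_fintype_card] using hc)
  refine ⟨(Equiv.sumCompl p).symm.trans ((Equiv.sumCongr e1 e2).trans (Equiv.sumCompl q)),
    fun a => ?_⟩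
  by_cases ha : p a
  · simpa [ha] using (e1 ⟨a, ha⟩).2
  · simpa [ha] using (e2 ⟨a, ha⟩).2

theorem Dec.cTri_of_card [Finite κ] [Finite κ'] {h : κ → Prop} {h' : κ' → Prop}
    (H : Dec (CTri κ A S h)) (hc : Nat.card κ = Nat.card κ')
    (hh : Nat.card {i // h i} = Nat.card {i // h' i}) : Dec (CTri κ' A S h') := by
  obtain ⟨e, he⟩ := Equiv.exists_iff_of_card_eq h h' hc hh
  exact H.cTri_equiv e (.refl _) (.refl _) he

theorem Nat.card_fin_val_lt {m e : ℕ} (h : e ≤ m) : Nat.card {i : Fin m // i.val < e} = e := by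
  rw [Nat.card_congr (Fin.castLEquiv h).symm, Nat.card_fin]

theorem Candelabra.dec [Finite κ] {m e : ℕ} (H : Candelabra A S m e) (hm : Nat.card κ = m)
    (he : e ≤ m) {h : κ → Prop} (hh : Nat.card {i // h i} = e) : Dec (CTri κ A S h) :=
  Dec.cTri_of_card H (by rw [hm, Nat.card_fin]) (by rw [hh, Nat.card_fin_val_lt he])

theorem Dec.candelabra [Finite κ] {m e : ℕ} {h : κ → Prop} (H : Dec (CTri κ A S h))
    (hm : Nat.card κ = m) (he : e ≤ m) (hh : Nat.card {i // h i} = e) : Candelabra A S m e :=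
  Dec.cTri_of_card H (by rw [hm, Nat.card_fin]) (by rw [hh, Nat.card_fin_val_lt he])

theorem CTri.of_subsingleton {h : κ → Prop} (hs : ∀ i j, h i → h j → i = j) {x y z : Pt κ A S} :
    CTri κ A S h x y z ↔ CTri κ A S (fun _ => False) x y z := by
  refine ⟨fun H => H.mono fun _ => False.elim, fun H => ⟨H.1, H.2.1, fun ⟨a, b, c⟩ => ?_⟩⟩
  by_cases hi : ∃ i, h i
  · obtain ⟨i, hi⟩ := hi
    exact H.2.1 i ⟨a.mono fun j hj => hs j i hj hi, b.mono fun j hj => hs j i hj hi,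
      c.mono fun j hj => hs j i hj hi⟩
  · exact H.2.2 ⟨a.mono fun j hj => hi ⟨j, hj⟩, b.mono fun j hj => hi ⟨j, hj⟩,
      c.mono fun j hj => hi ⟨j, hj⟩⟩

namespace Candelabra

theorem one_iff_zero {m : ℕ} : Candelabra A S m 1 ↔ Candelabra A S m 0 := by
  unfold Candelabra
  have : ∀ x y z : Pt (Fin m) A S, CTri (Fin m) A S (fun i => i.val < 1) x y z ↔
      CTri (Fin m) A S (fun i => i.val < 0) x y z := fun x y z => by
    rw [CTri.of_subsingleton (fun i j hi hj => Fin.ext (by omega)),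
      CTri.of_subsingleton (h := fun i => i.val < 0) (fun i j hi hj => Fin.ext (by omega))]
  exact ⟨fun H => H.congr fun x y z => (this x y z).symm, fun H => H.congr this⟩

theorem one_zero : Candelabra A S 1 0 := by
  refine Dec.of_forall_not fun x y z h => h.2.1 0 ⟨?_, ?_, ?_⟩
  · rcases x with ⟨i, a⟩ | s
    · exact Subsingleton.elim i 0
    · trivial
  · rcases y with ⟨i, a⟩ | s
    · exact Subsingleton.elim i 0
    · trivial
  · rcases z with ⟨i, a⟩ | s
    · exact Subsingleton.elim i 0
    · trivial

theorem zero_zero : Candelabra A S 0 0 := by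
  refine Dec.of_forall_not fun x y z h => h.2.2 ⟨?_, ?_, ?_⟩
  · rcases x with ⟨i, a⟩ | s
    · exact i.elim0
    · trivial
  · rcases y with ⟨i, a⟩ | s
    · exact i.elim0
    · trivial
  · rcases z with ⟨i, a⟩ | s
    · exact i.elim0
    · trivial

theorem fill_hole {m e : ℕ} (he : e ≤ m) (H : Candelabra A S m e) (H' : Candelabra A S e 0) :
    Candelabra A S m 0 := by
  have hm := Fin.castLE_injective he
  have := Dec.fill_hole hm (κ := Fin e) (κ' := Fin m) (A := A) (S := S) (H.congr fun x y z => ?_)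
    (H'.congr fun x y z => ?_)
  · exact this.congr fun x y z => by simp
  · have : (· ∈ Set.range (Fin.castLE he)) = fun i : Fin m => i.val < e := by
      ext i
      exact ⟨by rintro ⟨j, rfl⟩; exact j.2, fun h => ⟨⟨i, h⟩, rfl⟩⟩
    rw [this]
  · simp

theorem double [Fintype A] {m : ℕ} (he : Even (m * Fintype.card A))
    (H : Candelabra A Empty m 0) : Candelabra A Empty (2 * m) 0 := by
  have := Dec.double (κ := Fin m) (A := A) (by simpa using he) (H.congr fun x y z => by simp)
  exact this.candelabra (by simp) (by simp) (by simp)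

theorem triple [Fintype A] [Fintype S] {j a e v f : ℕ} (hf : 3 * f ≤ v) (hv : 0 < v)
    (hZ : j * Fintype.card A = 2 * v) (hS : a * Fintype.card A + Fintype.card S + 6 * f = 2 * v)
    (he : e ≤ j + a) (H : Candelabra A S (j + a) a) (H0 : Candelabra A S (j + a) e) :
    Candelabra A S (3 * j + a) e := by
  have T := Dec.tripling_card (Z := Fin j × A) (S := Fin a × A ⊕ S) hf hv (by simpa using hZ)
    (by simpa using hS)
  let h0 : Fin j ⊕ Fin a → Prop := fun t => (finSumFinEquiv t).val < e
  have hh0 : Nat.card {t // h0 t} = e := by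
    rw [← Nat.card_fin_val_lt he]
    exact Nat.card_congr (finSumFinEquiv.subtypeEquiv fun t => Iff.rfl)
  have hr : Nat.card {t : Fin j ⊕ Fin a // t.isRight} = a := by
    rw [Nat.card_congr (β := Fin a) ⟨fun t => t.1.getRight t.2, fun i => ⟨.inr i, rfl⟩, ?_, ?_⟩]
    · simp
    · rintro ⟨i | i, h⟩
      · cases h
      · rfl
    · exact fun i => rfl
  have F := Dec.fill h0 T (H.dec (by simp) (by omega) hr) (H0.dec (by simp) he hh0)
  refine F.candelabra (by simp) (by omega) ?_
  rw [← hh0]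
  refine Nat.card_congr ⟨fun t => ⟨t.1.map Prod.snd id, ?_⟩, fun t => ⟨t.1.map (fun k => (0, k)) id, ?_⟩,
    ?_, ?_⟩
  · obtain ⟨⟨i, k⟩ | i, h⟩ := t
    · exact h.2
    · exact h
  · obtain ⟨k | i, h⟩ := t
    · exact ⟨rfl, h⟩
    · exact h
  · rintro ⟨⟨i, k⟩ | i, h⟩
    · have hi : i = 0 := h.1
      subst hi
      rfl
    · rfl
  · rintro ⟨k | i, h⟩
    · rfl
    · rfl

/-- Group divisible designs with groups of size six. -/
theorem six (h5 : Candelabra (Fin 6) Empty 5 2) (h7 : Candelabra (Fin 6) Empty 7 2)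
    (h9 : Candelabra (Fin 6) Empty 9 2) (m : ℕ) :
    (m % 2 = 1 → 5 ≤ m → Candelabra (Fin 6) Empty m 2) ∧ Candelabra (Fin 6) Empty m 0 := by
  induction m using Nat.strong_induction_on with
  | _ m ih =>
    have h20 : Candelabra (Fin 6) Empty 2 0 := by
      simpa using double (by simp; decide) (one_zero (A := Fin 6) (S := Empty))
    have hodd : m % 2 = 1 → 5 ≤ m → Candelabra (Fin 6) Empty m 2 := by
      intro ho hm
      by_cases h5m : m = 5
      · rwa [h5m]
      by_cases h7m : m = 7
      · rwa [h7m]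
      by_cases h9m : m = 9
      · rwa [h9m]
      obtain ⟨j, hj⟩ : ∃ j, m = 3 * j + m % 3 := ⟨m / 3, by omega⟩
      have h3 := Nat.mod_lt m (show 3 > 0 by norm_num)
      interval_cases hm3 : m % 3
      · rw [hj]
        exact triple (a := 0) (v := 3 * j) (f := j) (by omega) (by omega) (by simp; omega)
          (by simp; omega) (by omega) ((ih j (by omega)).2)
          ((ih j (by omega)).1 (by omega) (by omega))
      · rw [hj]
        exact triple (a := 1) (v := 3 * j) (f := j - 1) (by omega) (by omega) (by simp; omega)
          (by simp; omega) (by omega) (one_iff_zero.2 (ih (j + 1) (by omega)).2)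
          ((ih (j + 1) (by omega)).1 (by omega) (by omega))
      · rw [hj]
        exact triple (a := 2) (v := 3 * j) (f := j - 2) (by omega) (by omega) (by simp; omega)
          (by simp; omega) (by omega) ((ih (j + 2) (by omega)).1 (by omega) (by omega))
          ((ih (j + 2) (by omega)).1 (by omega) (by omega))
    refine ⟨hodd, ?_⟩
    rcases Nat.even_or_odd' m with ⟨l, rfl | rfl⟩
    · rcases Nat.eq_zero_or_pos l with rfl | hl
      · exact zero_zero
      · exact double (by simp [show Even 6 by decide]) (ih l (by omega)).2
    · by_cases hl : l < 2
      · interval_cases l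
        · exact one_zero
        · exact triple (j := 1) (a := 0) (v := 3) (f := 1) (by omega) (by omega) (by simp)
            (by simp) (by omega) one_zero one_zero
      · exact fill_hole (by omega) (hodd (by omega) (by omega)) h20

/-- Candelabra systems with groups of size 24 and a stem of size 12. -/
theorem twentyFour (h4 : Candelabra (Fin 24) (Fin 12) 4 0) (h6 : Candelabra (Fin 24) (Fin 12) 6 0)
    (h2 : ∀ m, 2 ≤ m → Candelabra (Fin 24) (Fin 12) (3 * m - 1) 0) (k : ℕ) (hk : 0 < k)
    (hk2 : k ≠ 2) : Candelabra (Fin 24) (Fin 12) k 0 := by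
  induction k using Nat.strong_induction_on with
  | _ k ih =>
    by_cases h1 : k = 1
    · rw [h1]
      exact one_zero
    by_cases h4k : k = 4
    · rwa [h4k]
    by_cases h6k : k = 6
    · rwa [h6k]
    obtain ⟨j, hj⟩ : ∃ j, k = 3 * j + k % 3 := ⟨k / 3, by omega⟩
    have h3 := Nat.mod_lt k (show 3 > 0 by norm_num)
    interval_cases hk3 : k % 3
    · rw [hj]
      have := ih j (by omega) (by omega) (by omega)
      exact triple (a := 0) (v := 12 * j) (f := 4 * j - 2) (by omega) (by omega) (by simp; omega)
        (by simp; omega) (by omega) this this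
    · rw [hj]
      have := ih (j + 1) (by omega) (by omega) (by omega)
      exact triple (a := 1) (v := 12 * j) (f := 4 * j - 6) (by omega) (by omega) (by simp; omega)
        (by simp; omega) (by omega) (one_iff_zero.2 this) this
    · have := h2 (j + 1) (by omega)
      rwa [show k = 3 * (j + 1) - 1 by omega]

end Candelabra

end Candelabra

/-- Evaluates `n` before passing it on. -/
def Nat.force {α : Type} (n : ℕ) (f : ℕ → α) : α := Nat.rec (f 0) (fun k _ => f (Nat.succ k)) n

/-- Binary tries with natural numbers in the leaves. -/
def Trie : ℕ → Type
  | 0 => ℕ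
  | d + 1 => Trie d × Trie d

namespace Trie

def empty : ∀ d, Trie d
  | 0 => Nat.zero
  | d + 1 => (empty d, empty d)

def get : ∀ d, Trie d → ℕ → ℕ
  | 0, t, _ => t
  | d + 1, t, x => bif Nat.beq (Nat.mod x 2) 0 then get d t.1 (Nat.div x 2) else get d t.2 (Nat.div x 2)

/-- Adds the bits of `k` to the leaf `x`, provided that none of them is present, and continues. -/
def add : ∀ d, Trie d → ℕ → ℕ → (Trie d → Bool) → Bool
  | 0, t, _, k, c => bif Nat.beq (Nat.land t k) 0 then c (Nat.lor t k) else false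
  | d + 1, (l, r), x, k, c => bif Nat.beq (Nat.mod x 2) 0
      then add d l (Nat.div x 2) k fun l' => c (l', r)
      else add d r (Nat.div x 2) k fun r' => c (l, r')

end Trie

/-- The bits `64 * u + v` where `u` and `v` are distinct entries of `a`, `b`, `c`. -/
def pairMask (a b c : ℕ) : ℕ :=
  Nat.lor (Nat.shiftLeft (Nat.lor (Nat.pow 2 b) (Nat.pow 2 c)) (Nat.mul 64 a))
    (Nat.lor (Nat.shiftLeft (Nat.lor (Nat.pow 2 a) (Nat.pow 2 c)) (Nat.mul 64 b))
      (Nat.shiftLeft (Nat.lor (Nat.pow 2 a) (Nat.pow 2 b)) (Nat.mul 64 c)))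

/-- Adds the triples of the blocks to a trie, provided that there are no repetitions. -/
def addBlocks : List (ℕ × ℕ × ℕ × ℕ) → Trie 6 → (Trie 6 → Bool) → Bool
  | [], t, k => k t
  | (a, b, c, d) :: L, t, k =>
    t.add 6 a (pairMask b c d) fun t => t.add 6 b (pairMask a c d) fun t =>
      t.add 6 c (pairMask a b d) fun t => t.add 6 d (pairMask a b c) fun t => addBlocks L t k

/-- The entry `x` of a list of numbers below 64 packed into a number. -/
def entry (p x : ℕ) : ℕ := Nat.land (Nat.shiftRight p (Nat.mul 6 x)) 63

/-- The orbit of a block. -/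
def orbit (p : ℕ) : ℕ → ℕ → ℕ → ℕ → ℕ → List (ℕ × ℕ × ℕ × ℕ)
  | 0, _, _, _, _ => []
  | l + 1, a, b, c, d => Nat.force (entry p a) fun a => Nat.force (entry p b) fun b =>
      Nat.force (entry p c) fun c => Nat.force (entry p d) fun d => (a, b, c, d) :: orbit p l a b c d

/-- The orbits of blocks with decimal encoding `aabbccdd`. -/
def orbits (p l : ℕ) : List ℕ → List (ℕ × ℕ × ℕ × ℕ)
  | [] => []
  | b :: L => orbit p l (b / 1000000) (b / 10000 % 100) (b / 100 % 100) (b % 100) ++ orbits p l L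

/-- The number whose bit `64 * y + z` for `y < n` is the bit `z` of `f y`. -/
def rowsMask (f : ℕ → ℕ) : ℕ → ℕ
  | 0 => 0
  | y + 1 => Nat.lor (rowsMask f y) (Nat.shiftLeft (f y) (Nat.mul 64 y))

def allBelow (f : ℕ → Bool) : ℕ → Bool
  | 0 => true
  | n + 1 => bif f n then allBelow f n else false

/-- The triples in the trie are those described by `R`. -/
def checkExact (R : ℕ → ℕ → ℕ) (n : ℕ) (t : Trie 6) : Bool :=
  allBelow (fun x => Nat.beq (t.get 6 x) (bif Nat.ble n x then 0 else rowsMask (R x) n)) 64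

/-- The triples in the trie are among those described by `R`. -/
def checkSub (R : ℕ → ℕ → ℕ) (n : ℕ) (t : Trie 6) : Bool :=
  allBelow (fun x => (fun m => Nat.beq (Nat.lor (t.get 6 x) m) m)
    (bif Nat.ble n x then 0 else rowsMask (R x) n)) 64

theorem Nat.force_eq {α : Type} (n : ℕ) (f : ℕ → α) : Nat.force n f = f n := by
  cases n <;> rfl

theorem Nat.beq_eq_false_of_ne {a b : ℕ} (h : a ≠ b) : Nat.beq a b = false := by
  rwa [← Bool.not_eq_true, Nat.beq_eq]

theorem Trie.get_empty (d x : ℕ) : (Trie.empty d).get d x = 0 := by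
  induction d generalizing x with
  | zero => rfl
  | succ d ih =>
    simp only [Trie.get, Trie.empty, ih]
    cases (Nat.beq (Nat.mod x 2) 0) <;> rfl

theorem Trie.add_spec (d : ℕ) (t : Trie d) (x k : ℕ) (c : Trie d → Bool) (hx : x < 2 ^ d)
    (h : t.add d x k c = true) : ∃ t' : Trie d, c t' = true ∧ t.get d x &&& k = 0 ∧
      ∀ y < 2 ^ d, t'.get d y = if y = x then t.get d x ||| k else t.get d y := by
  induction d generalizing x with
  | zero =>
    simp only [Trie.add] at h
    by_cases h0 : Nat.land t k = 0
    · refine ⟨Nat.lor t k, ?_, h0, fun y hy => ?_⟩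
      · simpa [h0] using h
      · obtain rfl : y = x := by omega
        rw [if_pos rfl]
        rfl
    · simp [Nat.beq_eq_false_of_ne h0] at h
  | succ d ih =>
    obtain ⟨l, r⟩ := t
    have hx2 : x / 2 < 2 ^ d := by omega
    have hget : ∀ (l r : Trie d) (y : ℕ), Trie.get (d + 1) (l, r) y =
        if y % 2 = 0 then l.get d (y / 2) else r.get d (y / 2) := by
      intro l r y
      change cond (Nat.beq (y % 2) 0) _ _ = _
      by_cases hy : y % 2 = 0
      · rw [if_pos hy, hy]
        rfl
      · rw [if_neg hy, Nat.beq_eq_false_of_ne hy]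
        rfl
    have hadd : Trie.add (d + 1) (l, r) x k c = if x % 2 = 0
        then l.add d (x / 2) k fun l' => c (l', r) else r.add d (x / 2) k fun r' => c (l, r') := by
      change cond (Nat.beq (x % 2) 0) _ _ = _
      by_cases hy : x % 2 = 0
      · rw [if_pos hy, hy]
        rfl
      · rw [if_neg hy, Nat.beq_eq_false_of_ne hy]
        rfl
    rw [hadd] at h
    by_cases hp : x % 2 = 0
    · rw [if_pos hp] at h
      obtain ⟨t', h1, h2, h3⟩ := ih l (x / 2) _ hx2 h
      refine ⟨(t', r), h1, ?_, fun y hy => ?_⟩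
      · rw [hget, if_pos hp, h2]
      · rw [hget, hget, hget, if_pos hp, h3 _ (by omega)]
        have : y = x ↔ y % 2 = 0 ∧ y / 2 = x / 2 := by omega
        by_cases hy0 : y % 2 = 0 <;> simp [this, hy0]
    · rw [if_neg hp] at h
      obtain ⟨t', h1, h2, h3⟩ := ih r (x / 2) _ hx2 h
      refine ⟨(l, t'), h1, ?_, fun y hy => ?_⟩
      · rw [hget, if_neg hp, h2]
      · rw [hget, hget, hget, if_neg hp, h3 _ (by omega)]
        have : y = x ↔ y % 2 ≠ 0 ∧ y / 2 = x / 2 := by omega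
        by_cases hy0 : y % 2 = 0 <;> simp [this, hy0]

theorem testBit_pairMask {a b c u v : ℕ} (ha : a < 64) (hb : b < 64) (hc : c < 64) (hv : v < 64) :
    (pairMask a b c).testBit (64 * u + v) = true ↔ (u = a ∧ (v = b ∨ v = c)) ∨
      (u = b ∧ (v = a ∨ v = c)) ∨ (u = c ∧ (v = a ∨ v = b)) := by
  change Nat.testBit (((2 ^ b ||| 2 ^ c) <<< (64 * a)) ||| (((2 ^ a ||| 2 ^ c) <<< (64 * b)) |||
    ((2 ^ a ||| 2 ^ b) <<< (64 * c)))) _ = true ↔ _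
  simp only [Nat.testBit_or, Nat.testBit_shiftLeft, Nat.testBit_two_pow, Bool.or_eq_true,
    Bool.and_eq_true, decide_eq_true_eq]
  omega

theorem testBit_rowsMask {f : ℕ → ℕ} (hf : ∀ y, f y < 2 ^ 64) (n : ℕ) {u v : ℕ} (hv : v < 64) :
    (rowsMask f n).testBit (64 * u + v) = true ↔ u < n ∧ (f u).testBit v = true := by
  induction n with
  | zero => simp [rowsMask]
  | succ n ih =>
    change Nat.testBit (rowsMask f n ||| (f n <<< (64 * n))) _ = true ↔ _
    rw [Nat.testBit_or, Bool.or_eq_true, ih, Nat.testBit_shiftLeft, Bool.and_eq_true,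
      decide_eq_true_eq]
    constructor
    · rintro (h | ⟨h1, h2⟩)
      · exact ⟨by omega, h.2⟩
      · have : 64 * u + v - 64 * n < 64 := by
          by_contra h3
          rw [Nat.testBit_lt_two_pow ((hf n).trans_le (Nat.pow_le_pow_right (by omega)
            (not_lt.1 h3)))] at h2
          cases h2
        obtain rfl : u = n := by omega
        rw [Nat.add_sub_cancel_left] at h2
        exact ⟨by omega, h2⟩
    · rintro ⟨h1, h2⟩
      rcases Nat.lt_succ_iff_lt_or_eq.1 h1 with h | rfl
      · exact .inl ⟨h, h2⟩
      · right
        rw [Nat.add_sub_cancel_left]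
        exact ⟨by omega, h2⟩

theorem allBelow_iff {f : ℕ → Bool} {n : ℕ} : allBelow f n = true ↔ ∀ x < n, f x = true := by
  induction n with
  | zero => simp [allBelow]
  | succ n ih =>
    rw [allBelow, Bool.cond_eq_ite]
    constructor
    · intro h x hx
      split_ifs at h with h0
      rcases Nat.lt_succ_iff_lt_or_eq.1 hx with h1 | rfl
      · exact ih.1 h x h1
      · exact h0
    · intro h
      rw [if_pos (h n (by omega))]
      exact ih.2 fun x hx => h x (by omega)

/-- The distinct points `x`, `y`, `z` belong to the block. -/
def InBlock (b : ℕ × ℕ × ℕ × ℕ) (x y z : ℕ) : Prop :=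
  ∃ w, [b.1, b.2.1, b.2.2.1, b.2.2.2].Perm [x, y, z, w]

theorem inBlock_iff {a b c d x y z : ℕ} : InBlock (a, b, c, d) x y z ↔
    (x = a ∧ ((y = b ∧ (z = c ∨ z = d)) ∨ (y = c ∧ (z = b ∨ z = d)) ∨ (y = d ∧ (z = b ∨ z = c)))) ∨
    (x = b ∧ ((y = a ∧ (z = c ∨ z = d)) ∨ (y = c ∧ (z = a ∨ z = d)) ∨ (y = d ∧ (z = a ∨ z = c)))) ∨
    (x = c ∧ ((y = a ∧ (z = b ∨ z = d)) ∨ (y = b ∧ (z = a ∨ z = d)) ∨ (y = d ∧ (z = a ∨ z = b)))) ∨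
    (x = d ∧ ((y = a ∧ (z = b ∨ z = c)) ∨ (y = b ∧ (z = a ∨ z = c)) ∨ (y = c ∧ (z = a ∨ z = b)))) := by
  have h2 : ∀ {a b y z : ℕ}, [a, b].Perm [y, z] → y = a ∨ y = b := fun h => by
    simpa using h.symm.subset (List.mem_cons_self)
  have h3 : ∀ {a b c x y z : ℕ}, [a, b, c].Perm [x, y, z] → (x = a ∧ (y = b ∨ y = c)) ∨
      (x = b ∧ (y = a ∨ y = c)) ∨ (x = c ∧ (y = a ∨ y = b)) := by
    intro a b c x y z h
    have hx : x = a ∨ x = b ∨ x = c := by simpa using h.symm.subset (List.mem_cons_self)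
    rcases hx with rfl | rfl | rfl
    · exact .inl ⟨rfl, h2 h.cons_inv⟩
    · exact .inr (.inl ⟨rfl, h2 ((List.Perm.swap _ _ _).trans h).cons_inv⟩)
    · have := ((List.perm_middle (l₁ := [a, b]) (l₂ := [])).symm.trans h).cons_inv
      exact .inr (.inr ⟨rfl, h2 this⟩)
  constructor
  · rintro ⟨w, h⟩
    have hx : x = a ∨ x = b ∨ x = c ∨ x = d := by simpa using h.symm.subset (List.mem_cons_self)
    rcases hx with rfl | rfl | rfl | rfl
    · exact .inl ⟨rfl, h3 h.cons_inv⟩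
    · exact .inr (.inl ⟨rfl, h3 ((List.perm_middle (l₁ := [a])).symm.trans h).cons_inv⟩)
    · exact .inr (.inr (.inl ⟨rfl, h3 ((List.perm_middle (l₁ := [a, b])).symm.trans h).cons_inv⟩))
    · exact .inr (.inr (.inr ⟨rfl, h3 ((List.perm_middle (l₁ := [a, b, c])).symm.trans h).cons_inv⟩))
  · have key : ∀ w, (∀ n, List.count n [a, b, c, d] = List.count n [x, y, z, w]) →
        InBlock (a, b, c, d) x y z := fun w h => ⟨w, List.perm_iff_count.2 h⟩
    rintro (⟨hx, h⟩ | ⟨hx, h⟩ | ⟨hx, h⟩ | ⟨hx, h⟩) <;>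
    rcases h with (⟨hy, h⟩ | ⟨hy, h⟩ | ⟨hy, h⟩) <;> rcases h with hz | hz <;> subst x y z
    all_goals first
      | (refine key d fun n => ?_; simp only [List.count_cons] <;> ring1)
      | (refine key c fun n => ?_; simp only [List.count_cons] <;> ring1)
      | (refine key b fun n => ?_; simp only [List.count_cons] <;> ring1)
      | (refine key a fun n => ?_; simp only [List.count_cons] <;> ring1)

/-- The triple `x`, `y`, `z` is recorded in the trie. -/
def Trie.Bit (t : Trie 6) (x u v : ℕ) : Prop := (t.get 6 x).testBit (64 * u + v) = true

theorem Trie.add_bit {t : Trie 6} {x a b d : ℕ} {c : Trie 6 → Bool} (hx : x < 64) (ha : a < 64)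
    (hb : b < 64) (hd : d < 64) (h : t.add 6 x (pairMask a b d) c = true) :
    ∃ t' : Trie 6, c t' = true ∧
      (∀ u v w, u < 64 → w < 64 → (t'.Bit u v w ↔ t.Bit u v w ∨
        u = x ∧ ((v = a ∧ (w = b ∨ w = d)) ∨ (v = b ∧ (w = a ∨ w = d)) ∨
          (v = d ∧ (w = a ∨ w = b))))) ∧
      ∀ v w, w < 64 → t.Bit x v w → ¬ ((v = a ∧ (w = b ∨ w = d)) ∨ (v = b ∧ (w = a ∨ w = d)) ∨
          (v = d ∧ (w = a ∨ w = b))) := by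
  obtain ⟨t', h1, h2, h3⟩ := Trie.add_spec 6 t x _ c hx h
  refine ⟨t', h1, fun u v w hu hw => ?_, fun v w hw ht hk => ?_⟩
  · rw [Trie.Bit, h3 u hu]
    split_ifs with hux
    · rw [Nat.testBit_or, Bool.or_eq_true, testBit_pairMask ha hb hd hw, hux, Trie.Bit,
        eq_self_iff_true, true_and]
    · simp [hux, Trie.Bit]
  · have := congrArg (fun n => Nat.testBit n (64 * v + w)) h2
    simp only [Nat.testBit_and, Nat.zero_testBit] at this
    rw [(testBit_pairMask ha hb hd hw).2 hk, show (t.get 6 x).testBit (64 * v + w) = true from ht]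
      at this
    cases this

/-- All points of the block are small. -/
def SmallBlock (b : ℕ × ℕ × ℕ × ℕ) : Prop := b.1 < 64 ∧ b.2.1 < 64 ∧ b.2.2.1 < 64 ∧ b.2.2.2 < 64

theorem addBlocks_spec (L : List (ℕ × ℕ × ℕ × ℕ)) (hL : ∀ b ∈ L, SmallBlock b) (t : Trie 6)
    (k : Trie 6 → Bool) (h : addBlocks L t k = true) :
    ∃ t' : Trie 6, k t' = true ∧
      (∀ x y z, x < 64 → z < 64 → (t'.Bit x y z ↔ t.Bit x y z ∨ ∃ b ∈ L, InBlock b x y z)) ∧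
      (∀ x y z, x < 64 → z < 64 → t.Bit x y z → ∀ b ∈ L, ¬ InBlock b x y z) ∧
      L.Pairwise fun b b' => ∀ x y z, InBlock b x y z → ¬ InBlock b' x y z := by
  induction L generalizing t with
  | nil => exact ⟨t, h, by simp, by simp, List.Pairwise.nil⟩
  | cons p L ih =>
    obtain ⟨a, b, c, d⟩ := p
    obtain ⟨ha, hb, hc, hd⟩ := hL _ List.mem_cons_self
    obtain ⟨t1, h1, e1, f1⟩ := Trie.add_bit ha hb hc hd h
    obtain ⟨t2, h2, e2, f2⟩ := Trie.add_bit hb ha hc hd h1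
    obtain ⟨t3, h3, e3, f3⟩ := Trie.add_bit hc ha hb hd h2
    obtain ⟨t4, h4, e4, f4⟩ := Trie.add_bit hd ha hb hc h3
    obtain ⟨t', h', e', f', g'⟩ := ih (fun b hb => hL b (List.mem_cons_of_mem _ hb)) t4 h4
    have E : ∀ x y z, x < 64 → z < 64 →
        (t4.Bit x y z ↔ t.Bit x y z ∨ InBlock (a, b, c, d) x y z) := by
      intro x y z hx hz
      rw [e4 x y z hx hz, e3 x y z hx hz, e2 x y z hx hz, e1 x y z hx hz, inBlock_iff, or_assoc,
        or_assoc, or_assoc]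
    refine ⟨t', h', fun x y z hx hz => ?_, fun x y z hx hz ht p hp => ?_, ?_⟩
    · rw [e' x y z hx hz, E x y z hx hz, or_assoc]
      simp
    · rcases List.mem_cons.1 hp with rfl | hp
      · rw [inBlock_iff]
        rintro (⟨hh, h'⟩ | ⟨hh, h'⟩ | ⟨hh, h'⟩ | ⟨hh, h'⟩) <;> subst x
        · exact f1 y z hz ht h'
        · exact f2 y z hz ((e1 _ y z hx hz).2 (.inl ht)) h'
        · exact f3 y z hz ((e2 _ y z hx hz).2 (.inl ((e1 _ y z hx hz).2 (.inl ht)))) h'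
        · exact f4 y z hz ((e3 _ y z hx hz).2 (.inl ((e2 _ y z hx hz).2 (.inl
            ((e1 _ y z hx hz).2 (.inl ht)))))) h'
      · exact f' x y z hx hz ((E x y z hx hz).2 (.inl ht)) p hp
    · refine List.pairwise_cons.2 ⟨fun p hp x y z h => ?_, g'⟩
      have hxz : x < 64 ∧ z < 64 := by
        rw [inBlock_iff] at h
        simp only at ha hb hc hd
        omega
      exact f' x y z hxz.1 hxz.2 ((E x y z hxz.1 hxz.2).2 (.inr h)) p hp

theorem Trie.not_bit_empty (x y z : ℕ) : ¬ (Trie.empty 6).Bit x y z := by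
  rw [Trie.Bit, Trie.get_empty, Nat.zero_testBit]
  exact Bool.false_ne_true

theorem testBit_row_lt {r n z : ℕ} (h : r < 2 ^ n) (hz : r.testBit z = true) : z < n := by
  by_contra hn
  rw [Nat.testBit_lt_two_pow (h.trans_le (Nat.pow_le_pow_right (by omega) (not_lt.1 hn)))] at hz
  cases hz

section Check

variable {L : List (ℕ × ℕ × ℕ × ℕ)} {R : ℕ → ℕ → ℕ} {n : ℕ}

theorem testBit_cond_rowsMask (hR : ∀ x y, R x y < 2 ^ n) (hn : n ≤ 64) {x y z : ℕ} (hz : z < 64) :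
    Nat.testBit (bif Nat.ble n x then 0 else rowsMask (R x) n) (64 * y + z) = true ↔
      x < n ∧ y < n ∧ (R x y).testBit z = true := by
  by_cases hx : n ≤ x
  · simp [Nat.ble_eq_true_of_le hx, hx]
  · have : Nat.ble n x = false := by
      rwa [← Bool.not_eq_true, Nat.ble_eq]
    rw [this, cond_false, testBit_rowsMask (fun y => (hR x y).trans_le
      (Nat.pow_le_pow_right (by omega) hn)) n hz]
    simp [not_le.1 hx]

theorem packing_of_check (hn : n ≤ 64) (hR : ∀ x y, R x y < 2 ^ n) (hL : ∀ b ∈ L, SmallBlock b)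
    (h : addBlocks L (Trie.empty 6) (checkSub R n) = true) :
    (∀ b ∈ L, ∀ x y z, InBlock b x y z → x < n ∧ y < n ∧ (R x y).testBit z = true) ∧
      L.Pairwise fun b b' => ∀ x y z, InBlock b x y z → ¬ InBlock b' x y z := by
  obtain ⟨t, h1, h2, -, h3⟩ := addBlocks_spec L hL _ _ h
  refine ⟨fun b hb x y z hxyz => ?_, h3⟩
  have hxz : x < 64 ∧ z < 64 := by
    have := hL b hb
    simp only [SmallBlock] at this
    obtain ⟨a, b, c, d⟩ := b
    have h' := inBlock_iff.1 hxyz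
    simp only at this
    omega
  have ht := (h2 x y z hxz.1 hxz.2).2 (.inr ⟨b, hb, hxyz⟩)
  have := Nat.eq_of_beq_eq_true (allBelow_iff.1 h1 x hxz.1)
  rw [← testBit_cond_rowsMask hR hn hxz.2, ← this]
  change Nat.testBit (_ ||| _) _ = true
  rw [Nat.testBit_or, Bool.or_eq_true]
  exact .inl ht

theorem Dec.of_check (hn : n ≤ 64) (hR : ∀ x y, R x y < 2 ^ n) (hL : ∀ b ∈ L, SmallBlock b)
    (h : addBlocks L (Trie.empty 6) (checkExact R n) = true) :
    Dec fun x y z : Fin n => (R x y).testBit z = true := by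
  obtain ⟨t, h1, h2, -, h3⟩ := addBlocks_spec L hL _ _ h
  have key : ∀ x y z, x < 64 → z < 64 → ((∃ b ∈ L, InBlock b x y z) ↔
      x < n ∧ y < n ∧ (R x y).testBit z = true) := by
    intro x y z hx hz
    rw [← testBit_cond_rowsMask hR hn hz, ← Nat.eq_of_beq_eq_true (allBelow_iff.1 h1 x hx)]
    refine Iff.trans ?_ (h2 x y z hx hz).symm
    simp [Trie.not_bit_empty]
  refine ⟨fun x y z w => ∃ b ∈ L, [b.1, b.2.1, b.2.2.1, b.2.2.2].Perm [x.val, y.val, z.val, w.val],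
    ?_, ?_, ?_⟩
  · rintro x y z w ⟨b, hb, h⟩
    exact ⟨⟨b, hb, h.trans (.swap _ _ _)⟩, ⟨b, hb, h.trans (.cons _ (.swap _ _ _))⟩,
      ⟨b, hb, h.trans (.cons _ (.cons _ (.swap _ _ _)))⟩⟩
  · rintro x y z w w' ⟨b, hb, h⟩ ⟨b', hb', h'⟩
    have hbb : b = b' := by
      by_contra hne
      have : Std.Symm fun p q => ∀ x y z, InBlock p x y z → ¬ InBlock q x y z :=
        ⟨fun p q hpq x y z h h' => hpq x y z h' h⟩
      exact h3.forall hb hb' hne x y z ⟨_, h⟩ ⟨_, h'⟩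
    subst hbb
    exact Fin.ext (by simpa using (h.symm.trans h').cons_inv.cons_inv.cons_inv)
  · intro x y z
    have := key x y z (x.2.trans_le hn) (z.2.trans_le hn)
    constructor
    · intro h
      obtain ⟨b, hb, w, hw⟩ := this.2 ⟨x.2, y.2, h⟩
      have hwn : w < n := by
        have hs : w < 64 := by
          have hm : w ∈ [b.1, b.2.1, b.2.2.1, b.2.2.2] := hw.symm.subset (by simp)
          have := hL b hb
          simp only [SmallBlock] at this
          simp only [List.mem_cons, List.not_mem_nil, or_false] at hm
          omega
        refine testBit_row_lt (hR x y) ((key x y w (x.2.trans_le hn) hs).1 ⟨b, hb, z, ?_⟩).2.2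
        exact hw.trans (.cons _ (.cons _ (.swap _ _ _)))
      exact ⟨⟨w, hwn⟩, b, hb, hw⟩
    · rintro ⟨w, b, hb, hw⟩
      exact (this.1 ⟨b, hb, w, hw⟩).2.2

end Check

theorem entry_lt (p x : ℕ) : entry p x < 64 := by
  change (_ &&& 63) < 64
  exact Nat.lt_succ_of_le Nat.and_le_right

theorem smallBlock_of_mem_orbit {p l a b c d : ℕ} {q : ℕ × ℕ × ℕ × ℕ} (h : q ∈ orbit p l a b c d) :
    SmallBlock q := by
  induction l generalizing a b c d with
  | zero => simp [orbit] at h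
  | succ l ih =>
    simp only [orbit, Nat.force_eq, List.mem_cons] at h
    rcases h with rfl | h
    · exact ⟨entry_lt _ _, entry_lt _ _, entry_lt _ _, entry_lt _ _⟩
    · exact ih h

theorem smallBlock_of_mem_orbits {p l : ℕ} {B : List ℕ} {q : ℕ × ℕ × ℕ × ℕ} (h : q ∈ orbits p l B) :
    SmallBlock q := by
  induction B with
  | nil => simp [orbits] at h
  | cons b B ih =>
    rcases List.mem_append.1 h with h | h
    · exact smallBlock_of_mem_orbit h
    · exact ih h

theorem length_orbit (p l a b c d : ℕ) : (orbit p l a b c d).length = l := by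
  induction l generalizing a b c d with
  | zero => rfl
  | succ l ih => simp only [orbit, Nat.force_eq, List.length_cons, ih]

theorem length_orbits (p l : ℕ) (B : List ℕ) : (orbits p l B).length = l * B.length := by
  induction B with
  | nil => rfl
  | cons b B ih => rw [orbits, List.length_append, length_orbit, ih, List.length_cons]; ring

/-- The points of `Fin (m * s)` that are in the group of `x`. -/
def groupMask (s x : ℕ) : ℕ :=
  Nat.shiftLeft (Nat.sub (Nat.pow 2 s) 1) (Nat.mul s (Nat.div x s))

/-- The bits below `n` that are not in `f`. -/
def complMask (n f : ℕ) : ℕ := Nat.xor f (Nat.lor f (Nat.sub (Nat.pow 2 n) 1))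

/-- The points that form a triple of a candelabra system with `x` and `y`. -/
def candelabraRow (s m e x y : ℕ) : ℕ :=
  bif Nat.beq x y then 0 else complMask (Nat.mul m s)
    (Nat.lor (Nat.lor (Nat.pow 2 x) (Nat.pow 2 y)) (Nat.lor
      (bif Nat.beq (Nat.div x s) (Nat.div y s) then groupMask s x else 0)
      (bif Nat.ble (Nat.mul e s) x then 0 else
        bif Nat.ble (Nat.mul e s) y then 0 else Nat.sub (Nat.pow 2 (Nat.mul e s)) 1)))

/-- The points that form a transversal triple with `x` and `y`. -/
def transversalRow (s m x y : ℕ) : ℕ :=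
  bif Nat.beq (Nat.div x s) (Nat.div y s) then 0 else
    complMask (Nat.mul m s) (Nat.lor (groupMask s x) (groupMask s y))

theorem testBit_groupMask {s : ℕ} (hs : 0 < s) (x z : ℕ) :
    (groupMask s x).testBit z = true ↔ z / s = x / s := by
  change Nat.testBit ((2 ^ s - 1) <<< (s * (x / s))) z = true ↔ _
  rw [Nat.testBit_shiftLeft, Nat.testBit_two_pow_sub_one, Bool.and_eq_true, decide_eq_true_eq,
    decide_eq_true_eq, Nat.div_eq_iff hs, mul_comm]
  omega

theorem testBit_complMask (n f z : ℕ) :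
    (complMask n f).testBit z = true ↔ z < n ∧ ¬ f.testBit z = true := by
  change Nat.testBit (f ^^^ (f ||| (2 ^ n - 1))) z = true ↔ _
  rw [Nat.testBit_xor, Nat.testBit_or, Nat.testBit_two_pow_sub_one]
  cases f.testBit z <;> simp

theorem lt_two_pow_of_testBit {r n : ℕ} (h : ∀ z, r.testBit z = true → z < n) : r < 2 ^ n :=
  Nat.lt_pow_two_of_testBit r fun i hi => by
    by_contra hb
    exact absurd (h i (by simpa using hb)) (not_lt.2 hi)

theorem testBit_candelabraRow {s : ℕ} (hs : 0 < s) (m e x y z : ℕ) :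
    (candelabraRow s m e x y).testBit z = true ↔ z < m * s ∧ (x ≠ y ∧ x ≠ z ∧ y ≠ z) ∧
      ¬ (x / s = y / s ∧ z / s = y / s) ∧ ¬ (x / s < e ∧ y / s < e ∧ z / s < e) := by
  rw [candelabraRow]
  by_cases hxy : x = y
  · simp [hxy]
  rw [Nat.beq_eq_false_of_ne hxy, cond_false, testBit_complMask]
  have h1 : Nat.testBit (bif Nat.beq (x / s) (y / s) then groupMask s x else 0) z = true ↔
      x / s = y / s ∧ z / s = y / s := by
    by_cases h : x / s = y / s
    · rw [h, show Nat.beq (y / s) (y / s) = true from Nat.beq_eq.mpr rfl, cond_true,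
        testBit_groupMask hs, h]
      simp
    · rw [Nat.beq_eq_false_of_ne h]
      simp [h]
  have h2 : Nat.testBit (bif Nat.ble (e * s) x then 0 else
      bif Nat.ble (e * s) y then 0 else 2 ^ (e * s) - 1) z = true ↔
      x / s < e ∧ y / s < e ∧ z / s < e := by
    simp only [Nat.div_lt_iff_lt_mul hs]
    have key : ∀ a b, Nat.ble a b = decide (a ≤ b) := fun a b => by
      rw [Bool.eq_iff_iff, decide_eq_true_eq, Nat.ble_eq]
    rw [key, key]
    by_cases hx : e * s ≤ x
    · simp [hx]
    · by_cases hy : e * s ≤ y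
      · simp [hx, hy]
      · simp [hx, hy, not_le.1 hx, not_le.1 hy, Nat.testBit_two_pow_sub_one]
  change z < m * s ∧ ¬ Nat.testBit ((2 ^ x ||| 2 ^ y) ||| ((bif Nat.beq (x / s) (y / s) then
    groupMask s x else 0) ||| (bif Nat.ble (e * s) x then 0 else bif Nat.ble (e * s) y then 0 else
      2 ^ (e * s) - 1))) z = true ↔ _
  simp only [Nat.testBit_or, Bool.or_eq_true, h1, h2, Nat.testBit_two_pow, decide_eq_true_eq]
  tauto

theorem testBit_transversalRow {s : ℕ} (hs : 0 < s) (m x y z : ℕ) :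
    (transversalRow s m x y).testBit z = true ↔ z < m * s ∧
      x / s ≠ y / s ∧ x / s ≠ z / s ∧ y / s ≠ z / s := by
  rw [transversalRow]
  by_cases hxy : x / s = y / s
  · rw [show Nat.beq (Nat.div x s) (Nat.div y s) = true from Nat.beq_eq.mpr hxy]
    simp [hxy]
  rw [show Nat.beq (Nat.div x s) (Nat.div y s) = false from Nat.beq_eq_false_of_ne hxy, cond_false,
    testBit_complMask]
  change z < m * s ∧ ¬ Nat.testBit (_ ||| _) z = true ↔ _
  rw [Nat.testBit_or, Bool.or_eq_true, testBit_groupMask hs, testBit_groupMask hs]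
  tauto

section

variable {s m e : ℕ} {L : List (ℕ × ℕ × ℕ × ℕ)}

theorem Candelabra.of_check (hs : 0 < s) (hn : m * s ≤ 64) (hL : ∀ b ∈ L, SmallBlock b)
    (h : addBlocks L (Trie.empty 6) (checkExact (candelabraRow s m e) (m * s)) = true) :
    Candelabra (Fin s) Empty m e := by
  have hR : ∀ x y, candelabraRow s m e x y < 2 ^ (m * s) := fun x y =>
    lt_two_pow_of_testBit fun z hz => ((testBit_candelabraRow hs m e x y z).1 hz).1
  refine ((Dec.of_check hn hR hL h).comap_equiv
    ((Equiv.sumEmpty _ _).trans finProdFinEquiv)).congr fun x y z => ?_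
  rw [testBit_candelabraRow hs]
  obtain ⟨x, a⟩ | x := x
  · obtain ⟨y, b⟩ | y := y
    · obtain ⟨z, c⟩ | z := z
      · have key : ∀ (i : Fin m) (a : Fin s), (a.val + s * i.val) / s = i.val := fun i a => by
          rw [Nat.add_mul_div_left _ _ hs, Nat.div_eq_of_lt a.2, zero_add]
        have hne : ∀ p q : Fin m × Fin s, (Sum.inl p : Pt (Fin m) (Fin s) Empty) ≠ .inl q ↔
            p.2.val + s * p.1.val ≠ q.2.val + s * q.1.val := fun p q => by
          rw [ne_eq, ne_eq, Sum.inl.injEq, ← finProdFinEquiv_apply_val, ← finProdFinEquiv_apply_val,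
            ← Fin.ext_iff, finProdFinEquiv.injective.eq_iff]
        have hlt := (finProdFinEquiv (z, c)).2
        simp only [CTri, hne, Pt.In, Sum.elim_inl, Equiv.trans_apply, Equiv.sumEmpty_apply_inl,
          finProdFinEquiv_apply_val, key] at hlt ⊢
        simp only [hlt, true_and]
        have : (∀ i, ¬ (x = i ∧ y = i ∧ z = i)) ↔ ¬ (x.val = y.val ∧ z.val = y.val) := by
          simp only [Fin.val_inj]
          exact ⟨fun h ⟨h1, h2⟩ => h y ⟨h1, rfl, h2⟩, fun h i ⟨h1, h2, h3⟩ => h ⟨h1.trans h2.symm,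
            h3.trans h2.symm⟩⟩
        rw [this]
      · exact z.elim
    · exact y.elim
  · exact x.elim

theorem Dec.of_transversal_check (hs : 0 < s) (hn : m * s ≤ 64) (hL : ∀ b ∈ L, SmallBlock b)
    (h : addBlocks L (Trie.empty 6) (checkExact (transversalRow s m) (m * s)) = true) :
    Dec fun x y z : Fin m × Fin s => x.1 ≠ y.1 ∧ x.1 ≠ z.1 ∧ y.1 ≠ z.1 := by
  have hR : ∀ x y, transversalRow s m x y < 2 ^ (m * s) := fun x y =>
    lt_two_pow_of_testBit fun z hz => ((testBit_transversalRow hs m x y z).1 hz).1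
  refine ((Dec.of_check hn hR hL h).comap_equiv finProdFinEquiv).congr fun x y z => ?_
  rw [testBit_transversalRow hs]
  have key : ∀ p : Fin m × Fin s, (finProdFinEquiv p).val / s = p.1.val := fun p => by
    rw [finProdFinEquiv_apply_val, Nat.add_mul_div_left _ _ hs, Nat.div_eq_of_lt p.2.2, zero_add]
  simp only [key, (finProdFinEquiv z).2, true_and, ne_eq, Fin.val_inj]

end

/-- `x`, `y`, `z` are distinct elements of `b`. -/
def Finset.Triple {α : Type} (b : Finset α) (x y z : α) : Prop :=
  (x ≠ y ∧ x ≠ z ∧ y ≠ z) ∧ x ∈ b ∧ y ∈ b ∧ z ∈ b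

/-- There is a packing with `N` blocks all of whose triples satisfy `T`. -/
def Pack {α : Type} (T : α → α → α → Prop) (N : ℕ) : Prop :=
  ∃ B : Finset (Finset α), B.card = N ∧ (∀ b ∈ B, b.card = 4) ∧
    (∀ b ∈ B, ∀ x y z, b.Triple x y z → T x y z) ∧
    ∀ b ∈ B, ∀ b' ∈ B, ∀ x y z, b.Triple x y z → b'.Triple x y z → b = b'

theorem Finset.exists_triple {α : Type} {b : Finset α} (h : b.card = 4) :
    ∃ x y z, b.Triple x y z := by
  obtain ⟨x, hx, y, hy, z, hz, h1, h2, h3⟩ := Finset.two_lt_card.1 (h ▸ (by decide : 2 < 4))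
  exact ⟨x, y, z, ⟨h1, h2, h3⟩, hx, hy, hz⟩

theorem inBlock_of_mem {b : ℕ × ℕ × ℕ × ℕ} {x y z : ℕ} (h : x ≠ y ∧ x ≠ z ∧ y ≠ z)
    (hx : x ∈ [b.1, b.2.1, b.2.2.1, b.2.2.2]) (hy : y ∈ [b.1, b.2.1, b.2.2.1, b.2.2.2])
    (hz : z ∈ [b.1, b.2.1, b.2.2.1, b.2.2.2]) : InBlock b x y z := by
  have hs : List.Subperm [x, y, z] [b.1, b.2.1, b.2.2.1, b.2.2.2] := by
    refine List.subperm_of_subset (by simp [h]) fun u hu => ?_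
    simp only [List.mem_cons, List.not_mem_nil, or_false] at hu
    rcases hu with rfl | rfl | rfl <;> assumption
  obtain ⟨w, hw⟩ := hs.exists_of_length_lt (by simp)
  have hp : List.Perm [w, x, y, z] [x, y, z, w] := List.perm_append_comm (l₁ := [w])
  exact ⟨w, (hp.symm.trans (hw.perm_of_length_le (by simp))).symm⟩

namespace Pack

variable {α β ι : Type} {T T' : α → α → α → Prop} {N N' : ℕ}

theorem mono (h : Pack T N) (H : ∀ x y z, (x ≠ y ∧ x ≠ z ∧ y ≠ z) → T x y z → T' x y z) :
    Pack T' N := by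
  obtain ⟨B, h1, h2, h3, h4⟩ := h
  exact ⟨B, h1, h2, fun b hb x y z h => H x y z h.1 (h3 b hb x y z h), h4⟩

theorem iUnion [Fintype ι] {R : ι → α → α → α → Prop} (h : ∀ i, Pack (R i) N)
    (H : ∀ i j x y z, R i x y z → R j x y z → i = j) :
    Pack (fun x y z => ∃ i, R i x y z) (Fintype.card ι * N) := by
  classical
  choose B h1 h2 h3 h4 using h
  have key : ∀ i j b b', b ∈ B i → b' ∈ B j → ∀ x y z, b.Triple x y z → b'.Triple x y z → b = b' := by
    intro i j b b' hb hb' x y z h h'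
    obtain rfl := H i j x y z (h3 i b hb x y z h) (h3 j b' hb' x y z h')
    exact h4 i b hb b' hb' x y z h h'
  refine ⟨Finset.univ.biUnion B, ?_, ?_, ?_, ?_⟩
  · rw [Finset.card_biUnion, Finset.sum_congr rfl fun i _ => h1 i, Finset.sum_const, smul_eq_mul,
      Finset.card_univ]
    intro i _ j _ hij
    refine Finset.disjoint_left.2 fun b hb hb' => hij ?_
    obtain ⟨x, y, z, h⟩ := Finset.exists_triple (h2 i b hb)
    exact H i j x y z (h3 i b hb x y z h) (h3 j b hb' x y z h)
  · simpa using fun b i => h2 i b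
  · simp only [Finset.mem_biUnion, Finset.mem_univ, true_and]
    rintro b ⟨i, hb⟩ x y z h
    exact ⟨i, h3 i b hb x y z h⟩
  · simp only [Finset.mem_biUnion, Finset.mem_univ, true_and]
    rintro b ⟨i, hb⟩ b' ⟨j, hb'⟩
    exact key i j b b' hb hb'

theorem or (h : Pack T N) (h' : Pack T' N') (H : ∀ x y z, T x y z → ¬ T' x y z) :
    Pack (fun x y z => T x y z ∨ T' x y z) (N + N') := by
  classical
  obtain ⟨B, h1, h2, h3, h4⟩ := h
  obtain ⟨B', h1', h2', h3', h4'⟩ := h'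
  refine ⟨B ∪ B', ?_, ?_, ?_, ?_⟩
  · rw [Finset.card_union_of_disjoint, h1, h1']
    refine Finset.disjoint_left.2 fun b hb hb' => ?_
    obtain ⟨x, y, z, h⟩ := Finset.exists_triple (h2 b hb)
    exact H x y z (h3 b hb x y z h) (h3' b hb' x y z h)
  · intro b hb
    exact (Finset.mem_union.1 hb).elim (h2 b) (h2' b)
  · intro b hb x y z h
    exact (Finset.mem_union.1 hb).imp (fun hb => h3 b hb x y z h) fun hb => h3' b hb x y z h
  · intro b hb b' hb' x y z h h'
    rcases Finset.mem_union.1 hb with hb | hb <;> rcases Finset.mem_union.1 hb' with hb' | hb'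
    · exact h4 b hb b' hb' x y z h h'
    · exact (H x y z (h3 b hb x y z h) (h3' b' hb' x y z h')).elim
    · exact (H x y z (h3 b' hb' x y z h') (h3' b hb x y z h)).elim
    · exact h4' b hb b' hb' x y z h h'

theorem map (φ : α ↪ β) (h : Pack T N) :
    Pack (fun x y z => ∃ a b c, φ a = x ∧ φ b = y ∧ φ c = z ∧ T a b c) N := by
  obtain ⟨B, h1, h2, h3, h4⟩ := h
  have key : ∀ {b : Finset α} {x y z : β}, (b.map φ).Triple x y z →
      ∃ u v w, φ u = x ∧ φ v = y ∧ φ w = z ∧ b.Triple u v w := by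
    rintro b x y z ⟨h, hx, hy, hz⟩
    simp only [Finset.mem_map] at hx hy hz
    obtain ⟨u, hu, rfl⟩ := hx
    obtain ⟨v, hv, rfl⟩ := hy
    obtain ⟨w, hw, rfl⟩ := hz
    simp only [ne_eq, φ.injective.eq_iff] at h
    exact ⟨u, v, w, rfl, rfl, rfl, h, hu, hv, hw⟩
  refine ⟨B.map (Finset.mapEmbedding φ).toEmbedding, by rw [Finset.card_map, h1], ?_, ?_, ?_⟩
  · simp only [Finset.mem_map]
    rintro _ ⟨b, hb, rfl⟩
    exact (Finset.card_map φ).trans (h2 b hb)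
  · simp only [Finset.mem_map]
    rintro _ ⟨b, hb, rfl⟩ x y z h
    obtain ⟨u, v, w, hu, hv, hw, h⟩ := key h
    exact ⟨u, v, w, hu, hv, hw, h3 b hb u v w h⟩
  · simp only [Finset.mem_map]
    rintro _ ⟨b, hb, rfl⟩ _ ⟨b', hb', rfl⟩ x y z h h'
    obtain ⟨u, v, w, rfl, rfl, rfl, h0⟩ := key h
    obtain ⟨u', v', w', hu, hv, hw, h0'⟩ := key h'
    rw [φ.injective.eq_iff] at hu hv hw
    subst hu hv hw
    rw [h4 b hb b' hb' _ _ _ h0 h0']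

theorem of_list {n : ℕ} {T : Fin n → Fin n → Fin n → Prop} (L : List (ℕ × ℕ × ℕ × ℕ))
    (h : ∀ b ∈ L, ∀ x y z, InBlock b x y z → (x ≠ y ∧ x ≠ z ∧ y ≠ z) ∧
      ∃ (hx : x < n) (hy : y < n) (hz : z < n), T ⟨x, hx⟩ ⟨y, hy⟩ ⟨z, hz⟩)
    (hL : L.Pairwise fun b b' => ∀ x y z, InBlock b x y z → ¬ InBlock b' x y z) :
    Pack T L.length := by
  classical
  let f : ℕ × ℕ × ℕ × ℕ → Finset (Fin n) := fun b =>
    Finset.univ.filter fun x => x.val ∈ [b.1, b.2.1, b.2.2.1, b.2.2.2]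
  have hf : ∀ b x, x ∈ f b ↔ x.val = b.1 ∨ x.val = b.2.1 ∨ x.val = b.2.2.1 ∨ x.val = b.2.2.2 :=
    fun b x => by simp [f]
  have ht : ∀ b x y z, (f b).Triple x y z → InBlock b x y z := by
    rintro b x y z ⟨h, hx, hy, hz⟩
    refine inBlock_of_mem ?_ (by simpa [f] using hx) (by simpa [f] using hy) (by simpa [f] using hz)
    simpa only [ne_eq, Fin.ext_iff] using h
  have hc : ∀ b ∈ L, (f b).card = 4 := by
    rintro ⟨a, b, c, d⟩ hb
    obtain ⟨⟨h1, h2, h3⟩, ha, hb', hc, -⟩ := h _ hb a b c (inBlock_iff.2 (by simp))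
    obtain ⟨⟨-, h4, h5⟩, -, -, hd, -⟩ := h _ hb a b d (inBlock_iff.2 (by simp))
    obtain ⟨⟨-, -, h6⟩, -⟩ := h _ hb a c d (inBlock_iff.2 (by simp))
    have : f (a, b, c, d) = {⟨a, ha⟩, ⟨b, hb'⟩, ⟨c, hc⟩, ⟨d, hd⟩} := by
      ext x
      simp [hf, Fin.ext_iff]
    rw [this]
    simp [Finset.card_insert_of_notMem, h1, h2, h3, h4, h5, h6]
  have hp : L.Pairwise fun b b' => f b ≠ f b' := by
    refine hL.imp_of_mem fun {b b'} hb hb' hbb he => ?_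
    obtain ⟨x, y, z, hxyz⟩ := Finset.exists_triple (hc b hb)
    exact hbb x y z (ht _ _ _ _ hxyz) (ht _ _ _ _ (he ▸ hxyz))
  refine ⟨(L.map f).toFinset, ?_, ?_, ?_, ?_⟩
  · rw [List.toFinset_card_of_nodup (List.pairwise_map.2 hp), List.length_map]
  · simp only [List.mem_toFinset, List.mem_map]
    rintro _ ⟨b, hb, rfl⟩
    exact hc b hb
  · simp only [List.mem_toFinset, List.mem_map]
    rintro _ ⟨b, hb, rfl⟩ x y z hxyz
    obtain ⟨-, hx, hy, hz, hT⟩ := h b hb x y z (ht _ _ _ _ hxyz)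
    exact hT
  · simp only [List.mem_toFinset, List.mem_map]
    rintro _ ⟨b, hb, rfl⟩ _ ⟨b', hb', rfl⟩ x y z h h'
    by_contra hne
    have : Std.Symm fun p q => ∀ x y z, InBlock p x y z → ¬ InBlock q x y z :=
      ⟨fun p q hpq x y z h h' => hpq x y z h' h⟩
    exact hL.forall hb hb' (fun he => hne (congrArg f he)) x y z (ht _ _ _ _ h) (ht _ _ _ _ h')

theorem of_check {L : List (ℕ × ℕ × ℕ × ℕ)} {n e N : ℕ} (hN : L.length = N) (hn : n ≤ 64)
    (hL : ∀ b ∈ L, SmallBlock b)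
    (h : addBlocks L (Trie.empty 6) (checkSub (candelabraRow 1 n e) n) = true) :
    Pack (fun x y z : Fin n => ¬ (x.val < e ∧ y.val < e ∧ z.val < e)) N := by
  have hR : ∀ x y, candelabraRow 1 n e x y < 2 ^ n := fun x y =>
    lt_two_pow_of_testBit fun z hz => by
      simpa using ((testBit_candelabraRow one_pos n e x y z).1 hz).1
  obtain ⟨h1, h2⟩ := packing_of_check hn hR hL h
  subst hN
  refine of_list L (fun b hb x y z hxyz => ?_) h2
  obtain ⟨hx, hy, hz⟩ := h1 b hb x y z hxyz
  rw [testBit_candelabraRow one_pos] at hz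
  simp only [mul_one, Nat.div_one] at hz
  exact ⟨hz.2.1, hx, hy, hz.1, hz.2.2.2⟩

end Pack

def blocksTen : List (ℕ × ℕ × ℕ × ℕ) :=
  orbits 0x9207185103081 10 [10206, 10304, 20407]

theorem Candelabra.one_ten : Candelabra (Fin 1) Empty 10 0 :=
  .of_check (L := blocksTen) (by decide) (by decide) (fun _ => smallBlock_of_mem_orbits) (by decide +kernel)

def blocksFourteen : List (ℕ × ℕ × ℕ × ℕ) :=
  orbits 0x1cd30b289200185103081 7 [10205, 10310, 10711, 10809, 11213, 20712, 20810, 21113, 30713,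
    30811, 30912, 70910, 7080911]

theorem Candelabra.one_fourteen : Candelabra (Fin 1) Empty 14 0 :=
  .of_check (L := blocksFourteen) (by decide) (by decide) (fun _ => smallBlock_of_mem_orbits) (by decide +kernel)

def blocksTransversalFive : List (ℕ × ℕ × ℕ × ℕ) :=
  orbits 0xc20404d24503ce34c2ca2481c6144 5 [40818, 40917, 41013, 41112, 41519, 50815, 50912,
    51017, 51118, 51419, 60814, 61019, 61113, 61517, 70914, 71015, 71119, 71318, 91319, 91518,
    101418, 111417, 1050919, 1051013, 1051418, 1061018, 1061114, 1070915, 1071118, 1111519,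
    2061119, 2071114]

theorem Dec.transversal_five_four :
    Dec fun x y z : Fin 5 × Fin 4 => x.1 ≠ y.1 ∧ x.1 ≠ z.1 ∧ y.1 ≠ z.1 :=
  .of_transversal_check (L := blocksTransversalFive) (by decide) (by decide)
    (fun _ => smallBlock_of_mem_orbits) (by decide +kernel)

def blocksTransversalSix : List (ℕ × ℕ × ℕ × ℕ) :=
  orbits 0x3d140c38d24b2862070c5100081 3 [30617, 30714, 30813, 30916, 31015, 31112, 40615, 40717,
    40814, 40912, 41016, 41113, 50611, 50709, 50810, 51217, 51315, 51416, 60913, 61014, 61216,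
    71012, 71115, 71316, 80917, 81116, 81215, 91415, 101317, 111417, 3060912, 3061013, 3061415,
    3071016, 3071117, 3071215, 3080914, 3081115, 3081216, 3091317, 3101417, 3111316, 6111217,
    6111315, 6111416]

theorem Dec.transversal_six_three :
    Dec fun x y z : Fin 6 × Fin 3 => x.1 ≠ y.1 ∧ x.1 ≠ z.1 ∧ y.1 ≠ z.1 :=
  .of_transversal_check (L := blocksTransversalSix) (by decide) (by decide)
    (fun _ => smallBlock_of_mem_orbits) (by decide +kernel)

def blocksSixFive : List (ℕ × ℕ × ℕ × ℕ) :=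
  orbits 0x49759551331140f38d75c6da65824b2862070c5100081 9 [11220, 11321, 12429, 31215, 31825,
    31924, 41221, 41329, 41828, 51225, 51324, 51823, 61224, 61325, 61819, 71218, 71327, 71928,
    81229, 81323, 81824, 91213, 91821, 92425, 101222, 101319, 102427, 111227, 111318, 111926,
    121419, 122628, 131528, 132022, 182729, 192125, 3041219, 3041322, 3042429, 3061221, 3061318,
    3062427, 3071222, 3071321, 3072425, 3081228, 3081327, 3081821, 3091229, 3091328, 3091823,
    3101227, 3101326, 3101819, 3111223, 3111324, 3111829, 3121420, 3122426, 3131519, 3132529,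
    3182026, 3192129, 6071228, 6071329, 6071823, 6091223, 6091327, 6091828, 6101217, 6101821,
    6102429, 6111222, 6111328, 6111927, 6121429, 6121820, 6131526, 6132123, 6182529, 6192428,
    9101221, 9101324, 9101825, 9121428, 9122527, 9131522, 9131923, 9182029, 9192426, 12131823,
    12131926, 12132028, 12132127, 12132229, 12151821, 12151925, 12152024, 12152227, 12152328,
    12171819, 12172026, 12172124, 12172225, 12172329]

theorem Candelabra.six_five : Candelabra (Fin 6) Empty 5 2 :=
  .of_check (L := blocksSixFive) (by decide) (by decide) (fun _ => smallBlock_of_mem_orbits) (by decide +kernel)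

def blocksSixSeven : List (ℕ × ℕ × ℕ × ℕ) :=
  orbits 0x3ce34c4509a5929a2781f7a38a169961d71b5134975951891cb288003045102 15 [11213, 11439,
    11531, 21223, 21330, 21417, 31216, 31317, 31415, 41222, 41328, 41617, 61238, 61335, 61539,
    71224, 71332, 71422, 81235, 81315, 81625, 91214, 91339, 91538, 101229, 101331, 101432, 111237,
    111323, 111418, 121739, 121840, 122033, 122131, 122732, 122836, 123041, 131421, 131634,
    132029, 133638, 142325, 142931, 143037, 151624, 151730, 151832, 162339, 1031238, 1031329,
    1031417, 1061230, 1061331, 1061432, 1071236, 1071339, 1071524, 1081239, 1081337, 1081416,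
    1091222, 1091323, 1091418, 1101234, 1101424, 1101517, 1111228, 1111330, 1111639, 1121529,
    1121637, 1121733, 1121831, 1121927, 1122341, 1122435, 1131420, 1131725, 1131834, 1132128,
    1132235, 1142225, 1142331, 1142837, 1151638, 1152239, 1161825, 6071217, 6071324, 6071437,
    6081236, 6081316, 6081525, 6091216, 6091314, 6091517, 6101220, 6101425, 6101516, 6121334,
    6121540, 6121825, 6122133, 6122729, 6122832, 6123139, 6132039, 6132137, 6132225, 6132330,
    6132836, 6141522, 6141636, 6143138, 6152430, 6161724, 6162539, 7091221, 7091316, 7091532,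
    7121333, 7121623, 7121938, 7122034, 7122232, 7122539, 7123541, 7131829, 7132028, 7132335,
    7133037, 7141529, 7141721, 7142435, 7143032, 7151838, 7152331, 7161739, 12131822, 12131928,
    12132124, 12132338, 12132529, 12133032, 12133136, 12133540, 12133739, 12142025, 12142136,
    12142223, 12142429, 12142628, 12142734, 12143031, 12143241, 12143738, 12151839, 12152041,
    12152127, 12152237, 12152332, 12152431, 12152538, 12152633, 12152835, 12153436, 12172032,
    12172234, 12172541, 12172737, 12172930, 12182026, 12182830, 12183537, 12192937, 12202235,
    12212530, 12213237, 12222441, 12222536, 12222839, 12222933, 12233437, 12252731, 13152022,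
    13152930]

theorem Candelabra.six_seven : Candelabra (Fin 6) Empty 7 2 :=
  .of_check (L := blocksSixSeven) (by decide) (by decide) (fun _ => smallBlock_of_mem_orbits) (by decide +kernel)

def blocksSixNine : List (ℕ × ℕ × ℕ × ℕ) :=
  orbits 0x31140f38dd74cf2c70beeb6caeaa689e69648e28607de75c6da6585d65544d21c62092ca040083144 42
    [11218, 21222, 31227, 51249, 61230, 71237, 81239, 91251, 101213, 111244, 121426, 121738,
    121935, 122053, 122134, 122346, 122940, 131530, 131825, 132232, 1021251, 1031232, 1061239,
    1071220, 1081234, 1091241, 1101229, 1111213, 1121419, 1121726, 1122138, 1122440, 1122549,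
    1122746, 1123037, 1124253, 1131546, 1132234, 2061237, 2071232, 2081225, 2091217, 2101220,
    2111230, 2121343, 2121433, 2121835, 2121924, 2122149, 2122641, 2123453, 2131549, 2132242,
    2132737, 6071222, 6081218, 6091229, 6111253, 6121334, 6121440, 6121943, 6122024, 6122126,
    6122532, 6122744, 6124146, 6131542, 6132244, 7081251, 7091234, 7121342, 7121424, 7121945,
    7122139, 7122349, 7122531, 7122936, 7131551, 7132041, 7132744, 8121423, 8121727, 8121933,
    8122244, 8122443, 8122941, 8123236, 8124653, 8131539, 8131827, 12131849, 12131937, 12132051,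
    12132145, 12132253, 12132335, 12132452, 12132546, 12132629, 12133031, 12133250, 12133338,
    12134048, 12134447, 12141834, 12142037, 12142125, 12142242, 12142753, 12142843, 12142944,
    12143041, 12143136, 12143251, 12143949, 12144652, 12151832, 12151939, 12152047, 12152651,
    12153153, 12153749, 12182444, 12182939, 12183042, 12183150, 12184751, 12192634, 12193038,
    12193244, 12193649, 12194251, 12202539, 12202932, 12203043, 12203538, 12203648, 12213246,
    12222637, 12223145, 12223848, 12233242] ++ orbits
    0x31140f38dd74cf2c70beeb6caeaa689e69648e28607de75c6da6585d65544d21c62092ca040083144 21 [41215,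
    1051215, 2031215, 6101215, 7111215, 8091215, 12153033]

theorem Candelabra.six_nine : Candelabra (Fin 6) Empty 9 2 :=
  .of_check (L := blocksSixNine) (by decide) (by decide) (fun _ hb =>
    (List.mem_append.1 hb).elim smallBlock_of_mem_orbits smallBlock_of_mem_orbits) (by decide +kernel)

def blocksThirtyFive : List (ℕ × ℕ × ℕ × ℕ) :=
  orbits 0x103ce34c2d15955134a07de76285c6da6585c1100209287083146 24 [11131, 11225, 11326, 21128,
    21227, 21330, 31126, 31228, 31331, 51129, 51219, 52324, 61133, 61224, 61329, 71130, 71216,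
    72432, 101122, 101223, 102428, 111232, 111517, 111619, 112327, 112434, 121318, 122634, 122933,
    132333, 132532, 132834, 232934, 1021130, 1021216, 1022432, 1051126, 1111525, 1111620, 1111834,
    1112333, 1121323, 1121826, 2111218, 2112129, 2112425, 2232530, 11121325, 11121431, 11121526,
    11122233, 11122329, 11122730, 11131732, 11131821, 11132229, 11132334, 11132433, 11141733,
    11142432, 11172430, 11182530] ++ orbits
    0x103ce34c2d15955134a07de76285c6da6585c1100209287083146 12 [41114, 41215, 41316, 1051215,
    2031114]

theorem Pack.thirtyFive : Pack (fun x y z : Fin 35 => ¬ (x.val < 11 ∧ y.val < 11 ∧ z.val < 11)) 1548 :=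
  .of_check (L := blocksThirtyFive) (by simp [blocksThirtyFive, length_orbits]) (by decide)
    (fun _ hb =>
    (List.mem_append.1 hb).elim smallBlock_of_mem_orbits smallBlock_of_mem_orbits) (by decide +kernel)

def blocksEleven : List (ℕ × ℕ × ℕ × ℕ) :=
  orbits 0xa2481c61440c2040 1 [10204, 10305, 10710, 20307, 20608, 20910, 30408, 30609, 40509,
    40610, 50607, 50810, 70809, 1020510, 1020609, 1020708, 1030410, 1030607, 1030809, 1040508,
    1040709, 1060810, 2030409, 2030508, 2030610, 2040506, 2040710, 2050709, 3040507, 3050910,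
    3070810, 4060708, 4080910, 5060809, 6070910]

theorem Pack.eleven : Pack (fun x y z : Fin 11 => ¬ (x.val < 0 ∧ y.val < 0 ∧ z.val < 0)) 35 :=
  .of_check (L := blocksEleven) (by simp [blocksEleven, length_orbits]) (by decide)
    (fun _ => smallBlock_of_mem_orbits) (by decide +kernel)

section Ingredients

variable {κ κ' W W' : Type}

/-- The points of a triple belong to distinct groups. -/
def Transverse (x y z : κ × W) : Prop := x.1 ≠ y.1 ∧ x.1 ≠ z.1 ∧ y.1 ≠ z.1

/-- The points of a triple are distinct and do not belong to a single group. -/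
def Spread (x y z : κ × W) : Prop := (x ≠ y ∧ x ≠ z ∧ y ≠ z) ∧ ¬ (x.1 = y.1 ∧ x.1 = z.1)

theorem Dec.transverse_of_card [Finite κ] [Finite κ'] [Finite W] [Finite W']
    (h : Dec (Transverse (κ := κ) (W := W))) (hκ : Nat.card κ' = Nat.card κ)
    (hW : Nat.card W' = Nat.card W) : Dec (Transverse (κ := κ') (W := W')) := by
  obtain ⟨eκ⟩ := Finite.card_eq.1 hκ
  obtain ⟨eW⟩ := Finite.card_eq.1 hW
  refine (h.comap_equiv (eκ.prodCongr eW)).congr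
    fun x y z => ?_
  simp [Transverse]

theorem Dec.spread_of_card [Finite κ] [Finite κ'] [Finite W] [Finite W']
    (h : Dec (Spread (κ := κ) (W := W))) (hκ : Nat.card κ' = Nat.card κ)
    (hW : Nat.card W' = Nat.card W) : Dec (Spread (κ := κ') (W := W')) := by
  obtain ⟨eκ⟩ := Finite.card_eq.1 hκ
  obtain ⟨eW⟩ := Finite.card_eq.1 hW
  refine (h.comap_equiv (eκ.prodCongr eW)).congr
    fun x y z => ?_
  simp only [Spread, ne_eq, Equiv.prodCongr_apply, EmbeddingLike.apply_eq_iff_eq, Prod.map_fst,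
    (eκ.injective.prodMap eW.injective).eq_iff]

theorem Dec.transverse_four (Z : Type) [AddCommGroup Z] :
    Dec (Transverse (κ := Fin 4) (W := Z)) := by
  refine (Dec.of_transversal Prod.fst Prod.snd fun x y h h' => Prod.ext h h').congr fun x y z => ?_
  constructor
  · intro h
    have key : ∀ a b c : Fin 4, (a ≠ b ∧ a ≠ c ∧ b ≠ c) → ∃ d, a ≠ b ∧ a ≠ c ∧ a ≠ d ∧ b ≠ c ∧
        b ≠ d ∧ c ≠ d := by decide
    obtain ⟨d, hd⟩ := key _ _ _ h
    exact ⟨(d, -(x.2 + y.2 + z.2)), hd, add_neg_cancel _⟩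
  · rintro ⟨w, ⟨h1, h2, -, h3, -⟩, -⟩
    exact ⟨h1, h2, h3⟩

theorem Dec.transverse_twelve [Finite κ] (h : Nat.card κ = 4 ∨ Nat.card κ = 6) :
    Dec (Transverse (κ := κ) (W := Fin 12)) := by
  rcases h with h | h
  · exact (Dec.transverse_four (ZMod 12)).transverse_of_card (by simpa using h) (by simp)
  · have := (Dec.transversal_six_three.prod (ZMod 4)).comap_equiv
      (Equiv.prodAssoc (Fin 6) (Fin 3) (ZMod 4)).symm
    exact (show Dec (Transverse (κ := Fin 6) (W := Fin 3 × ZMod 4)) from this).transverse_of_card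
      (by simpa using h) (by simp)

theorem Dec.spread_of_transverse {W : Type} [Fintype W] (hW : Even (Fintype.card W))
    (h : Dec (Transverse (κ := κ) (W := W))) : Dec (Spread (κ := κ) (W := W)) := by
  refine h.or (Dec.of_oneFact (ι := κ) (OneFact.complete hW)) (fun x y z => ?_) ?_
  · simp only [Spread, Transverse, ne_eq, Prod.ext_iff]
    grind
  · rintro x y z ⟨h1, h2, h3⟩ (h | h | h)
    · exact h1 h.1
    · exact h2 h.1
    · exact h3 h.1

theorem Dec.spread_of_cTri {h : κ → Prop} (hh : ∀ i, ¬ h i) (H : Dec (CTri κ W Empty h)) :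
    Dec (Spread (κ := κ) (W := W)) := by
  refine (H.comap_equiv (Equiv.sumEmpty _ _).symm).congr fun x y z => ?_
  simp only [CTri, Spread, Pt.In, Equiv.sumEmpty_symm_apply, Sum.elim_inl, ne_eq, Sum.inl.injEq, hh,
    and_self, not_false_eq_true, and_true]
  exact and_congr_right fun _ => ⟨fun h i ⟨h1, h2, h3⟩ => h ⟨h1.trans h2.symm, h1.trans h3.symm⟩,
    fun h ⟨h1, h2⟩ => h _ ⟨rfl, h1.symm, h2.symm⟩⟩

theorem Dec.spread_twelve [Finite κ] (h : Nat.card κ = 3 ∨ Nat.card κ = 5) :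
    Dec (Spread (κ := κ) (W := Fin 12)) := by
  rcases h with h | h
  · have := Dec.tripling_card (Z := Fin 12) (S := Empty) (v := 6) (f := 2) (by decide) (by decide)
      (by simp) (by simp)
    exact (Dec.spread_of_cTri (fun _ => id) this).spread_of_card (by simpa using h) rfl
  · have := (Dec.transversal_five_four.prod (ZMod 3)).comap_equiv
      (Equiv.prodAssoc (Fin 5) (Fin 4) (ZMod 3)).symm
    refine Dec.spread_of_transverse (by simp; decide) ?_
    exact (show Dec (Transverse (κ := Fin 5) (W := Fin 4 × ZMod 3)) from this).transverse_of_card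
      (by simpa using h) (by simp)

end Ingredients

section BlowUp

variable {P : Type} {𝓑 : Set (Set P)} {p q : P}

/-- The triples of points with nonzero weight that are not in a group. -/
def OffLines (𝓑 : Set (Set P)) (p q : P) (W : Type) (x y z : P × W) : Prop :=
  (x ≠ y ∧ x ≠ z ∧ y ≠ z) ∧ (x.1 ≠ q ∧ y.1 ≠ q ∧ z.1 ≠ q) ∧
    ∀ b ∈ 𝓑, p ∈ b → q ∈ b → ¬ (x.1 ∈ b ∧ y.1 ∈ b ∧ z.1 ∈ b)

theorem Dec.offLines [Finite P]
    (hex : ∀ x y z, x ≠ y → x ≠ z → y ≠ z → ∃ b ∈ 𝓑, x ∈ b ∧ y ∈ b ∧ z ∈ b)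
    (hun : ∀ b ∈ 𝓑, ∀ b' ∈ 𝓑, ∀ x y z, x ≠ y → x ≠ z → y ≠ z → x ∈ b → y ∈ b → z ∈ b →
      x ∈ b' → y ∈ b' → z ∈ b' → b = b')
    (hcard : ∀ b ∈ 𝓑, b.ncard = 4 ∨ b.ncard = 6) (hpq : p ≠ q) (hex2 : 2 < Nat.card P) :
    Dec (OffLines 𝓑 p q (Fin 12)) := by
  classical
  let R : {b // b ∈ 𝓑 ∧ ¬ (p ∈ b ∧ q ∈ b)} → P × Fin 12 → P × Fin 12 → P × Fin 12 → Prop :=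
    fun b x y z => (x.1 ∈ b.1 ∧ y.1 ∈ b.1 ∧ z.1 ∈ b.1) ∧ (x.1 ≠ q ∧ y.1 ≠ q ∧ z.1 ≠ q) ∧
      if q ∈ b.1 then Spread x y z else Transverse x y z
  have uniq : ∀ {b b' : Set P} {x y z : P × Fin 12}, b ∈ 𝓑 → b' ∈ 𝓑 →
      (x.1 ∈ b ∧ y.1 ∈ b ∧ z.1 ∈ b) → (x.1 ∈ b' ∧ y.1 ∈ b' ∧ z.1 ∈ b') →
      (x.1 ≠ q ∧ y.1 ≠ q ∧ z.1 ≠ q) → ((q ∈ b ∧ q ∈ b' ∧ Spread x y z) ∨ Transverse x y z) →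
      b = b' := by
    rintro b b' x y z hb hb' ⟨hx, hy, hz⟩ ⟨hx', hy', hz'⟩ ⟨hxq, hyq, hzq⟩
      (⟨hq, hq', -, h⟩ | ⟨h1, h2, h3⟩)
    · by_cases hxy : x.1 = y.1
      · exact hun b hb b' hb' x.1 z.1 q (fun hh => h ⟨hxy, hh⟩) hxq hzq hx hz hq hx' hz' hq'
      · exact hun b hb b' hb' x.1 y.1 q hxy hxq hyq hx hy hq hx' hy' hq'
    · exact hun b hb b' hb' _ _ _ h1 h2 h3 hx hy hz hx' hy' hz'
  refine Dec.iUnion R (fun b => ?_) (fun x y z => ?_) fun b b' x y z h h' => ?_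
  · obtain ⟨b, hb, hbpq⟩ := b
    by_cases hq : q ∈ b
    · let φ : ↥(b \ {q}) × Fin 12 → P × Fin 12 := fun x => (x.1.1, x.2)
      have hφ : φ.Injective := fun x y h => Prod.ext (Subtype.ext (Prod.ext_iff.1 h).1)
        (Prod.ext_iff.1 h).2
      have hs : Nat.card ↥(b \ {q}) = 3 ∨ Nat.card ↥(b \ {q}) = 5 := by
        rw [Nat.card_coe_set_eq, Set.ncard_sdiff_singleton_of_mem hq]
        have := hcard b hb
        omega
      refine ((Dec.spread_twelve hs).lift φ hφ).congr fun x y z => ?_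
      simp only [R, if_pos hq]
      constructor
      · rintro ⟨⟨hx, hy, hz⟩, ⟨hx', hy', hz'⟩, ⟨h1, h2, h3⟩, h4⟩
        refine ⟨(⟨x.1, hx, hx'⟩, x.2), (⟨y.1, hy, hy'⟩, y.2), (⟨z.1, hz, hz'⟩, z.2), rfl, rfl, rfl,
          ⟨?_, ?_, ?_⟩, ?_⟩
        · exact fun h => h1 (congrArg φ h)
        · exact fun h => h2 (congrArg φ h)
        · exact fun h => h3 (congrArg φ h)
        · exact fun h => h4 ⟨congrArg Subtype.val h.1, congrArg Subtype.val h.2⟩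
      · rintro ⟨x, y, z, rfl, rfl, rfl, ⟨h1, h2, h3⟩, h4⟩
        refine ⟨⟨x.1.2.1, y.1.2.1, z.1.2.1⟩, ⟨x.1.2.2, y.1.2.2, z.1.2.2⟩, ⟨hφ.ne h1, hφ.ne h2,
          hφ.ne h3⟩, ?_⟩
        simpa [φ, Subtype.ext_iff] using h4
    · let φ : ↥b × Fin 12 → P × Fin 12 := fun x => (x.1.1, x.2)
      have hφ : φ.Injective := fun x y h => Prod.ext (Subtype.ext (Prod.ext_iff.1 h).1)
        (Prod.ext_iff.1 h).2
      refine ((Dec.transverse_twelve (hcard b hb)).lift φ hφ).congr fun x y z => ?_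
      simp only [R, if_neg hq]
      constructor
      · rintro ⟨⟨hx, hy, hz⟩, -, h⟩
        exact ⟨(⟨x.1, hx⟩, x.2), (⟨y.1, hy⟩, y.2), (⟨z.1, hz⟩, z.2), rfl, rfl, rfl,
          by simpa [Transverse] using h⟩
      · rintro ⟨x, y, z, rfl, rfl, rfl, h⟩
        have key : ∀ x : ↥b, x.1 ≠ q := fun x h => hq (h ▸ x.2)
        exact ⟨⟨x.1.2, y.1.2, z.1.2⟩, ⟨key _, key _, key _⟩,
          by simpa [Transverse, φ, Subtype.ext_iff] using h⟩
  · constructor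
    · rintro ⟨hd, ⟨hx, hy, hz⟩, h⟩
      by_cases h0 : x.1 = y.1 ∧ x.1 = z.1
      · obtain ⟨r, hpr, hqr, hr⟩ : ∃ r, p ≠ r ∧ q ≠ r ∧ (x.1 = p ∨ x.1 = r) := by
          by_cases hxp : x.1 = p
          · obtain ⟨r, hr⟩ : ∃ r, r ∉ ({p, q} : Set P) := by
              by_contra! hr
              have := Set.ncard_le_ncard (s := Set.univ) (t := {p, q}) fun r _ => hr r
              rw [Set.ncard_univ, Set.ncard_pair hpq] at this
              omega
            simp only [Set.mem_insert_iff, Set.mem_singleton_iff, not_or] at hr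
            exact ⟨r, Ne.symm hr.1, Ne.symm hr.2, .inl hxp⟩
          · exact ⟨x.1, Ne.symm hxp, hx.symm, .inr rfl⟩
        obtain ⟨b, hb, h1, h2, h3⟩ := hex p q r hpq hpr hqr
        have hxb : x.1 ∈ b := by rcases hr with hr | hr <;> rwa [hr]
        exact (h b hb h1 h2 ⟨hxb, h0.1 ▸ hxb, h0.2 ▸ hxb⟩).elim
      have key : ∀ r s, r ≠ s → r ≠ q → s ≠ q → (x.1 = r ∨ x.1 = s) → (y.1 = r ∨ y.1 = s) →
          (z.1 = r ∨ z.1 = s) → ∃ i, R i x y z := by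
        intro r s hrs hr hs hxr hyr hzr
        obtain ⟨b, hb, h1, h2, h3⟩ := hex r s q hrs hr hs
        have hxb : x.1 ∈ b := by rcases hxr with hh | hh <;> rwa [hh]
        have hyb : y.1 ∈ b := by rcases hyr with hh | hh <;> rwa [hh]
        have hzb : z.1 ∈ b := by rcases hzr with hh | hh <;> rwa [hh]
        refine ⟨⟨b, hb, fun hpq => h b hb hpq.1 hpq.2 ⟨hxb, hyb, hzb⟩⟩, ⟨hxb, hyb, hzb⟩,
          ⟨hx, hy, hz⟩, ?_⟩
        rw [if_pos h3]
        exact ⟨hd, h0⟩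
      by_cases hxy : x.1 = y.1
      · exact key x.1 z.1 (fun hh => h0 ⟨hxy, hh⟩) hx hz (.inl rfl) (.inl hxy.symm) (.inr rfl)
      by_cases hxz : x.1 = z.1
      · exact key x.1 y.1 hxy hx hy (.inl rfl) (.inr rfl) (.inl hxz.symm)
      by_cases hyz : y.1 = z.1
      · exact key x.1 y.1 hxy hx hy (.inl rfl) (.inr rfl) (.inr hyz.symm)
      obtain ⟨b, hb, h1, h2, h3⟩ := hex x.1 y.1 z.1 hxy hxz hyz
      refine ⟨⟨b, hb, fun hpq => h b hb hpq.1 hpq.2 ⟨h1, h2, h3⟩⟩, ⟨h1, h2, h3⟩, ⟨hx, hy, hz⟩, ?_⟩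
      split_ifs
      · exact ⟨hd, h0⟩
      · exact ⟨hxy, hxz, hyz⟩
    · rintro ⟨⟨b, hb, hbpq⟩, hm, hq, h⟩
      refine ⟨?_, hq, fun b' hb' hp hq' hm' => hbpq ?_⟩
      · split_ifs at h
        · exact h.1
        · exact ⟨fun hh => h.1 (congrArg _ hh), fun hh => h.2.1 (congrArg _ hh),
            fun hh => h.2.2 (congrArg _ hh)⟩
      · have : b = b' := by
          split_ifs at h with hqb
          · exact uniq hb hb' hm hm' hq (.inl ⟨hqb, hq', h⟩)
          · exact uniq hb hb' hm hm' hq (.inr h)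
        exact this ▸ ⟨hp, hq'⟩
  · refine Subtype.ext (uniq b.2.1 b'.2.1 h.1 h'.1 h.2.1 ?_)
    replace h := h.2.2
    replace h' := h'.2.2
    split_ifs at h with hb
    · split_ifs at h' with hb'
      · exact .inl ⟨hb, hb', h⟩
      · exact .inr h'
    · exact .inr h

end BlowUp

section Design

variable {α : Type} {T : α → α → α → Prop}

theorem Dec.exists_design [DecidableEq α] (h : Dec T)
    (hT : ∀ x y z, T x y z → x ≠ y ∧ x ≠ z ∧ y ≠ z) :
    ∃ 𝓑 : Set (Finset α), (∀ b ∈ 𝓑, b.card = 4) ∧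
      (∀ b ∈ 𝓑, ∀ x y z, b.Triple x y z → T x y z) ∧
      (∀ x y z, T x y z → ∃ b ∈ 𝓑, b.Triple x y z) ∧
      ∀ b ∈ 𝓑, ∀ b' ∈ 𝓑, ∀ x y z, b.Triple x y z → b'.Triple x y z → b = b' := by
  obtain ⟨Q, h1, h2, h3⟩ := h
  have key : ∀ a b c d, Q a b c d → ∀ x y z, Finset.Triple {a, b, c, d} x y z →
      ∃ w, Q x y z w ∧ ({a, b, c, d} : Finset α) = {x, y, z, w} := by
    rintro a b c d hQ x y z ⟨⟨hxy, hxz, hyz⟩, hx, hy, hz⟩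
    simp only [Finset.mem_insert, Finset.mem_singleton] at hx hy hz
    have e1 : ∃ b' c' d', Q x b' c' d' ∧ ∀ u, u ∈ ({a, b, c, d} : Finset α) ↔
        u = x ∨ u = b' ∨ u = c' ∨ u = d' := by
      clear h2 h3
      simp only [Finset.mem_insert, Finset.mem_singleton]
      have hb := (h1 _ _ _ _ hQ).1
      have hc := (h1 _ _ _ _ (h1 _ _ _ _ hQ).2.1).1
      have hd := (h1 _ _ _ _ (h1 _ _ _ _ (h1 _ _ _ _ hQ).2.2).2.1).1
      rcases hx with rfl | rfl | rfl | rfl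
      · exact ⟨_, _, _, hQ, fun u => Iff.rfl⟩
      · exact ⟨_, _, _, hb, fun u => or_left_comm⟩
      · exact ⟨_, _, _, hc, fun u => by clear * -; grind⟩
      · exact ⟨_, _, _, hd, fun u => by clear * -; grind⟩
    obtain ⟨b', c', d', hQ1, hu1⟩ := e1
    have e2 : ∃ c'' d'', Q x y c'' d'' ∧ ∀ u, u ∈ ({a, b, c, d} : Finset α) ↔
        u = x ∨ u = y ∨ u = c'' ∨ u = d'' := by
      have hy' := (hu1 y).1 (by simpa using hy)
      have hc := (h1 _ _ _ _ hQ1).2.1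
      have hd := (h1 _ _ _ _ (h1 _ _ _ _ hQ1).2.2).2.1
      rcases hy' with rfl | rfl | rfl | rfl
      · exact absurd rfl hxy
      · exact ⟨_, _, hQ1, hu1⟩
      · exact ⟨_, _, hc, fun u => by rw [hu1]; clear * -; grind⟩
      · exact ⟨_, _, hd, fun u => by rw [hu1]; clear * -; grind⟩
    obtain ⟨c'', d'', hQ2, hu2⟩ := e2
    rcases (hu2 z).1 (by simpa using hz) with rfl | rfl | rfl | rfl
    · exact absurd rfl hxz
    · exact absurd rfl hyz
    · exact ⟨_, hQ2, by ext u; rw [hu2]; simp⟩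
    · exact ⟨_, (h1 _ _ _ _ hQ2).2.2, by ext u; rw [hu2]; simp only [Finset.mem_insert, Finset.mem_singleton]; clear * -; grind⟩
  have hne : ∀ x y z w, Q x y z w → (x ≠ y ∧ x ≠ z ∧ y ≠ z) ∧ (x ≠ w ∧ y ≠ w ∧ z ≠ w) := by
    intro x y z w hQ
    have e1 := hT _ _ _ ((h3 _ _ _).2 ⟨_, hQ⟩)
    have e2 := hT _ _ _ ((h3 _ _ _).2 ⟨_, (h1 _ _ _ _ hQ).2.2⟩)
    have e3 := hT _ _ _ ((h3 _ _ _).2 ⟨_, (h1 _ _ _ _ (h1 _ _ _ _ hQ).2.1).2.2⟩)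
    exact ⟨e1, e2.2.1, e2.2.2, e3.2.2⟩
  refine ⟨{b | ∃ x y z w, Q x y z w ∧ b = {x, y, z, w}}, ?_, ?_, ?_, ?_⟩
  · rintro _ ⟨x, y, z, w, hQ, rfl⟩
    obtain ⟨⟨e1, e2, e3⟩, e4, e5, e6⟩ := hne _ _ _ _ hQ
    simp [Finset.card_insert_of_notMem, e1, e2, e3, e4, e5, e6]
  · rintro _ ⟨a, b, c, d, hQ, rfl⟩ x y z h
    obtain ⟨w, hw, -⟩ := key a b c d hQ x y z h
    exact (h3 x y z).2 ⟨w, hw⟩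
  · intro x y z h
    obtain ⟨w, hw⟩ := (h3 x y z).1 h
    exact ⟨_, ⟨x, y, z, w, hw, rfl⟩, hT _ _ _ h, by simp, by simp, by simp⟩
  · rintro _ ⟨a, b, c, d, hQ, rfl⟩ _ ⟨a', b', c', d', hQ', rfl⟩ x y z h h'
    obtain ⟨w, hw, e⟩ := key a b c d hQ x y z h
    obtain ⟨w', hw', e'⟩ := key a' b' c' d' hQ' x y z h'
    rw [e, e', h2 _ _ _ _ _ hw hw']

end Design

section BlowUp

variable {P : Type} {𝓑 : Set (Set P)} {p q : P}

theorem Dec.comap_of_range {α β : Type} {T : α → α → α → Prop} (φ : β → α) (hφ : φ.Injective)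
    (hT : ∀ x y z, T x y z → z ∈ Set.range φ) (h : Dec T) :
    Dec fun a b c => T (φ a) (φ b) (φ c) := by
  obtain ⟨Q, h1, h2, h3⟩ := h
  refine ⟨fun a b c d => Q (φ a) (φ b) (φ c) (φ d), fun a b c d => h1 _ _ _ _,
    fun a b c d d' h h' => hφ (h2 _ _ _ _ _ h h'), fun a b c => (h3 _ _ _).trans ?_⟩
  constructor
  · rintro ⟨w, hw⟩
    obtain ⟨d, rfl⟩ := hT _ _ _ ((h3 _ _ _).2 ⟨_, (h1 _ _ _ _ hw).2.2⟩)
    exact ⟨d, hw⟩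
  · rintro ⟨d, hd⟩
    exact ⟨_, hd⟩

theorem Candelabra.of_offLines [Finite P] {k : ℕ} (hk : 0 < k) (h : Dec (OffLines 𝓑 p q (Fin 12)))
    (hex : ∀ x y z, x ≠ y → x ≠ z → y ≠ z → ∃ b ∈ 𝓑, x ∈ b ∧ y ∈ b ∧ z ∈ b)
    (hun : ∀ b ∈ 𝓑, ∀ b' ∈ 𝓑, ∀ x y z, x ≠ y → x ≠ z → y ≠ z → x ∈ b → y ∈ b → z ∈ b →
      x ∈ b' → y ∈ b' → z ∈ b' → b = b')
    (hpq : p ≠ q) (hline : ∀ b ∈ 𝓑, p ∈ b → q ∈ b → b.ncard = 4) (hP : Nat.card P = 2 * k + 2) :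
    Candelabra (Fin 24) (Fin 12) k 0 := by
  classical
  let P' := {x // p ≠ x ∧ q ≠ x}
  let κ := {b // b ∈ 𝓑 ∧ p ∈ b ∧ q ∈ b}
  have hβ : ∀ x : P', ∃ b : κ, x.1 ∈ b.1 := fun x => by
    obtain ⟨b, hb, h1, h2, h3⟩ := hex p q x.1 hpq x.2.1 x.2.2
    exact ⟨⟨b, hb, h1, h2⟩, h3⟩
  choose β hβ using hβ
  have hβ' : ∀ (x : P') (b : κ), x.1 ∈ b.1 ↔ β x = b := fun x b =>
    ⟨fun hx => Subtype.ext (hun _ (β x).2.1 _ b.2.1 p q x.1 hpq x.2.1 x.2.2 (β x).2.2.1 (β x).2.2.2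
      (hβ x) b.2.2.1 b.2.2.2 hx), fun hx => hx ▸ hβ x⟩
  have hfib : ∀ b : κ, Nonempty ({x // β x = b} ≃ Fin 2) := by
    intro b
    refine Finite.card_eq.1 ?_
    have e : {x // β x = b} ≃ ↥(b.1 \ {p, q}) :=
      ⟨fun x => ⟨x.1.1, (hβ' _ _).2 x.2, by simp [Ne.symm x.1.2.1, Ne.symm x.1.2.2]⟩,
        fun x => ⟨⟨x.1, fun hh => x.2.2 (by simp [hh]), fun hh => x.2.2 (by simp [hh])⟩,
          (hβ' _ _).1 x.2.1⟩, fun _ => rfl, fun _ => rfl⟩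
    rw [Nat.card_congr e, Nat.card_coe_set_eq, Set.ncard_sdiff (by
      rintro x (rfl | rfl)
      exacts [b.2.2.1, b.2.2.2]), Set.ncard_pair hpq, hline b.1 b.2.1 b.2.2.1 b.2.2.2]
    simp
  have f : ∀ b : κ, {x // β x = b} ≃ Fin 2 := fun b => (hfib b).some
  let e : P' ≃ κ × Fin 2 := (Equiv.sigmaFiberEquiv β).symm.trans
    ((Equiv.sigmaCongrRight f).trans (Equiv.sigmaEquivProd _ _))
  have he : ∀ t, β (e.symm t) = t.1 := fun t => by
    conv_rhs => rw [← e.apply_symm_apply t]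
    rfl
  let ψ : Pt κ (Fin 2 × Fin 12) (Fin 12) → P × Fin 12 :=
    Sum.elim (fun t => ((e.symm (t.1, t.2.1)).1, t.2.2)) fun w => (p, w)
  have hψ : ψ.Injective := by
    rintro (⟨b, j, w⟩ | w) (⟨b', j', w'⟩ | w') hh
    · obtain ⟨h1, h2⟩ := Prod.ext_iff.1 hh
      have h1 := e.symm.injective (Subtype.ext h1)
      simp only [ψ, Sum.elim_inl, Prod.mk.injEq] at h1 h2
      obtain ⟨rfl, rfl⟩ := h1
      rw [h2]
    · exact absurd (Prod.ext_iff.1 hh).1.symm (e.symm (b, j)).2.1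
    · exact absurd (Prod.ext_iff.1 hh).1 (e.symm (b', j')).2.1
    · exact congrArg Sum.inr (Prod.ext_iff.1 hh).2
  have hq : ∀ x, (ψ x).1 ≠ q := by
    rintro (⟨b, j, w⟩ | w)
    · exact (e.symm (b, j)).2.2.symm
    · exact hpq
  have hIn : ∀ (b : κ) x, x.In (· = b) ↔ (ψ x).1 ∈ b.1 := by
    rintro b (⟨b', j, w⟩ | w)
    · simp only [ψ, Sum.elim_inl, hβ', he]
      rfl
    · exact iff_of_true trivial b.2.2.1
  have h1 : Nat.card P' = Nat.card κ * 2 := by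
    rw [Nat.card_congr e, Nat.card_prod, Nat.card_fin]
  have h2 : Nat.card P' = Nat.card P - 2 := by
    have e2 : P' ≃ ↥({p, q}ᶜ : Set P) := Equiv.subtypeEquivRight fun x => by
      simp [not_or, eq_comm]
    rw [Nat.card_congr e2, Nat.card_coe_set_eq, Set.ncard_compl, Set.ncard_pair hpq]
  have : Nonempty κ := Nat.card_pos_iff.1 (by omega) |>.1
  have H : Dec (CTri κ (Fin 2 × Fin 12) (Fin 12) fun _ => False) := by
    refine (Dec.comap_of_range ψ hψ ?_ h).congr fun x y z => ?_
    · rintro x y ⟨z, w⟩ ⟨-, ⟨-, -, hz⟩, -⟩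
      by_cases hzp : p = z
      · subst hzp
        exact ⟨.inr w, rfl⟩
      · exact ⟨.inl ((e ⟨z, hzp, hz.symm⟩).1, (e ⟨z, hzp, hz.symm⟩).2, w), by simp [ψ]⟩
    · simp only [CTri, OffLines, ne_eq, hψ.eq_iff, hIn]
      refine and_congr_right fun _ => ⟨fun ⟨h, _⟩ => ⟨⟨hq x, hq y, hq z⟩,
        fun b hb hp hq => h ⟨b, hb, hp, hq⟩⟩, fun ⟨_, h⟩ => ⟨fun b => h b b.2.1 b.2.2.1 b.2.2.2, ?_⟩⟩
      rintro ⟨hx, hy, hz⟩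
      obtain ⟨b⟩ := this
      exact h b b.2.1 b.2.2.1 b.2.2.2 ⟨(hIn b x).1 (hx.mono fun _ => False.elim),
        (hIn b y).1 (hy.mono fun _ => False.elim), (hIn b z).1 (hz.mono fun _ => False.elim)⟩
  refine (H.cTri_equiv (.refl _) finProdFinEquiv (.refl _) fun _ => Iff.rfl).candelabra ?_
    (Nat.zero_le _) (by simp)
  omega

end BlowUp

section Spread

theorem Candelabra.of_spread {m s k : ℕ} (h : Dec (Spread (κ := Fin m) (W := Fin s)))
    (hs : s = 1 ∨ s = 6) (hm : 2 ≤ m) (hk : 0 < k) (hP : m * s = 2 * k + 2) :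
    Candelabra (Fin 24) (Fin 12) k 0 := by
  obtain ⟨𝓓, h1, h2, h3, h4⟩ := h.exists_design fun _ _ _ h => h.1
  let 𝓑 : Set (Set (Fin m × Fin s)) :=
    {b | (∃ c ∈ 𝓓, b = c) ∨ s = 6 ∧ ∃ i, b = {x | x.1 = i}}
  have hs0 : 0 < s := by omega
  let p : Fin m × Fin s := (⟨0, by omega⟩, ⟨0, hs0⟩)
  let q : Fin m × Fin s := (⟨1, by omega⟩, ⟨0, hs0⟩)
  have hpq : p.1 ≠ q.1 := by simp [p, q]
  have hline : ∀ c ∈ 𝓓, (c : Set (Fin m × Fin s)).ncard = 4 := fun c hc => by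
    rw [Set.ncard_coe_finset, h1 c hc]
  have hex : ∀ x y z, x ≠ y → x ≠ z → y ≠ z → ∃ b ∈ 𝓑, x ∈ b ∧ y ∈ b ∧ z ∈ b := by
    intro x y z hxy hxz hyz
    by_cases hx : x.1 = y.1 ∧ x.1 = z.1
    · rcases hs with rfl | rfl
      · exact absurd (Prod.ext hx.1 (Subsingleton.elim _ _)) hxy
      · exact ⟨{u | u.1 = x.1}, .inr ⟨rfl, _, rfl⟩, rfl, hx.1.symm, hx.2.symm⟩
    · obtain ⟨c, hc, -, hxc, hyc, hzc⟩ := h3 x y z ⟨⟨hxy, hxz, hyz⟩, hx⟩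
      exact ⟨c, .inl ⟨c, hc, rfl⟩, hxc, hyc, hzc⟩
  have hun : ∀ b ∈ 𝓑, ∀ b' ∈ 𝓑, ∀ x y z, x ≠ y → x ≠ z → y ≠ z → x ∈ b → y ∈ b → z ∈ b →
      x ∈ b' → y ∈ b' → z ∈ b' → b = b' := by
    rintro _ (⟨c, hc, rfl⟩ | ⟨-, i, rfl⟩) _ (⟨c', hc', rfl⟩ | ⟨-, i', rfl⟩) x y z hxy hxz hyz hx hy hz
      hx' hy' hz'
    · rw [h4 c hc c' hc' x y z ⟨⟨hxy, hxz, hyz⟩, hx, hy, hz⟩ ⟨⟨hxy, hxz, hyz⟩, hx', hy', hz'⟩]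
    · exact absurd ⟨hx'.trans hy'.symm, hx'.trans hz'.symm⟩
        (h2 c hc x y z ⟨⟨hxy, hxz, hyz⟩, hx, hy, hz⟩).2
    · exact absurd ⟨hx.trans hy.symm, hx.trans hz.symm⟩
        (h2 c' hc' x y z ⟨⟨hxy, hxz, hyz⟩, hx', hy', hz'⟩).2
    · rw [← show x.1 = i from hx, ← show x.1 = i' from hx']
  refine Candelabra.of_offLines hk (Dec.offLines hex hun ?_ (fun e => hpq (congrArg Prod.fst e)) ?_)
    hex hun (fun e => hpq (congrArg Prod.fst e)) ?_ (by simpa using hP)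
  · rintro _ (⟨c, hc, rfl⟩ | ⟨rfl, i, rfl⟩)
    · exact .inl (hline c hc)
    · right
      rw [show {x : Fin m × Fin 6 | x.1 = i} = Set.range (Prod.mk i) by
        ext ⟨a, b⟩; simp [eq_comm], Set.ncard_range_of_injective (Prod.mk_right_injective i)]
      simp
  · simp only [Nat.card_eq_fintype_card, Fintype.card_prod, Fintype.card_fin]
    omega
  · rintro _ (⟨c, hc, rfl⟩ | ⟨-, i, rfl⟩) hp hq
    · exact hline c hc
    · exact absurd (hp.trans hq.symm) hpq

theorem Candelabra.twentyFour_twelve {k : ℕ} (hk : 3 ≤ k) : Candelabra (Fin 24) (Fin 12) k 0 := by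
  have spread {A : Type} {m : ℕ} (H : Candelabra A Empty m 0) : Dec (Spread (κ := Fin m) (W := A)) :=
    Dec.spread_of_cTri (fun i => Nat.not_lt_zero i.val) H
  refine Candelabra.twentyFour ?_ ?_ (fun m hm => ?_) k (by omega) (by omega)
  · exact .of_spread (spread Candelabra.one_ten) (.inl rfl) (by omega) (by omega) (by omega)
  · exact .of_spread (spread Candelabra.one_fourteen) (.inl rfl) (by omega) (by omega) (by omega)
  · exact .of_spread (spread (Candelabra.six .six_five .six_seven .six_nine m).2) (.inr rfl) hm
      (by omega) (by omega)

end Spread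

section Count

variable {α : Type}

theorem Finset.card_filter_mem_mul_six [DecidableEq α] [Fintype α] {D : Finset (Finset α)}
    {T : α → α → α → Prop} (h1 : ∀ b ∈ D, b.card = 4)
    (h2 : ∀ b ∈ D, ∀ x y z, b.Triple x y z → T x y z)
    (h3 : ∀ x y z, T x y z → ∃ b ∈ D, b.Triple x y z)
    (h4 : ∀ b ∈ D, ∀ b' ∈ D, ∀ x y z, b.Triple x y z → b'.Triple x y z → b = b') (x : α) :
    Nat.card {p : α × α // T x p.1 p.2} = 6 * (D.filter (x ∈ ·)).card := by
  have hmem : ∀ (b : Finset α) (p : α × α), x ∈ b →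
      (p ∈ (b.erase x).offDiag ↔ b.Triple x p.1 p.2) := by
    intro b p hx
    simp only [Finset.mem_offDiag, Finset.mem_erase, Finset.Triple]
    grind
  have e : {p : α × α | T x p.1 p.2} =
      ((D.filter (x ∈ ·)).biUnion fun b => (b.erase x).offDiag : Finset (α × α)) := by
    ext p
    simp only [Set.mem_ofPred_eq, Finset.coe_biUnion, Finset.coe_filter, Set.mem_iUnion, exists_prop,
      Finset.mem_coe]
    constructor
    · intro h
      obtain ⟨b, hb, ht⟩ := h3 _ _ _ h
      exact ⟨b, ⟨hb, ht.2.1⟩, (hmem b p ht.2.1).2 ht⟩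
    · rintro ⟨b, ⟨hb, hx⟩, hp⟩
      exact h2 b hb _ _ _ ((hmem b p hx).1 hp)
  change Nat.card ↥{p : α × α | T x p.1 p.2} = _
  rw [Nat.card_coe_set_eq, e, Set.ncard_coe_finset, Finset.card_biUnion, mul_comm]
  · refine Finset.sum_const_nat fun b hb => ?_
    obtain ⟨hb, hx⟩ := Finset.mem_filter.1 hb
    rw [Finset.offDiag_card, Finset.card_erase_of_mem hx, h1 b hb]
  · intro b hb b' hb' hne
    obtain ⟨hb, hx⟩ := Finset.mem_filter.1 hb
    obtain ⟨hb', hx'⟩ := Finset.mem_filter.1 hb'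
    exact Finset.disjoint_left.2 fun p hp hp' =>
      hne (h4 b hb b' hb' _ _ _ ((hmem b p hx).1 hp) ((hmem b' p hx').1 hp'))

theorem Finset.sum_card_filter_mem [DecidableEq α] [Fintype α] {D : Finset (Finset α)} {m : ℕ}
    (h : ∀ b ∈ D, b.card = m) : ∑ x, (D.filter (x ∈ ·)).card = D.card * m := by
  rw [← Finset.sum_const_nat h]
  refine (Finset.sum_card_bipartiteAbove_eq_sum_card_bipartiteBelow (s := Finset.univ) (t := D)
    (fun x b => x ∈ b)).trans (Finset.sum_congr rfl fun b _ => ?_)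
  simp [Finset.bipartiteBelow]

/-- Deleting a point from a design. -/
theorem Dec.exists_pack [Fintype α] {T : α → α → α → Prop} (h : Dec T)
    (hT : ∀ x y z, T x y z → x ≠ y ∧ x ≠ z ∧ y ≠ z) {d : α → ℕ}
    (hd : ∀ x, Nat.card {p : α × α // T x p.1 p.2} = 6 * d x) (o : α) {N : ℕ}
    (hN : 4 * (N + d o) = ∑ x, d x) :
    Pack (fun x y z => T x y z ∧ x ≠ o ∧ y ≠ o ∧ z ≠ o) N := by
  classical
  obtain ⟨𝓑, h1, h2, h3, h4⟩ := h.exists_design hT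
  set D := 𝓑.toFinset with hD
  simp only [← Set.mem_toFinset, ← hD] at h1 h2 h3 h4
  have hr : ∀ x, (D.filter (x ∈ ·)).card = d x := fun x => by
    have := Finset.card_filter_mem_mul_six h1 h2 h3 h4 x
    rw [hd] at this
    omega
  refine ⟨D.filter (o ∉ ·), ?_, fun b hb => h1 b (Finset.mem_filter.1 hb).1, ?_, ?_⟩
  · have e1 := Finset.card_filter_add_card_filter_not (s := D) (o ∈ ·)
    have e2 := Finset.sum_card_filter_mem h1
    rw [Finset.sum_congr rfl fun x _ => hr x, ← hN] at e2
    rw [hr] at e1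
    omega
  · intro b hb x y z h
    obtain ⟨hb, ho⟩ := Finset.mem_filter.1 hb
    exact ⟨h2 b hb x y z h, fun e => ho (e ▸ h.2.1), fun e => ho (e ▸ h.2.2.1),
      fun e => ho (e ▸ h.2.2.2)⟩
  · exact fun b hb b' hb' => h4 b (Finset.mem_filter.1 hb).1 b' (Finset.mem_filter.1 hb').1

theorem Pack.comap {β : Type} {T : β → β → β → Prop} {N : ℕ} (φ : α ↪ β) (h : Pack T N)
    (hT : ∀ x y z, T x y z → x ∈ Set.range φ) :
    Pack (fun x y z => T (φ x) (φ y) (φ z)) N := by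
  classical
  obtain ⟨B, h1, h2, h3, h4⟩ := h
  have hr : ∀ b ∈ B, (b.preimage φ φ.injective.injOn).map φ = b := fun b hb => by
    ext x
    simp only [Finset.mem_map, Finset.mem_preimage]
    refine ⟨by rintro ⟨a, ha, rfl⟩; exact ha, fun hx => ?_⟩
    obtain ⟨y, hy, z, hz, hyz⟩ := Finset.one_lt_card.1
      (show 1 < (b.erase x).card by rw [Finset.card_erase_of_mem hx, h2 b hb]; decide)
    obtain ⟨hxy, hy⟩ := Finset.mem_erase.1 hy
    obtain ⟨hxz, hz⟩ := Finset.mem_erase.1 hz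
    obtain ⟨a, rfl⟩ := hT _ _ _ (h3 b hb x y z ⟨⟨hxy.symm, hxz.symm, hyz⟩, hx, hy, hz⟩)
    exact ⟨a, hx, rfl⟩
  have ht : ∀ {b : Finset β} {x y z}, (b.preimage φ φ.injective.injOn).Triple x y z →
      b.Triple (φ x) (φ y) (φ z) := by
    rintro b x y z ⟨⟨h1, h2, h3⟩, hx, hy, hz⟩
    exact ⟨⟨φ.injective.ne h1, φ.injective.ne h2, φ.injective.ne h3⟩, Finset.mem_preimage.1 hx,
      Finset.mem_preimage.1 hy, Finset.mem_preimage.1 hz⟩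
  refine ⟨B.image fun b => b.preimage φ φ.injective.injOn, ?_, ?_, ?_, ?_⟩
  · rw [Finset.card_image_of_injOn, h1]
    intro b hb b' hb' e
    rw [← hr b hb, ← hr b' hb']
    exact congrArg (Finset.map φ) e
  · simp only [Finset.mem_image]
    rintro _ ⟨b, hb, rfl⟩
    rw [← Finset.card_map φ, hr b hb, h2 b hb]
  · simp only [Finset.mem_image]
    rintro _ ⟨b, hb, rfl⟩ x y z h
    exact h3 b hb _ _ _ (ht h)
  · simp only [Finset.mem_image]
    rintro _ ⟨b, hb, rfl⟩ _ ⟨b', hb', rfl⟩ x y z h h'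
    rw [h4 b hb b' hb' _ _ _ (ht h) (ht h')]

end Count

section Lifting

variable {κ A S : Type}

theorem CTri.natCard_group [Fintype κ] [Fintype A] [Fintype S] (i : κ) (a : A) :
    Nat.card {p : Pt κ A S × Pt κ A S // CTri κ A S (fun _ => False) (.inl (i, a)) p.1 p.2} +
      (Fintype.card A + Fintype.card S - 1) * (Fintype.card A + Fintype.card S - 2) =
      (Fintype.card κ * Fintype.card A + Fintype.card S - 1) *
        (Fintype.card κ * Fintype.card A + Fintype.card S - 2) := by
  classical
  let x : Pt κ A S := .inl (i, a)
  let G : Finset (Pt κ A S) := Finset.univ.filter fun y => y.In (· = i)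
  have hGm : ∀ y, y ∈ G ↔ y.In (· = i) := fun y => by
    simp only [G, Finset.mem_filter, Finset.mem_univ, true_and]
  have hG : G.card = Fintype.card A + Fintype.card S := by
    have : G = (Finset.univ : Finset (A ⊕ S)).map
        ⟨Sum.map (Prod.mk i) id, (Prod.mk_right_injective i).sumMap Function.injective_id⟩ := by
      ext (⟨j, b⟩ | s)
      · simp [hGm, Pt.In, eq_comm]
      · simp [hGm, Pt.In]
    rw [this, Finset.card_map, Finset.card_univ, Fintype.card_sum]
  have hx : x ∈ G := (hGm x).2 rfl
  have hmem : ∀ p : Pt κ A S × Pt κ A S, CTri κ A S (fun _ => False) x p.1 p.2 ↔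
      p ∈ (Finset.univ.erase x).offDiag \ (G.erase x).offDiag := by
    intro p
    have h1 : ∀ j, x.In (· = j) ↔ i = j := fun j => Iff.rfl
    have h2 : ¬ x.In fun _ => False := id
    simp only [CTri, h1, h2, false_and, not_false_eq_true, and_true, Finset.mem_sdiff,
      Finset.mem_offDiag, Finset.mem_erase, Finset.mem_univ, hGm]
    rw [show (∀ j, ¬ (i = j ∧ p.1.In (· = j) ∧ p.2.In (· = j))) ↔
      ¬ (p.1.In (· = i) ∧ p.2.In (· = i)) from ⟨fun h h' => h i ⟨rfl, h'⟩,
        fun h j ⟨e, h'⟩ => h (e ▸ h')⟩]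
    tauto
  have hc : ∀ n, n * n - n = n * (n - 1) := fun n => by rw [Nat.mul_sub, mul_one]
  rw [Nat.card_congr (Equiv.subtypeEquivRight hmem), Nat.card_eq_fintype_card, Fintype.card_coe]
  rw [show (Fintype.card A + Fintype.card S - 1) * (Fintype.card A + Fintype.card S - 2) =
      (G.erase x).offDiag.card by
      rw [Finset.offDiag_card, Finset.card_erase_of_mem hx, hG, hc, Nat.sub_sub]]
  rw [Finset.card_sdiff_add_card_eq_card (Finset.offDiag_mono (Finset.erase_subset_erase _
    (Finset.subset_univ _))), Finset.offDiag_card, Finset.card_erase_of_mem (Finset.mem_univ _), hc,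
    Finset.card_univ, Fintype.card_sum, Fintype.card_prod, Nat.sub_sub]

theorem CTri.natCard_stem [Fintype κ] [Fintype A] [Nonempty κ] (s : S) :
    Nat.card {p : Pt κ A S × Pt κ A S // CTri κ A S (fun _ => False) (.inr s) p.1 p.2} =
      Fintype.card κ * (Fintype.card κ - 1) * (Fintype.card A * Fintype.card A) := by
  classical
  let f : {q : κ × κ // q.1 ≠ q.2} × A × A →
      {p : Pt κ A S × Pt κ A S // CTri κ A S (fun _ => False) (.inr s) p.1 p.2} :=
    fun t => ⟨(.inl (t.1.1.1, t.2.1), .inl (t.1.1.2, t.2.2)), by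
      refine ⟨⟨Sum.inr_ne_inl, Sum.inr_ne_inl, fun e => t.1.2 ?_⟩, ?_, fun h => h.2.1⟩
      · exact congrArg Prod.fst (Sum.inl_injective e)
      · rintro i ⟨-, h1, h2⟩
        exact t.1.2 (Eq.trans h1 (Eq.symm h2))⟩
  have hf : f.Bijective := by
    constructor
    · rintro ⟨⟨⟨i, j⟩, h⟩, a, b⟩ ⟨⟨⟨i', j'⟩, h'⟩, a', b'⟩ e
      cases e
      rfl
    · obtain ⟨i₀⟩ := ‹Nonempty κ›
      rintro ⟨⟨⟨i, a⟩ | u, ⟨j, b⟩ | v⟩, h⟩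
      · refine ⟨(⟨(i, j), fun e => h.2.1 i ⟨trivial, rfl, Eq.symm e⟩⟩, a, b), rfl⟩
      · exact absurd ⟨trivial, rfl, trivial⟩ (h.2.1 i)
      · exact absurd ⟨trivial, trivial, rfl⟩ (h.2.1 j)
      · exact absurd ⟨trivial, trivial, trivial⟩ (h.2.1 i₀)
  rw [← Nat.card_eq_of_bijective f hf, Nat.card_prod, Nat.card_prod, Nat.card_eq_fintype_card,
    Nat.card_eq_fintype_card, Fintype.card_subtype]
  congr 1
  rw [show Finset.univ.filter (fun q : κ × κ => q.1 ≠ q.2) = Finset.univ.offDiag by ext; simp,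
    Finset.offDiag_card, Finset.card_univ, Nat.mul_sub, mul_one]

end Lifting

theorem Candelabra.pack {k : ℕ} (hk : 0 < k) (h : Candelabra (Fin 24) (Fin 12) k 0) (o : Fin 12) :
    Pack (fun x y z => CTri (Fin k) (Fin 24) (Fin 12) (fun _ => False) x y z ∧
      x ≠ .inr o ∧ y ≠ .inr o ∧ z ≠ .inr o) (24 * k * (k - 1) * (24 * k + 53)) := by
  have : NeZero k := ⟨hk.ne'⟩
  obtain ⟨j, rfl⟩ : ∃ j, k = j + 1 := ⟨k - 1, by omega⟩
  refine Dec.exists_pack (d := Sum.elim (fun _ => 4 * j * (24 * j + 69)) fun _ => 96 * (j + 1) * j)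
    (h.congr fun x y z => ⟨fun h => h.mono fun i hi => (Nat.not_lt_zero _ hi).elim,
      fun h => h.mono fun _ => False.elim⟩) (fun _ _ _ h => h.1) ?_ _ ?_
  · rintro (⟨i, a⟩ | s)
    · have := CTri.natCard_group (κ := Fin (j + 1)) (S := Fin 12) i a
      simp only [Fintype.card_fin] at this
      rw [show (j + 1) * 24 + 12 - 1 = 24 * j + 35 by omega,
        show (j + 1) * 24 + 12 - 2 = 24 * j + 34 by omega] at this
      simp only [Sum.elim_inl]
      nlinarith
    · rw [CTri.natCard_stem]
      simp only [Fintype.card_fin, Sum.elim_inr, Nat.add_sub_cancel]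
      ring
  · simp only [Fintype.sum_sum_type, Sum.elim_inl, Sum.elim_inr, Finset.sum_const, Finset.card_univ,
      Fintype.card_prod, Fintype.card_fin, smul_eq_mul, Nat.add_sub_cancel]
    ring

/-- The points of a group together with the stem, with `0, …, 10` in the stem. -/
def Pt.ofGroup {κ : Type} (i : κ) (u : Fin 35) : Pt κ (Fin 24) (Fin 12) :=
  if h : u.val < 11 then .inr ⟨u, by omega⟩ else .inl (i, ⟨u - 11, by omega⟩)

theorem Pt.ofGroup_injective {κ : Type} (i : κ) : (Pt.ofGroup i).Injective := by
  intro u v h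
  simp only [Pt.ofGroup] at h
  split_ifs at h with h1 h2 h2
  · have := Fin.ext_iff.1 (Sum.inr.inj h)
    exact Fin.ext this
  · have := Fin.ext_iff.1 (Prod.ext_iff.1 (Sum.inl_injective h)).2
    exact Fin.ext (by simp only at this; omega)

theorem Pack.fin {k : ℕ} (hk : 3 ≤ k) :
    Pack (fun _ _ _ : Fin (24 * k + 11) => True) (24 * k * (k - 1) * (24 * k + 53) + (k * 1548 + 35)) := by
  let o : Fin 12 := Fin.last 11
  let X := Pt (Fin k) (Fin 24) (Fin 12)
  let stem : X → Prop := fun x => x.In fun _ => False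
  let grp : Fin k → X → Prop := fun i x => x.In (· = i)
  have hin : ∀ i u, grp i (Pt.ofGroup i u) ∧ Pt.ofGroup i u ≠ .inr o ∧
      (stem (Pt.ofGroup i u) → u.val < 11) := by
    intro i u
    simp only [Pt.ofGroup]
    split_ifs with h
    · refine ⟨trivial, fun e => ?_, fun _ => h⟩
      have := Fin.ext_iff.1 (Sum.inr_injective e)
      simp only [o, Fin.val_last] at this
      omega
    · exact ⟨rfl, Sum.inl_ne_inr, False.elim⟩
  have P1 := Candelabra.pack (by omega) (Candelabra.twentyFour_twelve hk) o
  have P2 := Pack.iUnion (R := fun (i : Fin k) (x y z : X) => (x ≠ .inr o ∧ y ≠ .inr o ∧ z ≠ .inr o) ∧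
    (grp i x ∧ grp i y ∧ grp i z) ∧ ¬ (stem x ∧ stem y ∧ stem z))
    (fun i => (Pack.thirtyFive.map ⟨_, Pt.ofGroup_injective i⟩).mono ?group) ?uniq
  have P3 := (Pack.eleven.map (Fin.castSuccEmb.trans Function.Embedding.inr)).mono
    (T' := fun x y z : X => (x ≠ .inr o ∧ y ≠ .inr o ∧ z ≠ .inr o) ∧ (stem x ∧ stem y ∧ stem z)) ?st
  have P := P1.or (P2.or P3 ?d1) ?d2
  case group =>
    rintro x y z - ⟨a, b, c, rfl, rfl, rfl, h⟩
    exact ⟨⟨(hin i a).2.1, (hin i b).2.1, (hin i c).2.1⟩, ⟨(hin i a).1, (hin i b).1, (hin i c).1⟩,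
      fun ⟨ha, hb, hc⟩ => h ⟨(hin i a).2.2 ha, (hin i b).2.2 hb, (hin i c).2.2 hc⟩⟩
  case uniq =>
    rintro i j x y z ⟨-, ⟨hx, hy, hz⟩, hs⟩ ⟨-, ⟨hx', hy', hz'⟩, -⟩
    by_contra hij
    have key : ∀ x : X, grp i x → grp j x → stem x := by
      rintro (⟨l, a⟩ | s) h h'
      · exact hij (Eq.trans (Eq.symm h) h')
      · trivial
    exact hs ⟨key x hx hx', key y hy hy', key z hz hz'⟩
  case st =>
    rintro x y z - ⟨a, b, c, rfl, rfl, rfl, -⟩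
    have ho : ∀ a : Fin 11, (Sum.inr a.castSucc : X) ≠ .inr o := fun a e =>
      a.castSucc_ne_last (Sum.inr_injective e)
    exact ⟨⟨ho a, ho b, ho c⟩, trivial, trivial, trivial⟩
  case d1 =>
    rintro x y z ⟨i, -, -, h⟩ ⟨-, h'⟩
    exact h h'
  case d2 =>
    rintro x y z ⟨h, -⟩ (⟨i, -, h', -⟩ | ⟨-, h'⟩)
    · exact h.2.1 i h'
    · exact h.2.2 h'
  rw [Fintype.card_fin] at P
  let E : Fin (24 * k + 11) ≃ {x : X // x ≠ .inr o} := Fintype.equivOfCardEq (by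
    rw [Fintype.card_fin, Fintype.card_subtype_compl, Fintype.card_subtype_eq]
    simp only [X, Fintype.card_sum, Fintype.card_prod, Fintype.card_fin]
    omega)
  refine (P.comap (E.toEmbedding.trans (Function.Embedding.subtype _)) ?_).mono fun _ _ _ _ _ => trivial
  rintro x y z h
  have hx : x ≠ .inr o := by
    rcases h with h | ⟨i, h⟩ | h
    exacts [h.2.1, h.1.1, h.1.1]
  exact ⟨E.symm ⟨x, hx⟩, by simp⟩

section JohnsonBound

theorem Finset.card_mul_le_of_card_filter_le {α : Type} [DecidableEq α] [Fintype α]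
    {D : Finset (Finset α)} {m r : ℕ} {s : Finset α} (h : ∀ b ∈ D, b.card = m)
    (hr : ∀ x ∉ s, (D.filter (x ∈ ·)).card ≤ r) :
    D.card * m ≤ s.card * D.card + (Fintype.card α - s.card) * r := by
  rw [← Finset.sum_card_filter_mem h, ← Finset.sum_add_sum_compl s, ← Finset.card_compl]
  refine Nat.add_le_add (Finset.sum_le_card_nsmul _ _ _ fun x _ => Finset.card_filter_le _ _)
    (Finset.sum_le_card_nsmul _ _ _ fun x hx => hr x (Finset.mem_compl.1 hx))

theorem IsPQS.card_le {n : ℕ} {B : Finset (Finset (Fin n))} (h : IsPQS n B) :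
    B.card ≤ n * ((n - 1) * ((n - 2) / 2) / 3) / 4 := by
  have h4 : ∀ p : Finset (Fin n) → Prop, [DecidablePred p] → ∀ b ∈ B.filter p, b.card = 4 :=
    fun p _ b hb => h.1 b (Finset.mem_filter.1 hb).1
  have h2 : ∀ x y, x ≠ y → (B.filter fun b => {x, y} ⊆ b).card ≤ (n - 2) / 2 := by
    intro x y hxy
    have := Finset.card_mul_le_of_card_filter_le (r := 1)
      (h4 fun b => {x, y} ⊆ b) fun z hz => by
        refine le_trans (Finset.card_le_card fun b hb => ?_) (h.2 {z, x, y} (by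
          rw [Finset.card_insert_of_notMem hz, Finset.card_pair hxy]))
        simp only [Finset.mem_filter] at hb ⊢
        exact ⟨hb.1.1, Finset.insert_subset hb.2 hb.1.2⟩
    rw [Finset.card_pair hxy, Fintype.card_fin] at this
    omega
  have h1 : ∀ x, (B.filter fun b => {x} ⊆ b).card ≤ (n - 1) * ((n - 2) / 2) / 3 := by
    intro x
    have := Finset.card_mul_le_of_card_filter_le (s := {x}) (r := (n - 2) / 2)
      (h4 fun b => {x} ⊆ b) fun y hy => by
        refine le_trans (Finset.card_le_card fun b hb => ?_) (h2 y x (mt Finset.mem_singleton.2 hy))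
        simp only [Finset.mem_filter] at hb ⊢
        exact ⟨hb.1.1, Finset.insert_subset hb.2 hb.1.2⟩
    rw [Finset.card_singleton, Fintype.card_fin] at this
    omega
  have := Finset.card_mul_le_of_card_filter_le (s := ∅) h.1
    fun x _ => by simpa only [Finset.singleton_subset_iff] using h1 x
  rw [Finset.card_empty, Fintype.card_fin, Nat.sub_zero, zero_mul, zero_add] at this
  omega

theorem Pack.exists_isPQS {n N : ℕ} {T : Fin n → Fin n → Fin n → Prop} (h : Pack T N) :
    ∃ B, IsPQS n B ∧ B.card = N := by
  obtain ⟨B, h1, h2, -, h4⟩ := h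
  refine ⟨B, ⟨h2, fun t ht => Finset.card_le_one.2 fun b hb b' hb' => ?_⟩, h1⟩
  obtain ⟨x, y, z, hxy, hxz, hyz, rfl⟩ := Finset.card_eq_three.1 ht
  simp only [Finset.mem_filter, Finset.insert_subset_iff, Finset.singleton_subset_iff] at hb hb'
  exact h4 b hb.1 b' hb'.1 x y z ⟨⟨hxy, hxz, hyz⟩, hb.2⟩ ⟨⟨hxy, hxz, hyz⟩, hb'.2⟩

theorem johnsonBound_24k_add_11 (k : ℕ) :
    johnsonBound (24 * k + 11) = 576 * k ^ 3 + 696 * k ^ 2 + 276 * k + 35 := by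
  rw [johnsonBound, if_neg (by omega), show (24 * k + 11 - 2) / 2 = 12 * k + 4 by omega,
    show 24 * k + 11 - 1 = 24 * k + 10 by omega,
    show (24 * k + 10) * (12 * k + 4) = 3 * (96 * k ^ 2 + 72 * k + 13) + 1 by ring,
    show (3 * (96 * k ^ 2 + 72 * k + 13) + 1) / 3 = 96 * k ^ 2 + 72 * k + 13 by omega,
    show (24 * k + 11) * (96 * k ^ 2 + 72 * k + 13) =
      4 * (576 * k ^ 3 + 696 * k ^ 2 + 276 * k + 35) + 3 by ring]
  omega

end JohnsonBound

/-- For every k ≥ 3, A(24k+11,4,4) = J(24k+11,4,4)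
= ((24k+11)³ - 4(24k+11)² + (24k+11) - 18)/24. -/
theorem packingNumber_24k_add_11 (k : ℕ) (hk : 3 ≤ k) :
    packingNumber (24 * k + 11) = johnsonBound (24 * k + 11) ∧
    johnsonBound (24 * k + 11) =
      ((24 * k + 11) ^ 3 - 4 * (24 * k + 11) ^ 2 + (24 * k + 11) - 18) / 24 := by
  have hJ := johnsonBound_24k_add_11 k
  refine ⟨IsGreatest.csSup_eq ⟨?_, ?_⟩, ?_⟩
  · obtain ⟨B, hB, hc⟩ := (Pack.fin hk).exists_isPQS
    refine ⟨B, hB, hc.trans ?_⟩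
    obtain ⟨j, rfl⟩ : ∃ j, k = j + 1 := ⟨k - 1, by omega⟩
    rw [hJ, Nat.add_sub_cancel]
    ring
  · rintro _ ⟨B, hB, rfl⟩
    refine hB.card_le.trans ?_
    rw [johnsonBound, if_neg (by omega)]
  · rw [hJ]
    have e : (24 * k + 11) ^ 3 = 4 * (24 * k + 11) ^ 2 +
        (24 * (576 * k ^ 3 + 696 * k ^ 2 + 276 * k + 35) + 18 - (24 * k + 11)) := by
      zify [show 24 * k + 11 ≤ 24 * (576 * k ^ 3 + 696 * k ^ 2 + 276 * k + 35) + 18 by nlinarith]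
      ring
    rw [e]
    omega
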